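/- Let (R, m) be a d-dimensional complete Noetherian local domain of prime characteristic p with absolute integral closure R^+, let Λ be a set of indeterminates, and let T = R^+(t_λ : λ ∈ Λ). Let x_1, …, x_d be a system of parameters of R, choose pairwise distinct indices λ_1, …, λ_{d−1} ∈ Λ, and set z_i = x_i − t_{λ_i} x_{i+1} for 1 ≤ i < d. Fix 0 ≤ n ≤ d − 1 and let {y_1, …, y_h} and {w_1, …, w_l} be two subsets of X_n := {x_{n+2}, x_{n+3}, …, x_d} (so 0 ≤ h, l ≤ d − n − 1). Then: (1) y_1, …, y_h, z_1, …, z_n, x_{n+1} is a regular sequence on T; and (2) ⋂_{N ≥ 1} ( (y_1, …, y_h, z_1, …, z_n)T + ((x_{n+1}, w_1, …, w_l)T)^N ) = (y_1, …, y_h, z_1, …, z_n)T. -/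

import Mathlib

open IsLocalRing TensorProduct
set_option synthInstance.maxHeartbeats 1000000
set_option maxHeartbeats 1000000

/-- The absolute integral closure `R⁺` of a domain `R`: the integral closure of `R`
in an algebraic closure of its fraction field. -/
noncomputable abbrev RPlus (R : Type) [CommRing R] [IsDomain R] : Type :=
  ↥(integralClosure R (AlgebraicClosure (FractionRing R)))

/-- A system of parameters of a local ring: `d` elements generating an ideal whose
radical is the maximal ideal, where `d` is the Krull dimension. -/
def IsSOP (R : Type) [CommRing R] [IsLocalRing R] {d : ℕ} (x : Fin d → R) : Prop :=
  ringKrullDim R = d ∧ (Ideal.span (Set.range x)).radical = maximalIdeal R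

/-- `T = R⁺(t_λ : λ ∈ Λ)`: the localization of the polynomial ring `R⁺[t_λ : λ ∈ Λ]`
at the prime ideal generated by the maximal ideal of the quasilocal ring `R⁺`. -/
noncomputable abbrev TRing (R : Type) [CommRing R] [IsDomain R] (Λ : Type)
    [IsLocalRing (RPlus R)]
    [hP : (Ideal.map (MvPolynomial.C (σ := Λ)) (maximalIdeal (RPlus R))).IsPrime] : Type :=
  Localization.AtPrime (Ideal.map (MvPolynomial.C (σ := Λ)) (maximalIdeal (RPlus R)))

/-- The canonical map `R⁺ → T`. -/
noncomputable def plusToT (R : Type) [CommRing R] [IsDomain R] (Λ : Type)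
    [IsLocalRing (RPlus R)]
    [hP : (Ideal.map (MvPolynomial.C (σ := Λ)) (maximalIdeal (RPlus R))).IsPrime] :
    RPlus R →+* TRing R Λ :=
  (algebraMap (MvPolynomial Λ (RPlus R)) (TRing R Λ)).comp MvPolynomial.C

/-- The canonical map `R → T`. -/
noncomputable def toT (R : Type) [CommRing R] [IsDomain R] (Λ : Type)
    [IsLocalRing (RPlus R)]
    [hP : (Ideal.map (MvPolynomial.C (σ := Λ)) (maximalIdeal (RPlus R))).IsPrime] :
    R →+* TRing R Λ :=
  (plusToT R Λ).comp (algebraMap R (RPlus R))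

namespace HH

structure Base (p : ℕ) {Ω : Type} [CommRing Ω] (G : Set (Subring Ω)) : Prop where
  dir : ∀ S ∈ G, ∀ S' ∈ G, ∃ T ∈ G, S ≤ T ∧ S' ≤ T
  ex : ∀ w : Ω, ∃ S ∈ G, w ∈ S
  noeth : ∀ S ∈ G, IsNoetherianRing S
  frob : ∀ S ∈ G, ∃ T ∈ G, ∀ w : Ω, w ^ p ∈ S → w ∈ T
  root : ∀ (N : ℕ) (s : ℕ → Ω) (g : Ω), 0 < N →
    ∃ y, y ^ p ^ N = ∑ i ∈ Finset.range N, s i * y ^ p ^ i + g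
  intc : ∀ (b t : Ω) (N : ℕ) (s : ℕ → Ω), b ≠ 0 →
    t ^ p ^ N = ∑ i ∈ Finset.range N, s i * b ^ (p ^ N - p ^ i) * t ^ p ^ i → b ∣ t

section
variable {Ω : Type} [CommRing Ω] {ι : Type} {I : Type}

def Bdd (G : Set (Subring Ω)) (f : I → Ω) : Prop := ∃ S ∈ G, ∀ ν, f ν ∈ S

def Mem (G : Set (Subring Ω)) (x : ι → Ω) (α : I → ι → ℕ) (J : Finset ι) (U : I → Ω) : Prop :=
  ∃ r : I → ι → Ω, Bdd G (fun q : I × ι => r q.1 q.2) ∧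
    ∀ ν, U ν = ∑ i ∈ J, r ν i * x i ^ α ν i

variable {p : ℕ} {G : Set (Subring Ω)}

namespace Bdd

theorem comp {K : Type} {f : I → Ω} (h : Bdd G f) (g : K → I) : Bdd G (fun k => f (g k)) :=
  let ⟨S, hS, h⟩ := h; ⟨S, hS, fun k => h (g k)⟩

theorem two (hB : Base p G) {K : Type} {f : I → Ω} {g : K → Ω} (hf : Bdd G f) (hg : Bdd G g) :
    ∃ S ∈ G, (∀ ν, f ν ∈ S) ∧ ∀ ν, g ν ∈ S := by
  obtain ⟨S, hS, h⟩ := hf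
  obtain ⟨S', hS', h'⟩ := hg
  obtain ⟨T, hT, h1, h2⟩ := hB.dir S hS S' hS'
  exact ⟨T, hT, fun ν => h1 (h ν), fun ν => h2 (h' ν)⟩

theorem const (hB : Base p G) (c : Ω) : Bdd G (fun _ : I => c) :=
  let ⟨S, hS, h⟩ := hB.ex c; ⟨S, hS, fun _ => h⟩

theorem add (hB : Base p G) {f g : I → Ω} (hf : Bdd G f) (hg : Bdd G g) :
    Bdd G (fun ν => f ν + g ν) :=
  let ⟨S, hS, h, h'⟩ := two hB hf hg; ⟨S, hS, fun ν => S.add_mem (h ν) (h' ν)⟩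

theorem sub (hB : Base p G) {f g : I → Ω} (hf : Bdd G f) (hg : Bdd G g) :
    Bdd G (fun ν => f ν - g ν) :=
  let ⟨S, hS, h, h'⟩ := two hB hf hg; ⟨S, hS, fun ν => S.sub_mem (h ν) (h' ν)⟩

theorem mul (hB : Base p G) {f g : I → Ω} (hf : Bdd G f) (hg : Bdd G g) :
    Bdd G (fun ν => f ν * g ν) :=
  let ⟨S, hS, h, h'⟩ := two hB hf hg; ⟨S, hS, fun ν => S.mul_mem (h ν) (h' ν)⟩

theorem neg {f : I → Ω} (hf : Bdd G f) : Bdd G (fun ν => - f ν) :=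
  let ⟨S, hS, h⟩ := hf; ⟨S, hS, fun ν => S.neg_mem (h ν)⟩

theorem pow {f : I → Ω} (hf : Bdd G f) (n : I → ℕ) : Bdd G (fun ν => f ν ^ n ν) :=
  let ⟨S, hS, h⟩ := hf; ⟨S, hS, fun ν => S.pow_mem (h ν) _⟩

theorem sum (hB : Base p G) {κ : Type} (J : Finset κ) {f : κ → I → Ω}
    (hf : ∀ i ∈ J, Bdd G (f i)) : Bdd G (fun ν => ∑ i ∈ J, f i ν) := by
  classical
  induction J using Finset.induction_on with
  | empty => simpa using const hB 0
  | insert a J ha ih =>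
    simp only [Finset.sum_insert ha]
    exact add hB (hf a (by simp)) (ih fun i hi => hf i (by simp [hi]))

theorem prod (hB : Base p G) {κ : Type} (J : Finset κ) {f : κ → I → Ω}
    (hf : ∀ i ∈ J, Bdd G (f i)) : Bdd G (fun ν => ∏ i ∈ J, f i ν) := by
  classical
  induction J using Finset.induction_on with
  | empty => simpa using const hB 1
  | insert a J ha ih =>
    simp only [Finset.prod_insert ha]
    exact mul hB (hf a (by simp)) (ih fun i hi => hf i (by simp [hi]))

/-- a finite family of bounded families is bounded -/
theorem fin (hB : Base p G) [Finite ι] {f : I → ι → Ω}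
    (hf : ∀ i, Bdd G (fun ν => f ν i)) : Bdd G (fun q : I × ι => f q.1 q.2) := by
  classical
  have := Fintype.ofFinite ι
  have key : ∀ J : Finset ι, ∃ S ∈ G, ∀ i ∈ J, ∀ ν, f ν i ∈ S := by
    intro J
    induction J using Finset.induction_on with
    | empty => obtain ⟨S, hS, -⟩ := hB.ex 0; exact ⟨S, hS, by simp⟩
    | insert a J ha ih =>
      obtain ⟨S, hS, h⟩ := ih
      obtain ⟨S', hS', h'⟩ := hf a
      obtain ⟨T, hT, h1, h2⟩ := hB.dir S hS S' hS'
      refine ⟨T, hT, fun i hi ν => ?_⟩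
      rcases Finset.mem_insert.1 hi with rfl | hi
      · exact h2 (h' ν)
      · exact h1 (h i hi ν)
  obtain ⟨S, hS, h⟩ := key Finset.univ
  exact ⟨S, hS, fun q => h q.2 (Finset.mem_univ _) q.1⟩

end Bdd

namespace Mem
variable {x : ι → Ω} {α β : I → ι → ℕ} {J : Finset ι} {U V : I → Ω}

theorem bdd (hB : Base p G) (h : Mem G x α J U) : Bdd G U := by
  obtain ⟨r, hr, h⟩ := h
  have : U = fun ν => ∑ i ∈ J, r ν i * x i ^ α ν i := funext h
  rw [this]
  exact Bdd.sum hB J fun i _ => (hr.comp fun ν => (ν, i)).mul hB ((Bdd.const hB (x i)).pow _)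

theorem comp {K : Type} (h : Mem G x α J U) (g : K → I) :
    Mem G x (fun k => α (g k)) J (fun k => U (g k)) :=
  let ⟨r, hr, h⟩ := h
  ⟨fun k => r (g k), hr.comp (fun q : K × ι => (g q.1, q.2)), fun k => h (g k)⟩

theorem zero (hB : Base p G) : Mem G x α J (fun _ => 0) :=
  ⟨fun _ _ => 0, Bdd.const hB 0, fun ν => by simp⟩

theorem add (hB : Base p G) (hU : Mem G x α J U) (hV : Mem G x α J V) :
    Mem G x α J (fun ν => U ν + V ν) := by
  obtain ⟨r, hr, h⟩ := hU
  obtain ⟨s, hs, h'⟩ := hV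
  exact ⟨fun ν i => r ν i + s ν i, hr.add hB hs, fun ν => by
    beta_reduce; rw [h, h', ← Finset.sum_add_distrib]; exact Finset.sum_congr rfl fun i _ => by ring⟩

theorem mul (hB : Base p G) (hU : Mem G x α J U) (hV : Bdd G V) :
    Mem G x α J (fun ν => V ν * U ν) := by
  obtain ⟨r, hr, h⟩ := hU
  exact ⟨fun ν i => V ν * r ν i, (hV.comp Prod.fst).mul hB hr, fun ν => by
    beta_reduce; rw [h, Finset.mul_sum]; exact Finset.sum_congr rfl fun i _ => by ring⟩

theorem neg (hU : Mem G x α J U) : Mem G x α J (fun ν => - U ν) := by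
  obtain ⟨r, hr, h⟩ := hU
  exact ⟨fun ν i => - r ν i, hr.neg, fun ν => by
    beta_reduce; rw [h, ← Finset.sum_neg_distrib]; exact Finset.sum_congr rfl fun i _ => by ring⟩

theorem sub (hB : Base p G) (hU : Mem G x α J U) (hV : Mem G x α J V) :
    Mem G x α J (fun ν => U ν - V ν) := by
  simpa [sub_eq_add_neg] using hU.add hB hV.neg

theorem sum (hB : Base p G) {κ : Type} (A : Finset κ) {f : κ → I → Ω}
    (hf : ∀ i ∈ A, Mem G x α J (f i)) : Mem G x α J (fun ν => ∑ i ∈ A, f i ν) := by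
  classical
  induction A using Finset.induction_on with
  | empty => simpa using zero hB
  | insert a A ha ih =>
    simp only [Finset.sum_insert ha]
    exact add hB (hf a (by simp)) (ih fun i hi => hf i (by simp [hi]))

theorem single [DecidableEq ι] [Finite ι] (hB : Base p G) (hU : Bdd G U) {i : ι} (hi : i ∈ J) :
    Mem G x α J (fun ν => U ν * x i ^ α ν i) := by
  refine ⟨fun ν j => if j = i then U ν else 0, Bdd.fin (f := fun ν j => if j = i then U ν else 0) hB fun j => ?_, fun ν => ?_⟩
  · by_cases h : j = i
    · simpa [h] using hU
    · simpa [h] using Bdd.const hB 0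
  · simp [hi]

/-- change of parameters: if every generator lies in the target, so does everything -/
theorem trans (hB : Base p G) {y : ι → Ω} {β : I → ι → ℕ} {J' : Finset ι}
    (hU : Mem G x α J U) (h : ∀ i ∈ J, Mem G y β J' (fun ν => x i ^ α ν i)) :
    Mem G y β J' U := by
  obtain ⟨r, hr, hU⟩ := hU
  rw [funext hU]
  exact sum hB J fun i hi => (h i hi).mul hB (hr.comp fun ν => (ν, i))

theorem mono [DecidableEq ι] [Finite ι] (hB : Base p G) {J' : Finset ι} (hJ : J ⊆ J')
    (hab : ∀ ν, ∀ i ∈ J, β ν i ≤ α ν i)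
    (hU : Mem G x α J U) : Mem G x β J' U := by
  refine hU.trans hB fun i hi => ?_
  have := single (x := x) (α := β) (J := J') hB
    ((Bdd.const hB (x i)).pow (fun ν => α ν i - β ν i)) (hJ hi)
  convert this using 2 with ν
  rw [← pow_add, Nat.sub_add_cancel (hab ν i hi)]

theorem congr' {α β : I → ι → ℕ} (hab : ∀ ν, ∀ i ∈ J, β ν i = α ν i)
    (hU : Mem G x α J U) : Mem G x β J U := by
  obtain ⟨r, hr, h⟩ := hU
  exact ⟨r, hr, fun ν => (h ν).trans (Finset.sum_congr rfl fun i hi => by rw [hab ν i hi])⟩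

/-- split off one generator -/
theorem split [DecidableEq ι] {i : ι} (hi : i ∈ J) (hU : Mem G x α J U) :
    ∃ r : I → Ω, Bdd G r ∧ Mem G x α (J.erase i) (fun ν => U ν - r ν * x i ^ α ν i) := by
  obtain ⟨r, hr, h⟩ := hU
  refine ⟨fun ν => r ν i, hr.comp fun ν => (ν, i), r, hr, fun ν => ?_⟩
  beta_reduce; rw [h, ← Finset.add_sum_erase _ _ hi]; ring

/-- multiplying by a product of powers raises exponents -/
theorem prodMul [DecidableEq ι] [Finite ι] (hB : Base p G) (H : Finset ι) (γ : I → ι → ℕ)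
    (hU : Mem G x α J U) :
    Mem G x (fun ν i => α ν i + if i ∈ H then γ ν i else 0) J
      (fun ν => (∏ i ∈ H, x i ^ γ ν i) * U ν) := by
  obtain ⟨r, hr, h⟩ := hU
  refine ⟨fun ν i => r ν i * ∏ j ∈ H.erase i, x j ^ γ ν j, Bdd.fin (f := fun ν i => r ν i * ∏ j ∈ H.erase i, x j ^ γ ν j) hB
    fun i => ?_, fun ν => ?_⟩
  · exact (hr.comp fun ν => (ν, i)).mul hB
      (Bdd.prod hB _ fun j _ => (Bdd.const hB (x j)).pow _)
  · beta_reduce; rw [h, Finset.mul_sum]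
    refine Finset.sum_congr rfl fun i _ => ?_
    by_cases hi : i ∈ H
    · rw [← Finset.mul_prod_erase _ _ hi, if_pos hi, pow_add]; ring
    · rw [Finset.erase_eq_of_notMem hi, if_neg hi]; ring

theorem frob [Fact p.Prime] [CharP Ω p] (hU : Mem G x α J U) :
    Mem G x (fun ν i => p * α ν i) J (fun ν => U ν ^ p) := by
  obtain ⟨r, hr, h⟩ := hU
  refine ⟨fun ν i => r ν i ^ p, hr.pow _, fun ν => ?_⟩
  beta_reduce at h ⊢; rw [h, sum_pow_char]
  exact Finset.sum_congr rfl fun i _ => by rw [mul_pow, ← pow_mul, mul_comm p]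

end Mem

theorem Base.perf (hB : Base p G) (a : Ω) : ∃ b, b ^ p = a := by
  obtain ⟨y, hy⟩ := hB.root 1 (fun _ => 0) a one_pos
  exact ⟨y, by simpa using hy⟩

theorem mem_sp {H : Finset ι} {f : ι → Ω} {a : Ω} :
    a ∈ Ideal.span (f '' H) ↔ ∃ c : ι → Ω, a = ∑ i ∈ H, c i * f i := by
  classical
  refine (Submodule.mem_span_image_finset_iff_exists_fun Ω).trans ⟨?_, ?_⟩
  · rintro ⟨c, rfl⟩
    exact ⟨fun i => if h : i ∈ H then c ⟨i, h⟩ else 0, by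
      rw [← Finset.sum_attach H]; exact Finset.sum_congr rfl fun i _ => by simp⟩
  · rintro ⟨c, rfl⟩
    exact ⟨fun i => c i, by rw [← Finset.sum_attach H]; rfl⟩

theorem Mem.frobInv (hB : Base p G) [Fact p.Prime] [CharP Ω p] [IsDomain Ω]
    {x : ι → Ω} {α : I → ι → ℕ} {J : Finset ι} {U : I → Ω}
    (hU : Mem G x (fun ν i => p * α ν i) J (fun ν => U ν ^ p)) : Mem G x α J U := by
  obtain ⟨r, ⟨S, hS, hr⟩, h⟩ := hU
  choose g hg using hB.perf
  obtain ⟨T, hT, h1⟩ := hB.frob S hS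
  refine ⟨fun ν i => g (r ν i), ⟨T, hT, fun q => h1 _ (by rw [hg]; exact hr q)⟩, fun ν => ?_⟩
  apply frobenius_inj Ω p
  simp only [frobenius_def]
  beta_reduce at h ⊢; rw [h, sum_pow_char]
  exact Finset.sum_congr rfl fun i _ => by rw [mul_pow, hg, ← pow_mul, mul_comm p]

theorem Mem.frobInvN (hB : Base p G) [Fact p.Prime] [CharP Ω p] [IsDomain Ω]
    {x : ι → Ω} {J : Finset ι} (n : ℕ) : ∀ {α : I → ι → ℕ} {U : I → Ω},
    Mem G x (fun ν i => p ^ n * α ν i) J (fun ν => U ν ^ p ^ n) → Mem G x α J U := by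
  induction n with
  | zero => intro α U h; simpa using h
  | succ n ih =>
    intro α U h
    apply Mem.frobInv hB
    apply ih
    simpa only [pow_succ, mul_assoc, pow_mul, pow_right_comm] using h

theorem lemE (hB : Base p G) [Fact p.Prime] [CharP Ω p] [IsDomain Ω] [DecidableEq ι]
    (H : Finset ι) (hne : H.Nonempty) (x : ι → Ω) (hx : ∀ i ∈ H, x i ≠ 0)
    (v : Ω) (V : ℕ → Ω) (N : ℕ) (s : ℕ → Ω)
    (h1 : ∀ n ≤ N, v ^ p ^ n - (∏ i ∈ H, x i) ^ (p ^ n - 1) * V n ∈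
      Ideal.span ((fun i => x i ^ p ^ n) '' (H : Set ι)))
    (h2 : V N - ∑ i ∈ Finset.range N, s i * V i ∈ Ideal.span (x '' (H : Set ι))) :
    v ∈ Ideal.span (x '' (H : Set ι)) := by
  rcases Nat.eq_zero_or_pos N with rfl | hN
  · have := Ideal.add_mem _ (h1 0 le_rfl) (by simpa using h2)
    simpa using this
  have hp : 1 < p := (Fact.out : p.Prime).one_lt
  set β := ∏ i ∈ H, x i with hβ
  have h1' : ∀ n, ∃ c : ι → Ω, n ≤ N → v ^ p ^ n - β ^ (p ^ n - 1) * V n =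
      ∑ i ∈ H, c i * x i ^ p ^ n := fun n => by
    by_cases hn : n ≤ N
    · obtain ⟨c, hc⟩ := mem_sp.1 (h1 n hn); exact ⟨c, fun _ => hc⟩
    · exact ⟨0, fun h => absurd h hn⟩
  choose W hW using h1'
  obtain ⟨ε, hε⟩ := mem_sp.1 h2
  let b : ι → Ω := fun j => ∏ i ∈ H.erase j, x i
  have hb : ∀ j ∈ H, β = x j * b j := fun j hj => (Finset.mul_prod_erase H x hj).symm
  choose Y hY using fun j => hB.root N (fun i => s i * b j ^ (p ^ N - p ^ i))
    (W N j + b j ^ (p ^ N - 1) * ε j -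
      ∑ i ∈ Finset.range N, s i * b j ^ (p ^ N - p ^ i) * W i j) hN
  let D : Ω →+ Ω := 
    { toFun := fun t => t ^ p ^ N - ∑ i ∈ Finset.range N, s i * β ^ (p ^ N - p ^ i) * t ^ p ^ i
      map_zero' := by simp [(Fact.out : p.Prime).ne_zero]
      map_add' := fun t t' => by
        simp only [add_pow_char_pow, mul_add, Finset.sum_add_distrib]; ring }
  have hD : ∀ t, D t = t ^ p ^ N - ∑ i ∈ Finset.range N, s i * β ^ (p ^ N - p ^ i) * t ^ p ^ i :=
    fun t => rfl
  have hple : ∀ i ∈ Finset.range N, p ^ i ≤ p ^ N := fun i hi =>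
    Nat.pow_le_pow_right hp.le (Finset.mem_range.1 hi).le
  have hpo : ∀ i, 1 ≤ p ^ i := fun i => Nat.one_le_pow _ _ (by omega)
  have hDY : ∀ j ∈ H, D (x j * Y j) = x j ^ p ^ N * (W N j + b j ^ (p ^ N - 1) * ε j -
      ∑ i ∈ Finset.range N, s i * b j ^ (p ^ N - p ^ i) * W i j) := by
    intro j hj
    rw [hD, mul_pow, hY, hb j hj, mul_add, add_sub_right_comm, add_eq_right, sub_eq_zero,
      Finset.mul_sum]
    refine Finset.sum_congr rfl fun i hi => ?_
    rw [mul_pow, mul_pow]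
    nth_rw 1 [← Nat.sub_add_cancel (hple i hi)]
    rw [pow_add]; ring
  have hDV : D (v) = ∑ j ∈ H, x j ^ p ^ N * (W N j + b j ^ (p ^ N - 1) * ε j -
      ∑ i ∈ Finset.range N, s i * b j ^ (p ^ N - p ^ i) * W i j) := by
    have e1 : ∀ i ∈ Finset.range N, s i * β ^ (p ^ N - p ^ i) * v ^ p ^ i =
        β ^ (p ^ N - 1) * (s i * V i) +
        ∑ j ∈ H, x j ^ p ^ N * (s i * b j ^ (p ^ N - p ^ i) * W i j) := by
      intro i hi
      rw [sub_eq_iff_eq_add.1 (hW i (Finset.mem_range.1 hi).le), mul_add, add_comm]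
      congr 1
      · have : p ^ N - 1 = (p ^ N - p ^ i) + (p ^ i - 1) := by
          have := hple i hi; have := hpo i; omega
        rw [this, pow_add]; ring
      · rw [Finset.mul_sum]
        refine Finset.sum_congr rfl fun j hj => ?_
        rw [hb j hj, mul_pow]
        have e : x j ^ p ^ N = x j ^ (p ^ N - p ^ i) * x j ^ p ^ i := by
          rw [← pow_add, Nat.sub_add_cancel (hple i hi)]
        rw [e]; ring
    rw [hD, Finset.sum_congr rfl e1, sub_eq_iff_eq_add.1 (hW N le_rfl), Finset.sum_add_distrib,
      ← Finset.mul_sum, Finset.sum_comm]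
    rw [sub_eq_iff_eq_add.1 hε]
    simp only [mul_sub, mul_add, Finset.sum_sub_distrib, Finset.sum_add_distrib, Finset.mul_sum]
    have e2 : ∑ j ∈ H, β ^ (p ^ N - 1) * (ε j * x j) =
        ∑ j ∈ H, x j ^ p ^ N * (b j ^ (p ^ N - 1) * ε j) := by
      refine Finset.sum_congr rfl fun j hj => ?_
      rw [hb j hj, mul_pow]
      have e : x j ^ p ^ N = x j ^ (p ^ N - 1) * x j := by
        rw [← pow_succ, Nat.sub_add_cancel (hpo N)]
      rw [e]; ring
    rw [e2, Finset.sum_congr rfl fun j _ => mul_comm (W N j) _]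
    ring
  have hT : D (v - ∑ j ∈ H, x j * Y j) = 0 := by
    rw [map_sub, map_sum, hDV, sub_eq_zero]
    exact (Finset.sum_congr rfl hDY).symm
  have hdvd := hB.intc β _ N s (Finset.prod_ne_zero_iff.2 hx) (sub_eq_zero.1 ((hD _).symm.trans hT))
  obtain ⟨i, hi⟩ := hne
  have hsub : ∀ j ∈ H, x j ∈ Ideal.span (x '' (H : Set ι)) := fun j hj =>
    Ideal.subset_span ⟨j, hj, rfl⟩
  have hβm : β ∈ Ideal.span (x '' (H : Set ι)) := by
    rw [hb i hi]; exact Ideal.mul_mem_right _ _ (hsub i hi)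
  have := Ideal.mem_of_dvd _ hdvd hβm
  have h3 : ∑ j ∈ H, x j * Y j ∈ Ideal.span (x '' (H : Set ι)) :=
    Ideal.sum_mem _ fun j hj => Ideal.mul_mem_right _ _ (hsub j hj)
  simpa using Ideal.add_mem _ this h3

end
end HH

namespace HH
section
variable {Ω : Type} [CommRing Ω] {ι : Type} {p : ℕ} {G : Set (Subring Ω)}

structure Ax (p : ℕ) [DecidableEq ι] (G : Set (Subring Ω)) (Par : Set (ι → Ω)) : Prop
    extends Base p G where
  ne0 : ∀ x ∈ Par, ∀ i, x i ≠ 0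
  cc : ∀ x ∈ Par, ∀ S ∈ G, ∃ c : Ω, c ≠ 0 ∧ ∃ S' ∈ G, ∀ (J : Finset ι) (j : ι) (α : ι → ℕ) (β : ℕ)
    (w : Ω) (r : ι → Ω), j ∉ J → w ∈ S → (∀ i, r i ∈ S) →
    x j ^ β * w = ∑ i ∈ J, r i * x i ^ α i →
    ∃ r' : ι → Ω, (∀ i, r' i ∈ S') ∧ c * w = ∑ i ∈ J, r' i * x i ^ α i
  sub : ∀ x ∈ Par, ∀ H : Finset ι, ∃ B : Subring Ω,
    (∃ S ∈ G, B ≤ S) ∧ (∀ j, j ∉ H → x j ∈ B) ∧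
    (∀ S ∈ G, ∃ (e : ℕ) (T : Finset Ω), ∀ w ∈ S, ∃ b : Ω → Ω, (∀ t, b t ^ p ^ e ∈ B) ∧
      w - ∑ t ∈ T, b t * t ∈ Ideal.span (x '' (H : Set ι))) ∧
    (∀ j0, j0 ∉ H → ∀ a ∈ B, a ≠ 0 → ∃ N : ι → ℕ, (∀ j, 1 ≤ N j) ∧
      (fun j => if j ∈ H then x j else if j = j0 then a * x j0 else x j + x j0 ^ N j) ∈ Par) ∧
    (H = ∅ → ∀ c : Ω, c ≠ 0 → ∃ a ∈ B, a ≠ 0 ∧ c ∣ a)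

def Reg (G : Set (Subring Ω)) (Par : Set (ι → Ω)) (m : ℕ) : Prop :=
  ∀ x ∈ Par, ∀ (I : Type) (α : I → ι → ℕ) (β : I → ℕ) (J : Finset ι) (j : ι) (W : I → Ω),
    J.card < m → j ∉ J → Bdd G W → Mem G x α J (fun ν => x j ^ β ν * W ν) → Mem G x α J W

def UU (p : ℕ) (G : Set (Subring Ω)) (Par : Set (ι → Ω)) (m : ℕ) : Prop :=
  ∀ x ∈ Par, ∀ (I : Type) (σ : I → I) (e : I → ℕ) (J : Finset ι) (u : I → Ω) (c : Ω),
    J.card = m → (∀ ν, e (σ ν) = e ν + 1) → (∀ ν, u (σ ν) = u ν ^ p) → Bdd G u → c ≠ 0 →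
    Mem G x (fun ν _ => p ^ e ν) J (fun ν => c * u ν) → Mem G x (fun ν _ => p ^ e ν) J u

variable [DecidableEq ι] [Finite ι] {Par : Set (ι → Ω)} {m : ℕ} {x : ι → Ω} {I : Type}
  {α : I → ι → ℕ} {J : Finset ι}

theorem cancel1 (hB : Base p G) (hR : Reg G Par m) (hx : x ∈ Par) (hJ : J.card ≤ m)
    {i : ι} (hi : i ∈ J) (γ : I → ℕ) {V : I → Ω} (hV : Bdd G V)
    (h : Mem G x (fun ν k => α ν k + if k = i then γ ν else 0) J (fun ν => x i ^ γ ν * V ν)) :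
    Mem G x α J V := by
  obtain ⟨r, hr, h⟩ := h.split hi
  have hs : Bdd G (fun ν => r ν * x i ^ α ν i) := hr.mul hB ((Bdd.const hB (x i)).pow _)
  have h2 : Mem G x α (J.erase i) (fun ν => V ν - r ν * x i ^ α ν i) := by
    refine hR x hx I α γ _ i _ ?_ (Finset.notMem_erase i J) (hV.sub hB hs) ?_
    · rw [Finset.card_erase_of_mem hi]
      have := Finset.card_pos.2 ⟨i, hi⟩; omega
    · refine Mem.congr' (α := fun ν k => α ν k + if k = i then γ ν else 0) ?_ ?_
      · intro ν k hk; simp [Finset.ne_of_mem_erase hk]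
      · convert h using 2 with ν
        simp only [if_true, pow_add]; ring
  have h3 := (h2.mono hB (Finset.erase_subset i J) (fun _ _ _ => le_rfl)).add hB
    (Mem.single (x := x) (α := α) hB hr hi)
  simpa using h3

theorem cancel (hB : Base p G) (hR : Reg G Par m) (hx : x ∈ Par) (hJ : J.card ≤ m)
    {H : Finset ι} (hH : H ⊆ J) (γ : I → ι → ℕ) {V : I → Ω} (hV : Bdd G V)
    (h : Mem G x (fun ν k => α ν k + if k ∈ H then γ ν k else 0) J
      (fun ν => (∏ i ∈ H, x i ^ γ ν i) * V ν)) :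
    Mem G x α J V := by
  induction H using Finset.induction_on generalizing α V with
  | empty => simpa using h
  | insert a H ha ih =>
    refine cancel1 hB hR hx hJ (hH (Finset.mem_insert_self a H)) (fun ν => γ ν a) hV ?_
    refine ih ((Finset.subset_insert a H).trans hH)
      (((Bdd.const hB (x a)).pow _).mul hB hV) ?_
    refine Mem.congr' ?_ (by
      convert h using 2 with ν; rw [Finset.prod_insert ha]; ring)
    intro ν k _
    by_cases hk : k = a
    · subst hk; simp [ha]
    · simp [hk]

theorem socle (hB : Base p G) (hR : Reg G Par m) (hx : x ∈ Par) (hJ : J.card ≤ m)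
    {H : Finset ι} (hH : H ⊆ J) (hα : ∀ ν i, 1 ≤ α ν i) {u : I → Ω} (hu : Bdd G u)
    (h : ∀ i ∈ H, Mem G x α J (fun ν => x i * u ν)) :
    ∃ v, Bdd G v ∧ Mem G x α J (fun ν => u ν - (∏ i ∈ H, x i ^ (α ν i - 1)) * v ν) := by
  induction H using Finset.induction_on with
  | empty => exact ⟨u, hu, by simpa using Mem.zero hB⟩
  | insert a H ha ih =>
    have haJ := hH (Finset.mem_insert_self a H)
    have hHJ := (Finset.subset_insert a H).trans hH
    obtain ⟨v, hv, h1⟩ := ih hHJ fun i hi => h i (Finset.mem_insert_of_mem hi)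
    let α' : I → ι → ℕ := fun ν k => if k ∈ H then 1 else α ν k
    have hα' : ∀ ν k, α ν k = α' ν k + if k ∈ H then α ν k - 1 else 0 := by
      intro ν k; have := hα ν k
      by_cases hk : k ∈ H <;> simp [α', hk]; omega
    have h2 : Mem G x α' J (fun ν => x a * v ν) := by
      refine cancel hB hR hx hJ hHJ (fun ν i => α ν i - 1) ((Bdd.const hB (x a)).mul hB hv) ?_
      simp_rw [← hα']
      convert (h a (Finset.mem_insert_self a H)).sub hB (h1.mul hB (Bdd.const hB (x a))) using 2
      ring
    obtain ⟨r, hr, h3⟩ := h2.split haJ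
    have hs : Bdd G (fun ν => r ν * x a ^ (α ν a - 1)) := hr.mul hB ((Bdd.const hB (x a)).pow _)
    have h4 : Mem G x α' (J.erase a) (fun ν => v ν - r ν * x a ^ (α ν a - 1)) := by
      refine hR x hx I α' (fun _ => 1) _ a _ ?_ (Finset.notMem_erase a J) (hv.sub hB hs) ?_
      · rw [Finset.card_erase_of_mem haJ]
        have := Finset.card_pos.2 ⟨a, haJ⟩; omega
      · convert h3 using 2 with ν
        have : x a ^ α' ν a = x a * x a ^ (α ν a - 1) := by
          simp only [α', if_neg ha]; rw [← pow_succ', Nat.sub_add_cancel (hα ν a)]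
        rw [this]; ring
    refine ⟨r, hr, ?_⟩
    have h5 := (h4.mono hB (Finset.erase_subset a J) (fun _ _ _ => le_rfl)).prodMul hB H
      (fun ν i => α ν i - 1)
    simp_rw [← hα'] at h5
    convert h1.add hB h5 using 2 with ν
    rw [Finset.prod_insert ha]; ring

theorem reg_succ [Fact p.Prime] [CharP Ω p] (hA : Ax p G Par) (hR : Reg G Par m)
    (hU : UU p G Par m) : Reg G Par (m + 1) := by
  have hB := hA.toBase
  intro x hx I α β J j W hJ hj hW h
  rcases Nat.lt_or_ge J.card m with hlt | hge
  · exact hR x hx I α β J j W hlt hj hW h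
  have hJm : J.card = m := by omega
  have hp := (Fact.out : p.Prime)
  -- pure case
  have pure : ∀ (e : I → ℕ) (W : I → Ω), Bdd G W →
      Mem G x (fun ν _ => p ^ e ν) J (fun ν => x j ^ β ν * W ν) →
      Mem G x (fun ν _ => p ^ e ν) J W := by
    intro e W hW h
    obtain ⟨r, hr, h⟩ := h
    obtain ⟨S, hS, hWS, hrS⟩ := Bdd.two hB hW hr
    obtain ⟨c, hc, S', hS', hcc⟩ := hA.cc x hx S hS
    have h1 : ∀ q : I × ℕ, ∃ r' : ι → Ω, (∀ i, r' i ∈ S') ∧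
        c * W q.1 ^ p ^ q.2 = ∑ i ∈ J, r' i * x i ^ p ^ (e q.1 + q.2) := by
      rintro ⟨ν, n⟩
      refine hcc J j (fun _ => p ^ (e ν + n)) (β ν * p ^ n) _ (fun i => r ν i ^ p ^ n) hj
        (S.pow_mem (hWS ν) _) (fun i => S.pow_mem (hrS (ν, i)) _) ?_
      have := congrArg (· ^ p ^ n) (h ν)
      simp only [mul_pow, ← pow_mul, sum_pow_char_pow, ← pow_add] at this
      exact this
    choose r' hr' h1 using h1
    have h2 := hU x hx (I × ℕ) (fun q => (q.1, q.2 + 1)) (fun q => e q.1 + q.2) J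
      (fun q => W q.1 ^ p ^ q.2) c hJm (fun q => by ring) (fun q => by ring)
      ((hW.comp Prod.fst).pow _) hc ⟨r', ⟨S', hS', fun q => hr' q.1 q.2⟩, h1⟩
    simpa using h2.comp (fun ν => (ν, 0))
  let e : I → ℕ := fun ν => ∑ i ∈ J, α ν i
  have he : ∀ ν, ∀ i ∈ J, α ν i ≤ p ^ e ν := fun ν i hi =>
    (Finset.single_le_sum (f := fun i => α ν i) (fun _ _ => Nat.zero_le _) hi).trans
      (Nat.lt_pow_self hp.one_lt).le
  have h1 := h.prodMul hB J (fun ν i => p ^ e ν - α ν i)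
  refine cancel hB hR hx (by omega) (subset_refl J) (fun ν i => p ^ e ν - α ν i) hW ?_
  have hb : Bdd G (fun ν => (∏ i ∈ J, x i ^ (p ^ e ν - α ν i)) * W ν) :=
    (Bdd.prod hB _ fun i _ => (Bdd.const hB (x i)).pow _).mul hB hW
  have hexp : ∀ ν, ∀ k ∈ J, p ^ e ν = α ν k + if k ∈ J then p ^ e ν - α ν k else 0 := by
    intro ν k hk; have := he ν k hk; simp [hk]; omega
  refine Mem.congr' (fun ν k hk => (hexp ν k hk).symm) (pure e _ hb ?_)
  refine Mem.congr' hexp ?_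
  convert h1 using 2 with ν
  ring
end
end HH

namespace HH

theorem LA {A M : Type} [CommRing A] [IsDomain A] [AddCommGroup M] [Module A M]
    (Z : ℕ → Submodule A M) (T0 : Finset M) (h0 : Z 0 ≤ Submodule.span A T0)
    (hint : ∀ y, (∀ n, ∃ b : A, b ≠ 0 ∧ b • y ∈ Z n) → ∃ b : A, b ≠ 0 ∧ b • y = 0) :
    ∃ n0 : ℕ, ∀ (κ : Type) (T : Finset κ) (τ : κ → M), ∃ a : A, a ≠ 0 ∧ ∃ s : ℕ → κ → M,
      ∀ (y : M) (c : ℕ → κ → A), (∀ n ≤ n0, y - ∑ t ∈ T, c n t • τ t ∈ Z n) → ∃ b : A, b ≠ 0 ∧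
        b • (a • y - ∑ n ∈ Finset.range (n0 + 1), ∑ t ∈ T, c n t • s n t) = 0 := by
  classical
  let K := FractionRing A
  let S := nonZeroDivisors A
  let D := LocalizedModule S M
  let f : M →ₗ[A] D := LocalizedModule.mkLinearMap S M
  let E : Submodule K D := Submodule.span K ((T0.image f : Finset D) : Set D)
  let V : ℕ → Submodule K D := fun n => Submodule.localized' K S f (Z n)
  have hV : ∀ n (y : M), f y ∈ V n → ∃ b : A, b ≠ 0 ∧ b • y ∈ Z n := by
    intro n y hy
    obtain ⟨m, hm, s, hs⟩ := hy
    rw [IsLocalizedModule.mk'_eq_iff, Submonoid.smul_def, ← map_smul, IsLocalizedModule.eq_iff_exists S f] at hs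
    obtain ⟨c, hc⟩ := hs
    refine ⟨c * s, mul_ne_zero (nonZeroDivisors.ne_zero c.2) (nonZeroDivisors.ne_zero s.2), ?_⟩
    rw [mul_smul]
    have : c.1 • s.1 • y = c.1 • m := hc.symm
    rw [this]; exact Submodule.smul_mem _ _ hm
  have hVf : ∀ n, ∀ y ∈ Z n, f y ∈ V n := fun n y hy => ⟨y, hy, 1, IsLocalizedModule.mk'_one _ _ _⟩
  have hE : V 0 ≤ E := by
    have : V 0 ≤ Submodule.localized' K S f (Submodule.span A T0) :=
      (Submodule.localized'gi K S f).gc.monotone_l h0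
    rwa [Submodule.localized'_span, ← Finset.coe_image] at this
  let W : ℕ →o (Submodule K E)ᵒᵈ :=
    { toFun := fun n => OrderDual.toDual (Submodule.comap E.subtype (⨅ i ≤ n, V i))
      monotone' := fun n m h => by
        refine OrderDual.toDual_le_toDual.2 (Submodule.comap_mono ?_)
        exact biInf_mono fun i hi => hi.trans h }
  have : FiniteDimensional K E := FiniteDimensional.span_finset K _
  obtain ⟨n0, hn0⟩ := IsArtinian.monotone_stabilizes W
  have hW : ∀ z, (∀ i ≤ n0, z ∈ V i) → z = 0 := by
    intro z hz
    have hzE : z ∈ E := hE (hz 0 (Nat.zero_le _))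
    have hall : ∀ n, z ∈ V n := by
      intro n
      have h1 : (⟨z, hzE⟩ : E) ∈ OrderDual.ofDual (W n0) := by
        simp only [W]
        change z ∈ (⨅ i ≤ n0, V i)
        simpa [Submodule.mem_iInf] using hz
      rw [hn0 (max n0 n) (le_max_left _ _)] at h1
      have h2 : z ∈ (⨅ i ≤ max n0 n, V i) := h1
      simp only [Submodule.mem_iInf] at h2
      exact h2 n (le_max_right _ _)
    obtain ⟨⟨y, s⟩, rfl⟩ := IsLocalizedModule.mk'_surjective S f z
    simp only [Function.uncurry_apply_pair] at hall ⊢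
    obtain ⟨b, hb, hby⟩ := hint y fun n => hV n y (by
      rw [← IsLocalizedModule.mk'_cancel' f y s, Submonoid.smul_def, ← algebraMap_smul K]
      exact Submodule.smul_mem _ _ (hall n))
    rw [IsLocalizedModule.mk'_eq_zero, IsLocalizedModule.eq_zero_iff S f]
    exact ⟨⟨b, mem_nonZeroDivisors_of_ne_zero hb⟩, hby⟩
  let F : D →ₗ[K] ((i : Fin (n0 + 1)) → D ⧸ V i) := LinearMap.pi fun i => (V i).mkQ
  have hF : LinearMap.ker F = ⊥ := by
    rw [LinearMap.ker_eq_bot']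
    intro z hz
    refine hW z fun i hi => ?_
    have := congrFun hz ⟨i, by omega⟩
    simpa [F] using this
  obtain ⟨g, hg⟩ := LinearMap.exists_leftInverse_of_injective F hF
  let sD : ℕ → D → D := fun n z =>
    if h : n < n0 + 1 then g (Pi.single ⟨n, h⟩ ((V n).mkQ z)) else 0
  refine ⟨n0, fun κ T τ => ?_⟩
  obtain ⟨a, ha⟩ := IsLocalizedModule.exist_integer_multiples S f
    ((Finset.range (n0 + 1)) ×ˢ T) (fun q => sD q.1 (f (τ q.2)))
  have ha' : ∀ (n : ℕ) (t : κ), ∃ m : M, n ∈ Finset.range (n0 + 1) → t ∈ T →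
      f m = a • sD n (f (τ t)) := by
    intro n t
    by_cases h : n ∈ Finset.range (n0 + 1) ∧ t ∈ T
    · obtain ⟨m, hm⟩ := ha (n, t) (by simpa using h)
      exact ⟨m, fun _ _ => hm⟩
    · exact ⟨0, fun h1 h2 => absurd ⟨h1, h2⟩ h⟩
  choose s hs using ha'
  refine ⟨a, nonZeroDivisors.ne_zero a.2, s, fun y c hc => ?_⟩
  have key : f y = ∑ n ∈ Finset.range (n0 + 1), ∑ t ∈ T, c n t • sD n (f (τ t)) := by
    have h1 : f y = g (F (f y)) := by
      have := LinearMap.congr_fun hg (f y); simpa using this.symm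
    rw [h1, ← Finset.univ_sum_single (F (f y)), map_sum, Finset.sum_range]
    refine Finset.sum_congr rfl fun i _ => ?_
    have h2 : F (f y) i = ∑ t ∈ T, c i t • (V i).mkQ (f (τ t)) := by
      have h3 := hVf i _ (hc i (by omega))
      rw [map_sub, ← Submodule.Quotient.eq] at h3
      change Submodule.Quotient.mk (f y) = _
      rw [h3]
      change (V i).mkQ _ = _
      simp only [map_sum, map_smul]
      refine Finset.sum_congr rfl fun t _ => ?_
      rw [← algebraMap_smul K, map_smul, algebraMap_smul]
    rw [h2]
    simp only [sD, dif_pos i.2]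
    have h4 : ∀ z : (D ⧸ V i), Pi.single i z = LinearMap.single K (fun j : Fin (n0+1) => D ⧸ V j) i z :=
      fun _ => rfl
    simp only [Fin.eta]
    rw [h4, map_sum, map_sum]
    refine Finset.sum_congr rfl fun t _ => ?_
    rw [← algebraMap_smul K, map_smul, map_smul, algebraMap_smul, h4]
  have hz : f ((a : A) • y - ∑ n ∈ Finset.range (n0 + 1), ∑ t ∈ T, c n t • s n t) = 0 := by
    rw [map_sub, map_smul, key, sub_eq_zero, Finset.smul_sum, map_sum]
    refine Finset.sum_congr rfl fun n hn => ?_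
    rw [Finset.smul_sum, map_sum]
    refine Finset.sum_congr rfl fun t ht => ?_
    rw [map_smul, hs n t hn ht, Submonoid.smul_def, smul_comm]
  rw [IsLocalizedModule.eq_zero_iff S f] at hz
  obtain ⟨b, hb⟩ := hz
  exact ⟨b, nonZeroDivisors.ne_zero b.2, hb⟩
end HH

namespace HH
section
variable {Ω : Type} [CommRing Ω] {ι : Type} {p : ℕ} {G : Set (Subring Ω)} {I : Type}

theorem noethT (hB : Base p G) {S : Subring Ω} (hS : S ∈ G) (P : Ideal S) :
    ∃ T : Finset Ω, (∀ t ∈ T, ∃ h : t ∈ S, (⟨t, h⟩ : S) ∈ P) ∧ ∀ w (h : w ∈ S), (⟨w, h⟩ : S) ∈ P →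
      ∃ a : Ω → Ω, (∀ t, a t ∈ S) ∧ w = ∑ t ∈ T, a t * t := by
  classical
  have := hB.noeth S hS
  obtain ⟨T, hT⟩ := (isNoetherianRing_iff_ideal_fg S).1 this P
  refine ⟨T.image Subtype.val, ?_, fun w h hw => ?_⟩
  · intro t ht
    obtain ⟨t, ht', rfl⟩ := Finset.mem_image.1 ht
    exact ⟨t.2, by rw [← hT]; exact Ideal.subset_span ht'⟩
  · rw [← hT] at hw
    obtain ⟨a, ha⟩ := Submodule.mem_span_finset'.1 hw
    refine ⟨fun t => if h : ∃ h : t ∈ S, (⟨t, h⟩ : S) ∈ T then (a ⟨⟨t, h.1⟩, h.2⟩ : S) else 0, ?_, ?_⟩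
    · intro t
      by_cases h : ∃ h : t ∈ S, (⟨t, h⟩ : S) ∈ T
      · simp only [dif_pos h]; exact Subtype.mem _
      · simp only [dif_neg h]; exact S.zero_mem
    · rw [Finset.sum_image (by simp), ← Finset.sum_attach T]
      have := congrArg (Subtype.val : S → Ω) ha
      simp only [smul_eq_mul, Subring.coe_mul, AddSubmonoidClass.coe_finsetSum] at this
      rw [← this]
      exact Finset.sum_congr rfl fun t _ => by simp

theorem unif (hB : Base p G) [Finite ι] {x : ι → Ω} {H : Finset ι} {U : I → Ω} (hU : Bdd G U)
    (h : ∀ ν, U ν ∈ Ideal.span (x '' (H : Set ι))) : Mem G x (fun _ _ => 1) H U := by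
  obtain ⟨S, hS, hUS⟩ := hU
  obtain ⟨T, hT, hT2⟩ := noethT hB hS ((Ideal.span (x '' (H : Set ι))).comap S.subtype)
  choose a ha hUa using fun ν => hT2 (U ν) (hUS ν) (h ν)
  rw [funext hUa]
  refine Mem.sum hB T fun t ht => Mem.mul hB ?_ ⟨S, hS, fun ν => ha ν t⟩
  obtain ⟨h1, h2⟩ := hT t ht
  obtain ⟨c, hc⟩ := mem_sp.1 (show t ∈ Ideal.span (x '' (H : Set ι)) from h2)
  exact ⟨fun _ => c, Bdd.fin (f := fun _ => c) hB fun i => Bdd.const hB (c i), fun ν => by simpa using hc⟩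

theorem unif2 (hB : Base p G) [IsDomain Ω] (B : Subring Ω) (q : Ideal Ω) {U : I → Ω} (hU : Bdd G U)
    (h : ∀ ν, ∃ b ∈ B, b ≠ 0 ∧ b * U ν ∈ q) : ∃ b ∈ B, b ≠ 0 ∧ ∀ ν, b * U ν ∈ q := by
  classical
  obtain ⟨S, hS, hUS⟩ := hU
  let P : Ideal S :=
    { carrier := {w | ∃ b ∈ B, b ≠ 0 ∧ b * (w : Ω) ∈ q}
      zero_mem' := ⟨1, B.one_mem, one_ne_zero, by simp⟩
      add_mem' := by
        rintro w w' ⟨b, hb, h0, h⟩ ⟨b', hb', h0', h'⟩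
        refine ⟨b * b', B.mul_mem hb hb', mul_ne_zero h0 h0', ?_⟩
        have : b * b' * ((w + w' : S) : Ω) = b' * (b * w) + b * (b' * w') := by
          rw [Subring.coe_add]; ring
        rw [this]
        exact q.add_mem (q.mul_mem_left _ h) (q.mul_mem_left _ h')
      smul_mem' := by
        rintro c w ⟨b, hb, h0, h⟩
        refine ⟨b, hb, h0, ?_⟩
        have : b * ((c • w : S) : Ω) = c * (b * w) := by
          rw [smul_eq_mul, Subring.coe_mul]; ring
        rw [this]; exact q.mul_mem_left _ h }
  obtain ⟨T, hT, hT2⟩ := noethT hB hS P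
  have : ∀ T' ⊆ T, ∃ b ∈ B, b ≠ 0 ∧ ∀ t ∈ T', b * t ∈ q := by
    intro T'
    induction T' using Finset.induction_on with
    | empty => exact fun _ => ⟨1, B.one_mem, one_ne_zero, by simp⟩
    | insert t T' ht ih =>
      intro hs
      obtain ⟨b, hb, h0, h⟩ := ih ((Finset.subset_insert _ _).trans hs)
      obtain ⟨_, b', hb', h0', h'⟩ := hT t (hs (Finset.mem_insert_self _ _))
      refine ⟨b * b', B.mul_mem hb hb', mul_ne_zero h0 h0', fun s hs => ?_⟩
      rcases Finset.mem_insert.1 hs with rfl | hs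
      · rw [mul_assoc]; exact q.mul_mem_left _ h'
      · rw [mul_comm b, mul_assoc]; exact q.mul_mem_left _ (h s hs)
  obtain ⟨b, hb, h0, hbT⟩ := this T subset_rfl
  refine ⟨b, hb, h0, fun ν => ?_⟩
  obtain ⟨a, -, ha⟩ := hT2 (U ν) (hUS ν) (h ν)
  rw [ha, Finset.mul_sum]
  exact q.sum_mem fun t ht => by rw [mul_left_comm]; exact q.mul_mem_left _ (hbT t ht)

theorem Base.frobN (hB : Base p G) (n : ℕ) : ∀ S ∈ G, ∃ T ∈ G, ∀ w : Ω, w ^ p ^ n ∈ S → w ∈ T := by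
  induction n with
  | zero => exact fun S hS => ⟨S, hS, fun w h => by simpa using h⟩
  | succ n ih =>
    intro S hS
    obtain ⟨T, hT, h⟩ := ih S hS
    obtain ⟨T', hT', h'⟩ := hB.frob T hT
    exact ⟨T', hT', fun w hw => h' w (h _ (by rwa [← pow_mul, ← pow_succ']))⟩

/-- perfect closure of a subring -/
def pcl [Fact p.Prime] [CharP Ω p] (B : Subring Ω) : Subring Ω where
  carrier := {b | ∃ n, b ^ p ^ n ∈ B}
  zero_mem' := ⟨0, by simp⟩
  one_mem' := ⟨0, by simp⟩
  add_mem' := by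
    rintro a b ⟨n, hn⟩ ⟨m, hm⟩
    refine ⟨n + m, ?_⟩
    rw [add_pow_char_pow]
    refine B.add_mem ?_ ?_
    · rw [pow_add, pow_mul]; exact B.pow_mem hn _
    · rw [add_comm, pow_add, pow_mul]; exact B.pow_mem hm _
  mul_mem' := by
    rintro a b ⟨n, hn⟩ ⟨m, hm⟩
    refine ⟨n + m, ?_⟩
    rw [mul_pow]
    refine B.mul_mem ?_ ?_
    · rw [pow_add, pow_mul]; exact B.pow_mem hn _
    · rw [add_comm, pow_add, pow_mul]; exact B.pow_mem hm _
  neg_mem' := by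
    rintro a ⟨n, hn⟩
    refine ⟨n, ?_⟩
    rw [neg_pow]
    exact B.mul_mem (B.pow_mem (B.neg_mem B.one_mem) _) hn

theorem span_frobN [Fact p.Prime] [CharP Ω p] {x : ι → Ω} {H : Finset ι} {a : Ω} (n : ℕ)
    (h : a ∈ Ideal.span (x '' (H : Set ι))) :
    a ^ p ^ n ∈ Ideal.span ((fun i => x i ^ p ^ n) '' (H : Set ι)) := by
  obtain ⟨c, rfl⟩ := mem_sp.1 h
  rw [sum_pow_char_pow]
  exact mem_sp.2 ⟨fun i => c i ^ p ^ n, Finset.sum_congr rfl fun i _ => by rw [mul_pow]⟩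

/-- separation: elements of all the twisted spans are torsion -/
theorem hintE (hB : Base p G) [Fact p.Prime] [CharP Ω p] [IsDomain Ω] [DecidableEq ι]
    {H : Finset ι} (hne : H.Nonempty) {x : ι → Ω} (hx : ∀ i ∈ H, x i ≠ 0)
    (A : Subring Ω) (T : Finset Ω) (Y : Ω) (b η : ℕ → Ω) (hb : ∀ n, b n ∈ A) (hb0 : ∀ n, b n ≠ 0)
    (hη : ∀ n, ∃ c : Ω → A, η n - ∑ t ∈ T, (c t : Ω) * t ∈ Ideal.span (x '' (H : Set ι)))
    (h : ∀ n, b n * Y ^ p ^ n - (∏ i ∈ H, x i) ^ (p ^ n - 1) * η n ∈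
      Ideal.span ((fun i => x i ^ p ^ n) '' (H : Set ι))) :
    ∃ c ∈ A, c ≠ 0 ∧ c * Y ∈ Ideal.span (x '' (H : Set ι)) := by
  classical
  choose c hc using hη
  -- a nontrivial relation
  have hdep : ¬ LinearIndependent A (fun i : Fin (T.card + 1) => fun t : T => c i t) := by
    intro hli
    have := hli.fintype_card_le_finrank
    simp at this
  rw [Fintype.not_linearIndependent_iff] at hdep
  obtain ⟨μ0, hμ0, i0, hi0⟩ := hdep
  let μ : ℕ → A := fun i => if h : i < T.card + 1 then μ0 ⟨i, h⟩ else 0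
  have hex : ∃ N, μ N ≠ 0 ∧ ∀ i, N < i → μ i = 0 := by
    let F := (Finset.range (T.card + 1)).filter fun i => μ i ≠ 0
    have hF : F.Nonempty := ⟨i0, Finset.mem_filter.2 ⟨Finset.mem_range.2 i0.2, by
      simp only [μ]; rw [dif_pos i0.2]; exact hi0⟩⟩
    refine ⟨F.max' hF, (Finset.mem_filter.1 (F.max'_mem hF)).2, fun i hi => ?_⟩
    by_contra hne
    have : i ∈ F := by
      refine Finset.mem_filter.2 ⟨?_, hne⟩
      by_contra h'
      exact hne (by simp only [μ]; rw [dif_neg (by simpa using h')])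
    exact absurd (F.le_max' i this) (by omega)
  obtain ⟨N, hN, hN'⟩ := hex
  have hNlt : N < T.card + 1 := by
    by_contra h'; exact hN (by simp only [μ]; rw [dif_neg h'])
  have hrel : ∑ i ∈ Finset.range (N + 1), (μ i : Ω) * η i ∈ Ideal.span (x '' (H : Set ι)) := by
    have e1 : ∑ i ∈ Finset.range (T.card + 1), (μ i : Ω) * ∑ t ∈ T, (c i t : Ω) * t = 0 := by
      rw [Finset.sum_range]
      have : ∀ i : Fin (T.card + 1), μ i = μ0 i := fun i => by simp only [μ]; rw [dif_pos i.2]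
      simp only [this, Finset.mul_sum]
      rw [Finset.sum_comm]
      refine Finset.sum_eq_zero fun t ht => ?_
      have := congrArg (Subtype.val : A → Ω) (congrFun hμ0 ⟨t, ht⟩)
      simp only [Finset.sum_apply, Pi.smul_apply, smul_eq_mul, AddSubmonoidClass.coe_finsetSum,
        Subring.coe_mul, Pi.zero_apply, Subring.coe_zero] at this
      simp only [← mul_assoc]
      rw [← Finset.sum_mul, this, zero_mul]
    have e2 : ∑ i ∈ Finset.range (T.card + 1), (μ i : Ω) * (η i - ∑ t ∈ T, (c i t : Ω) * t) ∈
        Ideal.span (x '' (H : Set ι)) := Ideal.sum_mem _ fun i _ => Ideal.mul_mem_left _ _ (hc i)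
    simp only [mul_sub, Finset.sum_sub_distrib] at e2
    rw [e1, sub_zero] at e2
    rwa [Finset.sum_subset (Finset.range_mono (by omega : N + 1 ≤ T.card + 1))]
    intro i _ hi
    rw [hN' i (by simpa using hi)]; simp
  let P : ℕ → Ω := fun i => ∏ l ∈ (Finset.range (N + 1)).erase i, b l
  let c0 : Ω := μ N * ∏ l ∈ Finset.range (N + 1), b l
  have hc0 : ∀ i ≤ N, c0 = b i * (μ N * P i) := fun i hi => by
    simp only [c0, P]
    rw [← Finset.mul_prod_erase (Finset.range (N + 1)) b
      (Finset.mem_range.2 (by omega : i < N + 1))]; ring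
  have hpo : ∀ i, 1 ≤ p ^ i := fun i => Nat.one_le_pow _ _ (Fact.out : p.Prime).pos
  refine ⟨c0, A.mul_mem (μ N).2 (A.prod_mem fun l _ => hb l), mul_ne_zero (by simpa using hN)
    (Finset.prod_ne_zero_iff.2 fun l _ => hb0 l), ?_⟩
  refine lemE hB H hne x hx (c0 * Y) (fun i => c0 ^ (p ^ i - 1) * (μ N * P i) * η i) N
    (fun i => - (P N * μ i * c0 ^ (p ^ N - 1 - p ^ i) * b i)) (fun n hn => ?_) ?_
  · have := Ideal.mul_mem_left _ (c0 ^ (p ^ n - 1) * (μ N * P n)) (h n)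
    convert this using 1
    have e : (c0 * Y) ^ p ^ n = c0 ^ (p ^ n - 1) * (b n * (μ N * P n)) * Y ^ p ^ n := by
      rw [mul_pow, ← hc0 n hn, ← pow_succ, Nat.sub_add_cancel (hpo n)]
    rw [e]; ring
  · have := Ideal.mul_mem_left _ (c0 ^ (p ^ N - 1) * P N) hrel
    convert this using 1
    rw [Finset.sum_range_succ, mul_add, Finset.mul_sum, sub_eq_add_neg, ← Finset.sum_neg_distrib,
      add_comm]
    congr 1
    · refine Finset.sum_congr rfl fun i hi => ?_
      have hlt : p ^ i < p ^ N :=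
        Nat.pow_lt_pow_right (Fact.out : p.Prime).one_lt (Finset.mem_range.1 hi)
      have h1 : p ^ N - 1 = (p ^ N - 1 - p ^ i) + (p ^ i - 1) + 1 := by
        have := hpo i; omega
      have h2 : c0 ^ (p ^ N - 1) = c0 ^ (p ^ N - 1 - p ^ i) * c0 ^ (p ^ i - 1) *
          (b i * (μ N * P i)) := by
        rw [← hc0 i (Finset.mem_range.1 hi).le, ← pow_add, ← pow_succ, ← h1]
      rw [h2]; ring
    · ring
end
end HH

namespace HH
section
variable {Ω : Type} [CommRing Ω] {ι : Type} {p : ℕ} {G : Set (Subring Ω)} {I : Type}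

theorem crux (hB : Base p G) [Fact p.Prime] [CharP Ω p] [IsDomain Ω] [DecidableEq ι] [Finite ι]
    {H J : Finset ι} (hne : H.Nonempty) (hHJ : H ⊆ J) {x : ι → Ω} (hx : ∀ i ∈ H, x i ≠ 0)
    (B : Subring Ω) (hBS : ∃ S ∈ G, B ≤ S) (hxB : ∀ j, j ∉ H → x j ∈ B)
    (hsp : ∀ S ∈ G, ∃ (e : ℕ) (T : Finset Ω), ∀ w ∈ S, ∃ b : Ω → Ω, (∀ t, b t ^ p ^ e ∈ B) ∧
      w - ∑ t ∈ T, b t * t ∈ Ideal.span (x '' (H : Set ι)))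
    {α : I → ι → ℕ} (hα : ∀ ν, ∀ i ∈ H, α ν i = 1) {v : I → Ω} (hv : Bdd G v)
    (w g : ℕ → I → Ω) (hw : ∃ S ∈ G, ∀ n ν, w n ν ∈ S)
    (hg : ∀ n ν, g n ν ^ p ^ n = (∏ i ∈ H, x i) ^ (p ^ n - 1) * w n ν)
    (hm : ∀ n, Mem G x α J (fun ν => v ν - g n ν)) :
    ∃ a ∈ B, a ≠ 0 ∧ Mem G x α J (fun ν => a * v ν) := by
  classical
  obtain ⟨S, hS, hwS⟩ := hw
  let A : Subring Ω := pcl (p := p) B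
  have hBA : B ≤ A := fun b hb => ⟨0, by simpa using hb⟩
  set q := Ideal.span (x '' (H : Set ι)) with hq
  set β := ∏ i ∈ H, x i with hβ
  let π : Ω →ₗ[A] (Ω ⧸ q) := (Submodule.mkQ q).restrictScalars A
  have hπ : ∀ y, π y = 0 ↔ y ∈ q := fun y => Submodule.Quotient.mk_eq_zero q
  have hsm : ∀ (a : A) (y : Ω), a • y = (a : Ω) * y := fun a y => rfl
  let Z0 : ℕ → Submodule A Ω := fun n => Submodule.span A {z | ∃ s ∈ S, z ^ p ^ n = β ^ (p ^ n - 1) * s}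
  let Z : ℕ → Submodule A (Ω ⧸ q) := fun n => (Z0 n).map π
  obtain ⟨e0, T0, hT0⟩ := hsp S hS
  have hS0 : ∀ s ∈ Submodule.span A (S : Set Ω), ∃ c : Ω → A, s - ∑ t ∈ T0, (c t : Ω) * t ∈ q := by
    intro s hs
    induction hs using Submodule.span_induction with
    | mem s hs =>
      obtain ⟨b, hb, h⟩ := hT0 s hs
      exact ⟨fun t => ⟨b t, e0, hb t⟩, h⟩
    | zero => exact ⟨0, by simp⟩
    | add s s' _ _ h h' =>
      obtain ⟨c, hc⟩ := h
      obtain ⟨c', hc'⟩ := h'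
      refine ⟨fun t => c t + c' t, ?_⟩
      convert q.add_mem hc hc' using 1
      simp only [Subring.coe_add, add_mul, Finset.sum_add_distrib]; ring
    | smul a s _ h =>
      obtain ⟨c, hc⟩ := h
      refine ⟨fun t => a * c t, ?_⟩
      convert q.mul_mem_left a hc using 1
      rw [hsm, mul_sub, Finset.mul_sum]
      simp only [Subring.coe_mul, mul_assoc]
  have hZ0 : ∀ n, ∀ z ∈ Z0 n, ∃ s ∈ Submodule.span A (S : Set Ω), z ^ p ^ n = β ^ (p ^ n - 1) * s := by
    intro n z hz
    induction hz using Submodule.span_induction with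
    | mem z hz => obtain ⟨s, hs, h⟩ := hz; exact ⟨s, Submodule.subset_span hs, h⟩
    | zero => exact ⟨0, Submodule.zero_mem _, by simp [(Fact.out : p.Prime).ne_zero]⟩
    | add s s' _ _ h h' =>
      obtain ⟨c, hc, h⟩ := h
      obtain ⟨c', hc', h'⟩ := h'
      exact ⟨c + c', Submodule.add_mem _ hc hc', by rw [add_pow_char_pow, h, h']; ring⟩
    | smul a s _ h =>
      obtain ⟨c, hc, h⟩ := h
      refine ⟨(a ^ p ^ n) • c, Submodule.smul_mem _ _ hc, ?_⟩
      rw [hsm, hsm, mul_pow, h, Subring.coe_pow]; ring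
  have hz : Z 0 ≤ Submodule.span A ((T0.image π : Finset (Ω ⧸ q)) : Set (Ω ⧸ q)) := by
    rintro _ ⟨z, hz, rfl⟩
    obtain ⟨s, hs, h⟩ := hZ0 0 z hz
    have : z = s := by simpa using h
    subst this
    obtain ⟨c, hc⟩ := hS0 z hs
    have e : π z = ∑ t ∈ T0, c t • π t := by
      rw [← hπ, map_sub, sub_eq_zero] at hc
      rw [hc, map_sum]
      exact Finset.sum_congr rfl fun t _ => by rw [← map_smul, hsm]
    rw [e]
    exact Submodule.sum_mem _ fun t ht => Submodule.smul_mem _ _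
      (Submodule.subset_span (by simpa using ⟨t, ht, rfl⟩))
  have hint : ∀ y, (∀ n, ∃ b : A, b ≠ 0 ∧ b • y ∈ Z n) → ∃ b : A, b ≠ 0 ∧ b • y = 0 := by
    intro y hy
    obtain ⟨Y, rfl⟩ := Submodule.mkQ_surjective q y
    choose b hb0 hb using hy
    choose z hz hzb using hb
    choose s hs hzs using fun n => hZ0 n (z n) (hz n)
    obtain ⟨c, hcA, hc0, hc⟩ := hintE hB hne hx A T0 Y (fun n => (b n : Ω) ^ p ^ n) s
      (fun n => A.pow_mem (b n).2 _) (fun n => pow_ne_zero _ (by simpa using hb0 n))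
      (fun n => hS0 _ (hs n)) (fun n => by
        rw [← hβ, ← mul_pow, ← hzs, ← sub_pow_char_pow]
        refine span_frobN n ?_
        rw [← hq, ← hπ, map_sub, hzb, ← hsm, map_smul, sub_eq_zero]; rfl)
    exact ⟨⟨c, hcA⟩, by simpa [Subtype.ext_iff] using hc0, (hπ (c * Y)).2 hc⟩
  obtain ⟨n0, hLA⟩ := LA Z (T0.image π) hz hint
  choose r hr hrm using hm
  -- common ring for the coefficients
  have hrb : Bdd G (fun q : (I × ι) × Fin (n0 + 1) => r q.2 q.1.1 q.1.2) :=
    Bdd.fin (f := fun (q : I × ι) (n : Fin (n0 + 1)) => r n q.1 q.2) hB fun n => hr n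
  obtain ⟨S1, hS1, hrS⟩ := hrb
  obtain ⟨e1, T1, hT1⟩ := hsp S1 hS1
  have hT1' : ∀ (ν : I) (n : ℕ) (j : ι), ∃ b : Ω → Ω, (∀ t, b t ^ p ^ e1 ∈ B) ∧
      (n ≤ n0 → r n ν j - ∑ t ∈ T1, b t * t ∈ q) := by
    intro ν n j
    by_cases hn : n ≤ n0
    · obtain ⟨b, hb, h⟩ := hT1 (r n ν j) (hrS ((ν, j), ⟨n, by omega⟩))
      exact ⟨b, hb, fun _ => h⟩
    · exact ⟨fun _ => 0, fun _ => by simp [(Fact.out : p.Prime).ne_zero], fun h => absurd h hn⟩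
  choose b hb hbr using hT1'
  obtain ⟨a, ha0, s, hs⟩ := hLA Ω T1 (fun t => π t)
  choose sl hsl using fun n t => Submodule.mkQ_surjective q (s n t)
  let cc : I → ℕ → Ω → Ω := fun ν n t => ∑ j ∈ J \ H, x j ^ α ν j * b ν n j t
  have hccA : ∀ ν n t, cc ν n t ∈ A := fun ν n t => A.sum_mem fun j hj => A.mul_mem
    (A.pow_mem (hBA (hxB j (Finset.mem_sdiff.1 hj).2)) _) ⟨e1, hb ν n j t⟩
  let E : I → Ω := fun ν => a * v ν - ∑ n ∈ Finset.range (n0 + 1), ∑ t ∈ T1, cc ν n t * sl n t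
  have hE : ∀ ν, ∃ b ∈ A, b ≠ 0 ∧ b * E ν ∈ q := by
    intro ν
    obtain ⟨b', hb0, hb'⟩ := hs (π (v ν)) (fun n t => ⟨cc ν n t, hccA ν n t⟩) (fun n hn => by
      refine ⟨g n ν, Submodule.subset_span ⟨w n ν, hwS n ν, hg n ν⟩, ?_⟩
      simp only [← map_smul, hsm]
      rw [← map_sum, ← map_sub, ← sub_eq_zero, ← map_sub, hπ]
      have h1 := hrm n ν
      rw [← Finset.sum_sdiff hHJ] at h1
      have h2 : ∑ t ∈ T1, cc ν n t * t = ∑ j ∈ J \ H, x j ^ α ν j * ∑ t ∈ T1, b ν n j t * t := by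
        simp only [cc, Finset.sum_mul, Finset.mul_sum]
        rw [Finset.sum_comm]
        simp only [mul_assoc]
      have h3 : g n ν - (v ν - ∑ t ∈ T1, cc ν n t * t) =
          - (∑ j ∈ J \ H, x j ^ α ν j * (r n ν j - ∑ t ∈ T1, b ν n j t * t)) -
            ∑ j ∈ H, r n ν j * x j ^ α ν j := by
        simp only [mul_sub, Finset.sum_sub_distrib]
        rw [h2, sub_eq_iff_eq_add.1 h1, Finset.sum_congr rfl fun j _ => mul_comm (r n ν j) _]
        ring
      rw [h3]
      refine q.sub_mem (q.neg_mem (q.sum_mem fun j _ => q.mul_mem_left _ (hbr ν n j hn)))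
        (q.sum_mem fun j hj => q.mul_mem_left _ ?_)
      rw [hα ν j hj, pow_one]
      exact Ideal.subset_span ⟨j, hj, rfl⟩)
    refine ⟨b', b'.2, by simpa using hb0, ?_⟩
    rw [← hπ, ← hsm, map_smul]
    convert hb' using 2
    simp only [E, map_sub, map_sum]
    congr 1
    refine Finset.sum_congr rfl fun n _ => Finset.sum_congr rfl fun t _ => ?_
    rw [← hsl]; rfl
  have hbbd : ∀ n j t, Bdd G (fun ν => b ν n j t) := by
    intro n j t
    obtain ⟨S', hS', hBS⟩ := hBS
    obtain ⟨S'', hS'', h⟩ := hB.frobN e1 S' hS'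
    exact ⟨S'', hS'', fun ν => h _ (hBS (hb ν n j t))⟩
  have hccb : ∀ n t, Bdd G (fun ν => cc ν n t) := fun n t =>
    Bdd.sum hB _ fun j _ => ((Bdd.const hB (x j)).pow _).mul hB (hbbd n j t)
  have hEb : Bdd G E := ((Bdd.const hB (a : Ω)).mul hB hv).sub hB
    (Bdd.sum hB _ fun n _ => Bdd.sum hB _ fun t _ => (hccb n t).mul hB (Bdd.const hB _))
  obtain ⟨b1, hb1A, hb10, hb1⟩ := unif2 hB A q hEb hE
  have hM1 := unif (x := x) (H := H) hB ((Bdd.const hB b1).mul hB hEb) hb1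
  have hM2 : Mem G x α J (fun ν => b1 * E ν) :=
    hM1.mono hB hHJ fun ν i hi => (hα ν i hi).le
  have hM3 : ∀ n t, Mem G x α J (fun ν => cc ν n t) := fun n t => Mem.sum hB _ fun j hj => by
    simpa only [mul_comm] using
      Mem.single (x := x) (α := α) hB (hbbd n j t) (Finset.mem_sdiff.1 hj).1
  have hM4 : Mem G x α J (fun ν => ∑ n ∈ Finset.range (n0 + 1), ∑ t ∈ T1, sl n t * cc ν n t) :=
    Mem.sum hB _ fun n _ => Mem.sum hB _ fun t _ => (hM3 n t).mul hB (Bdd.const hB _)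
  have hM5 : Mem G x α J (fun ν => (b1 * a) * v ν) := by
    convert hM2.add hB (hM4.mul hB (Bdd.const hB b1)) using 2 with ν
    simp only [E, mul_comm (sl _ _)]; ring
  obtain ⟨k, hk⟩ := A.mul_mem hb1A a.2
  refine ⟨_, hk, pow_ne_zero _ (mul_ne_zero hb10 (by simpa using ha0)), ?_⟩
  convert hM5.mul hB (Bdd.const hB ((b1 * a) ^ (p ^ k - 1))) using 2 with ν
  rw [← mul_assoc, ← pow_succ, Nat.sub_add_cancel (Nat.one_le_pow _ _ (Fact.out : p.Prime).pos)]
end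
end HH

set_option linter.unusedSectionVars false
namespace HH
section
variable {Ω : Type} [CommRing Ω] {ι : Type} {p : ℕ} {G : Set (Subring Ω)} {I : Type}
variable [DecidableEq ι] [Finite ι] {Par : Set (ι → Ω)} {m : ℕ} {x : ι → Ω}
  {α : I → ι → ℕ} {J : Finset ι}

theorem Mem.frobN [Fact p.Prime] [CharP Ω p] (n : ℕ) {α : I → ι → ℕ} {U : I → Ω}
    (h : Mem G x α J U) : Mem G x (fun ν i => p ^ n * α ν i) J (fun ν => U ν ^ p ^ n) := by
  induction n with
  | zero => simpa using h
  | succ n ih =>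
    have := ih.frob
    simpa only [pow_succ', mul_assoc, pow_mul, pow_right_comm] using this

theorem tel (hB : Base p G) [Fact p.Prime] [CharP Ω p] (hR : Reg G Par m) (hx : x ∈ Par)
    (hJ : J.card ≤ m) {H : Finset ι} (hH : H ⊆ J) {σ : I → I} {e : I → ℕ} {u v : I → Ω}
    (he : ∀ ν, e (σ ν) = e ν + 1) (hu : ∀ ν, u (σ ν) = u ν ^ p) (hv : Bdd G v)
    (h : Mem G x (fun ν _ => p ^ e ν) J (fun ν => u ν - (∏ i ∈ H, x i ^ (p ^ e ν - 1)) * v ν))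
    (n : ℕ) : Mem G x (fun ν i => if i ∈ H then p ^ n else p ^ (e ν + n)) J
      (fun ν => v ν ^ p ^ n - (∏ i ∈ H, x i) ^ (p ^ n - 1) * v (σ^[n] ν)) := by
  have hp := (Fact.out : p.Prime)
  have he' : ∀ ν, e (σ^[n] ν) = e ν + n := by
    intro ν
    induction n with
    | zero => rfl
    | succ n ih => rw [Function.iterate_succ_apply', he, ih]; ring
  have hu' : ∀ ν, u (σ^[n] ν) = u ν ^ p ^ n := by
    intro ν
    induction n with
    | zero => simp
    | succ n ih => 
      rw [Function.iterate_succ_apply', hu, ih (fun ν => by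
        clear ih
        induction n with
        | zero => rfl
        | succ n ih => rw [Function.iterate_succ_apply', he, ih (fun ν => by
            have := he' ν; rw [Function.iterate_succ_apply', he] at this; omega)]; ring), ← pow_mul, pow_succ]
  have hpo : ∀ i, 1 ≤ p ^ i := fun i => Nat.one_le_pow _ _ hp.pos
  have hple : ∀ ν, p ^ n ≤ p ^ (e ν + n) := fun ν => Nat.pow_le_pow_right hp.pos (by omega)
  refine cancel hB hR hx hJ hH (fun ν _ => p ^ (e ν + n) - p ^ n)
    ((hv.pow _).sub hB (((Bdd.const hB _).pow _).mul hB (hv.comp _))) ?_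
  have h1 := (h.comp σ^[n])
  have h2 := h.frobN n
  have h1' : Mem G x (fun ν i => p ^ n * p ^ e ν) J (fun ν => 
      u (σ^[n] ν) - (∏ i ∈ H, x i ^ (p ^ e (σ^[n] ν) - 1)) * v (σ^[n] ν)) :=
    h1.congr' fun ν i _ => by rw [he', pow_add, mul_comm]
  have h3 := h1'.sub hB h2
  refine Mem.congr' (α := fun ν i => p ^ n * p ^ e ν) (fun ν i hi => ?_) ?_
  · split_ifs
    · rw [Nat.add_sub_cancel' (hple ν), pow_add, mul_comm]
    · rw [pow_add, mul_comm, add_zero]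
  · convert h3 using 2 with ν
    rw [hu', sub_pow_char_pow, he', mul_pow, mul_sub]
    have e1 : ∏ i ∈ H, (x i ^ (p ^ e ν - 1)) ^ p ^ n = ∏ i ∈ H, x i ^ (p ^ (e ν + n) - p ^ n) := by
      refine Finset.prod_congr rfl fun i _ => ?_
      rw [← pow_mul, Nat.sub_mul, one_mul, pow_add]
    have e2 : ∏ i ∈ H, x i ^ (p ^ (e ν + n) - 1) =
        (∏ i ∈ H, x i ^ (p ^ (e ν + n) - p ^ n)) * (∏ i ∈ H, x i) ^ (p ^ n - 1) := by
      rw [← Finset.prod_pow, ← Finset.prod_mul_distrib]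
      refine Finset.prod_congr rfl fun i _ => ?_
      rw [← pow_add]; congr 1
      have := hple ν; have := hpo n; omega
    rw [← Finset.prod_pow H (p ^ n) (fun i => x i ^ (p ^ e ν - 1)), e1, e2]; ring

theorem uu_aux [Fact p.Prime] [CharP Ω p] [IsDomain Ω] (hA : Ax p G Par) (hR : Reg G Par m)
    (k : ℕ) : ∀ x ∈ Par, ∀ (I : Type) (σ : I → I) (e : I → ℕ) (J H : Finset ι) (u : I → Ω) (c : Ω),
    J.card = m → H ⊆ J → (J \ H).card = k → J.Nonempty →
    (∀ ν, e (σ ν) = e ν + 1) → (∀ ν, u (σ ν) = u ν ^ p) → Bdd G u → 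
    (∀ i ∈ H, Mem G x (fun ν _ => p ^ e ν) J (fun ν => x i * u ν)) → 
    (H = ∅ → c ≠ 0 ∧ Mem G x (fun ν _ => p ^ e ν) J (fun ν => c * u ν)) →
    Mem G x (fun ν _ => p ^ e ν) J u := by
  have hB := hA.toBase
  have hp := (Fact.out : p.Prime)
  have hpo : ∀ i, 1 ≤ p ^ i := fun i => Nat.one_le_pow _ _ hp.pos
  induction k with
  | zero =>
    intro x hx I σ e J H u c hJ hH hk hne he hu hbu hxu hc
    obtain rfl : J = H := Finset.Subset.antisymm
      (Finset.sdiff_eq_empty_iff_subset.1 (Finset.card_eq_zero.1 hk)) hH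
    obtain ⟨v, hv, h⟩ := socle hB hR hx hJ.le hH (fun ν _ => hpo _) hbu hxu
    have ht := tel hB hR hx hJ.le hH he hu hv h
    have key : ∀ ν, v ν ∈ Ideal.span (x '' (J : Set ι)) := by
      intro ν
      obtain ⟨S, hS, hvS⟩ := hv
      have := hB.noeth S hS
      let V : ℕ → S := fun n => ⟨v (σ^[n] ν), hvS _⟩
      have hst : ∃ N, V N ∈ Ideal.span (V '' (Finset.range N : Finset ℕ)) := by
        let f : ℕ →o Ideal S := ⟨fun n => Ideal.span (V '' (Finset.range n : Finset ℕ)), by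
          intro a b hab
          exact Ideal.span_mono (Set.image_mono (by simpa using hab))⟩
        obtain ⟨N, hN⟩ := monotone_stabilizes_iff_noetherian.2 this f
        refine ⟨N, ?_⟩
        have := hN (N + 1) (by omega)
        have h2 : V N ∈ f (N + 1) := Ideal.subset_span ⟨N, by simp, rfl⟩
        rw [← this] at h2
        exact h2
      obtain ⟨N, hN⟩ := hst
      obtain ⟨s, hs⟩ := mem_sp.1 hN
      refine lemE hB J hne x (fun i _ => hA.ne0 x hx i) (v ν) (fun n => v (σ^[n] ν)) N
        (fun n => (s n : Ω)) (fun n _ => ?_) ?_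
      · obtain ⟨r, -, hr⟩ := ht n
        refine mem_sp.2 ⟨r ν, (hr ν).trans (Finset.sum_congr rfl fun i hi => by beta_reduce; rw [if_pos hi])⟩
      · have := congrArg (Subtype.val) hs
        rw [AddSubmonoidClass.coe_finsetSum] at this
        rw [show v (σ^[N] ν) = _ from this]
        simp [V]
    have h1 := (unif hB hv key).prodMul hB J (fun ν _ => p ^ e ν - 1)
    have h2 : Mem G x (fun ν _ => p ^ e ν) J (fun ν => (∏ i ∈ J, x i ^ (p ^ e ν - 1)) * v ν) :=
      h1.congr' fun ν i hi => by rw [if_pos hi]; have := hpo (e ν); omega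
    simpa using h.add hB h2
  | succ k ih =>
    intro x hx I σ e J H u c hJ hH hk hne he hu hbu hxu hc
    obtain ⟨j0, hj0⟩ : (J \ H).Nonempty := Finset.card_pos.1 (by omega)
    obtain ⟨hj0J, hj0H⟩ := Finset.mem_sdiff.1 hj0
    obtain ⟨B, hB1, hB2, hB3, hB4, hB5⟩ := hA.sub x hx H
    -- the multiplier
    have ha : ∃ a ∈ B, a ≠ 0 ∧ Mem G x (fun ν _ => p ^ e ν) J (fun ν => a * u ν) := by
      rcases H.eq_empty_or_nonempty with hH0 | hHne
      · obtain ⟨hc0, hcm⟩ := hc hH0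
        obtain ⟨a, haB, ha0, b, hb⟩ := hB5 hH0 c hc0
        refine ⟨a, haB, ha0, ?_⟩
        have := hcm.mul hB (Bdd.const hB b)
        convert this using 2 with ν
        rw [hb]; ring
      · obtain ⟨v, hv, h⟩ := socle hB hR hx hJ.le hH (fun ν _ => hpo _) hbu hxu
        have ht := tel hB hR hx hJ.le hH he hu hv h
        have hroot : ∀ (n : ℕ) (w : Ω), ∃ g, g ^ p ^ n = w := by
          intro n w
          rcases Nat.eq_zero_or_pos n with rfl | hn
          · exact ⟨w, by simp⟩
          · obtain ⟨y, hy⟩ := hB.root n (fun _ => 0) w hn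
            exact ⟨y, by simpa using hy⟩
        choose g hg using fun n ν => hroot n ((∏ i ∈ H, x i) ^ (p ^ n - 1) * v (σ^[n] ν))
        obtain ⟨S, hS, hvS⟩ := hv
        obtain ⟨a, haB, ha0, ham⟩ := crux hB hHne hH (fun i _ => hA.ne0 x hx i) B hB1 hB2 hB3
          (α := fun ν i => if i ∈ H then 1 else p ^ e ν) (fun ν i hi => if_pos hi) ⟨S, hS, hvS⟩
          (fun n ν => v (σ^[n] ν)) g ⟨S, hS, fun n ν => hvS _⟩ hg (fun n => by
            apply Mem.frobInvN hB n
            have := ht n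
            simp only [sub_pow_char_pow, hg]
            refine this.congr' fun ν i _ => ?_
            split_ifs
            · simp
            · rw [pow_add, mul_comm])
        refine ⟨a, haB, ha0, ?_⟩
        have h1 := ham.prodMul hB H (fun ν _ => p ^ e ν - 1)
        have h2 : Mem G x (fun ν _ => p ^ e ν) J
            (fun ν => (∏ i ∈ H, x i ^ (p ^ e ν - 1)) * (a * v ν)) :=
          h1.congr' fun ν i _ => by
            split_ifs
            · have := hpo (e ν); omega
            · rfl
        have h3 := (h.mul hB (Bdd.const hB a)).add hB h2
        convert h3 using 2 with ν
        ring
    obtain ⟨a, haB, ha0, ham⟩ := ha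
    obtain ⟨N, hN, hx'⟩ := hB4 j0 hj0H a haB ha0
    set x' : ι → Ω := fun j => if j ∈ H then x j else if j = j0 then a * x j0 else x j + x j0 ^ N j
      with hx'def
    have hx'H : ∀ i ∈ H, x' i = x i := fun i hi => if_pos hi
    have hx'j : x' j0 = a * x j0 := by simp [x', hj0H]
    have hx'o : ∀ i, i ∉ H → i ≠ j0 → x' i = x i + x j0 ^ N i := fun i h1 h2 => by
      simp [x', h1, h2]
    have hba : Bdd G (fun ν => a ^ p ^ e ν) := (Bdd.const hB a).pow _
    have inc1 : ∀ U : I → Ω, Mem G x (fun ν _ => p ^ e ν) J U →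
        Mem G x' (fun ν _ => p ^ e ν) J (fun ν => a ^ p ^ e ν * U ν) := by
      rintro U ⟨r, hr, hU⟩
      have : (fun ν => a ^ p ^ e ν * U ν) =
          fun ν => ∑ i ∈ J, r ν i * (a ^ p ^ e ν * x i ^ p ^ e ν) := by
        funext ν; rw [hU, Finset.mul_sum]; exact Finset.sum_congr rfl fun i _ => by ring
      rw [this]
      refine Mem.sum hB J fun i hi => Mem.mul hB ?_ (hr.comp fun ν => (ν, i))
      by_cases h1 : i ∈ H
      · rw [← hx'H i h1]
        exact Mem.single hB hba hi
      have hj := Mem.single (x := x') (α := fun ν _ => p ^ e ν) (J := J)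
          (U := fun _ => 1) hB (Bdd.const hB 1) hj0J
      by_cases h2 : i = j0
      · subst h2
        convert hj using 2 with ν
        rw [hx'j, one_mul, mul_pow]
      · have h3 := (Mem.single (x := x') (α := fun ν _ => p ^ e ν) (J := J) hB hba hi).sub hB
          (hj.mul hB (V := fun ν => x j0 ^ ((N i - 1) * p ^ e ν)) ((Bdd.const hB (x j0)).pow _))
        convert h3 using 2 with ν
        rw [hx'j, hx'o i h1 h2, add_pow_char_pow, mul_pow, ← pow_mul]
        have : N i * p ^ e ν = (N i - 1) * p ^ e ν + p ^ e ν := by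
          have := hN i
          obtain ⟨t, ht⟩ : ∃ t, N i = t + 1 := ⟨N i - 1, by omega⟩
          rw [ht]; simp; ring
        rw [this, pow_add]; ring
    have hres : Mem G x' (fun ν _ => p ^ e ν) J (fun ν => a ^ p ^ e ν * u ν) := by
      refine ih x' hx' I σ e J (insert j0 H) _ c hJ (Finset.insert_subset hj0J hH) ?_ hne he ?_
        (hba.mul hB hbu) ?_ (fun h => absurd h (Finset.insert_ne_empty _ _))
      · rw [Finset.sdiff_insert, Finset.card_erase_of_mem hj0, hk]; rfl
      · intro ν; rw [he, hu, mul_pow, ← pow_mul, pow_succ]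
      · intro i hi
        rcases Finset.mem_insert.1 hi with rfl | hi
        · have := inc1 _ (ham.mul hB (Bdd.const hB (x i)))
          convert this using 2 with ν
          rw [hx'j]; ring
        · have := inc1 _ (hxu i hi)
          convert this using 2 with ν
          rw [hx'H i hi]; ring
    obtain ⟨r, hr, hsp⟩ := hres.split hj0J
    have hbd : Bdd G (fun ν => u ν - r ν * x j0 ^ p ^ e ν) :=
      hbu.sub hB (hr.mul hB ((Bdd.const hB _).pow _))
    have h4 : Mem G x' (fun ν _ => p ^ e ν) (J.erase j0) (fun ν => u ν - r ν * x j0 ^ p ^ e ν) := by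
      refine hR x' hx' I _ (fun ν => p ^ e ν) _ j0 _ ?_ (Finset.notMem_erase _ _) hbd ?_
      · rw [Finset.card_erase_of_mem hj0J]
        have := Finset.card_pos.2 hne
        omega
      · have := hsp.mul hB (V := fun ν => x j0 ^ p ^ e ν) ((Bdd.const hB _).pow _)
        convert this using 2 with ν
        rw [hx'j, mul_pow]; ring
    have hone : ∀ i ∈ J, Mem G x (fun ν _ => p ^ e ν) J (fun ν => x i ^ p ^ e ν) := fun i hi => by
      simpa using Mem.single (x := x) (α := fun ν _ => p ^ e ν) (J := J)
          (U := fun _ => 1) hB (Bdd.const hB 1) hi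
    have h5 : Mem G x (fun ν _ => p ^ e ν) J (fun ν => u ν - r ν * x j0 ^ p ^ e ν) := by
      refine h4.trans hB fun i hi => ?_
      obtain ⟨hi1, hi2⟩ := Finset.mem_erase.1 hi
      by_cases h1 : i ∈ H
      · rw [hx'H i h1]; exact hone i hi2
      · rw [hx'o i h1 hi1]
        have := (hone i hi2).add hB ((hone j0 hj0J).mul hB
          (V := fun ν => x j0 ^ ((N i - 1) * p ^ e ν)) ((Bdd.const hB (x j0)).pow _))
        convert this using 2 with ν
        rw [add_pow_char_pow, ← pow_mul, ← pow_add]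
        congr 2
        have := hN i
        obtain ⟨t, ht⟩ : ∃ t, N i = t + 1 := ⟨N i - 1, by omega⟩
        rw [ht]; simp; ring
    have := h5.add hB ((hone j0 hj0J).mul hB hr)
    simpa using this

theorem uu_of_reg [Fact p.Prime] [CharP Ω p] [IsDomain Ω] (hA : Ax p G Par) (hR : Reg G Par m) :
    UU p G Par m := by
  intro x hx I σ e J u c hJ he hu hbu hc h
  rcases J.eq_empty_or_nonempty with rfl | hne
  · obtain ⟨r, hr, h⟩ := h
    refine ⟨r, hr, fun ν => ?_⟩
    have := h ν
    simpa [hc] using this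
  · exact uu_aux hA hR _ x hx I σ e J ∅ u c hJ (Finset.empty_subset _) rfl hne he hu hbu
      (by simp) (fun _ => ⟨hc, h⟩)

theorem reg_all [Fact p.Prime] [CharP Ω p] [IsDomain Ω] (hA : Ax p G Par) (m : ℕ) :
    Reg G Par m := by
  induction m with
  | zero => intro x hx I α β J j W hJ; omega
  | succ m ih => exact reg_succ hA ih (uu_of_reg hA ih)

theorem uu_all [Fact p.Prime] [CharP Ω p] [IsDomain Ω] (hA : Ax p G Par) (m : ℕ) :
    UU p G Par m := uu_of_reg hA (reg_all hA m)

end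
end HH

namespace HH

/-- square-zero extensions of fields of char p split -/
theorem sqz {p : ℕ} [Fact p.Prime] {W L : Type} [CommRing W] [Field L] [CharP W p] (π : W →+* L)
    (hπ : Function.Surjective π) (hsq : ∀ a b, π a = 0 → π b = 0 → a * b = 0) :
    ∃ g : L →+* W, ∀ l, π (g l) = l := by
  have hp := (Fact.out : p.Prime)
  have : CharP L p := by
    refine (CharP.charP_iff_prime_eq_zero hp).2 ?_
    rw [← map_natCast π, CharP.cast_eq_zero, map_zero]
  have hpow0 : ∀ a, π a = 0 → a ^ p = 0 := fun a ha => by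
    have : p = (p - 2) + 1 + 1 := by have := hp.two_le; omega
    rw [this, pow_succ, pow_succ, mul_assoc, hsq a a ha ha, mul_zero]
  have hunit : ∀ a, π a ≠ 0 → IsUnit a := by
    intro a ha
    obtain ⟨b, hb⟩ := hπ (π a)⁻¹
    have h1 : π (a * b - 1) = 0 := by rw [map_sub, map_mul, hb, mul_inv_cancel₀ ha]; simp
    have h2 := hsq _ _ h1 h1
    refine IsUnit.of_mul_eq_one (b * (2 - a * b)) ?_
    linear_combination -h2
  let s : Set (Subring W) := {E | (∀ w, w ^ p ∈ E) ∧ ∀ w ∈ E, π w = 0 → w = 0}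
  let E0 : Subring W := (frobenius W p).range
  have hE0 : E0 ∈ s := by
    refine ⟨fun w => ⟨w, rfl⟩, ?_⟩
    rintro _ ⟨w, rfl⟩ h
    rw [frobenius_def] at h ⊢
    rw [map_pow] at h
    exact hpow0 w (pow_eq_zero_iff hp.ne_zero |>.1 h)
  obtain ⟨E, hE0E, hEm⟩ := zorn_le_nonempty₀ s (by
    intro c hc hch y hy
    refine ⟨sSup c, ⟨fun w => ?_, fun w hw hw0 => ?_⟩, fun z hz => le_sSup hz⟩
    · exact (le_sSup hy : y ≤ sSup c) ((hc hy).1 w)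
    · rw [Subring.mem_sSup_of_directedOn ⟨y, hy⟩ hch.directedOn] at hw
      obtain ⟨t, ht, hwt⟩ := hw
      exact (hc ht).2 w hwt hw0) E0 hE0
  have hEs := hEm.1
  have hfield : IsField E := by
    have : Nontrivial E := ⟨⟨0, 1, fun h => by
      have := congrArg (fun e : E => π (e : W)) h
      simp at this⟩⟩
    refine ⟨⟨0, 1, zero_ne_one⟩, mul_comm, ?_⟩
    intro a ha
    have ha' : π (a : W) ≠ 0 := fun h => ha (Subtype.ext (hEs.2 a a.2 h))
    obtain ⟨u, hu⟩ := hunit _ ha'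
    refine ⟨⟨(a : W) ^ (p - 1) * ((u⁻¹ : Wˣ) : W) ^ p, E.mul_mem (E.pow_mem a.2 _) (hEs.1 _)⟩, ?_⟩
    apply Subtype.ext
    change (a : W) * ((a : W) ^ (p - 1) * ((u⁻¹ : Wˣ) : W) ^ p) = 1
    rw [← mul_assoc, ← pow_succ', Nat.sub_add_cancel hp.one_le, ← hu, ← mul_pow]
    simp
  let := hfield.toField
  let : Algebra E L := (π.comp E.subtype).toAlgebra
  have hsurj : ∀ w, ∃ e ∈ E, π e = π w := by
    intro w
    by_contra! hcon
    let c : E := ⟨w ^ p, hEs.1 w⟩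
    have hirr : Irreducible (Polynomial.X ^ p - Polynomial.C c : Polynomial E) := by
      refine X_pow_sub_C_irreducible_of_prime hp fun b hb => ?_
      have h1 : (b : W) ^ p = w ^ p := congrArg Subtype.val hb
      have h2 := congrArg π h1
      rw [map_pow, map_pow] at h2
      exact hcon b b.2 (frobenius_inj L p h2)
    have hmin : Polynomial.X ^ p - Polynomial.C c = minpoly E (π w) := by
      refine minpoly.eq_of_irreducible_of_monic hirr ?_ (Polynomial.monic_X_pow_sub_C _ hp.ne_zero)
      simp only [map_sub, map_pow, Polynomial.aeval_X, Polynomial.aeval_C]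
      change π w ^ p - π (w ^ p) = 0
      rw [map_pow, sub_self]
    let E' : Subring W := (Polynomial.eval₂RingHom E.subtype w).range
    have hE' : E' ∈ s := by
      refine ⟨fun v => ⟨Polynomial.C ⟨v ^ p, hEs.1 v⟩, by simp⟩, ?_⟩
      rintro _ ⟨g, rfl⟩ hg
      have h1 : Polynomial.aeval (π w) g = 0 := by
        rw [← hg]
        rw [Polynomial.coe_eval₂RingHom, Polynomial.hom_eval₂]
        rfl
      obtain ⟨q, hq⟩ := minpoly.dvd E (π w) h1
      rw [hq, ← hmin, map_mul]
      have : Polynomial.eval₂RingHom E.subtype w (Polynomial.X ^ p - Polynomial.C c) = 0 := by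
        simp [c]
      rw [this, zero_mul]
    have hle : E ≤ E' := fun e he => ⟨Polynomial.C ⟨e, he⟩, by simp⟩
    have hw : w ∈ E' := ⟨Polynomial.X, by simp⟩
    exact hcon w (hEm.2 hE' hle hw) rfl
  let πE : E →+* L := π.comp E.subtype
  have hbij : Function.Bijective πE := by
    constructor
    · exact πE.injective
    · intro l
      obtain ⟨w, rfl⟩ := hπ l
      obtain ⟨e, he, h⟩ := hsurj w
      exact ⟨⟨e, he⟩, h⟩
  let eq := RingEquiv.ofBijective πE hbij
  exact ⟨E.subtype.comp (eq.symm : L →+* E), fun l => eq.apply_symm_apply l⟩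

theorem fsm (p : ℕ) [Fact p.Prime] (k : Type) [Field k] [Algebra (ZMod p) k] :
    Algebra.FormallySmooth (ZMod p) k := by
  have : CharP k p := by
    refine (CharP.charP_iff_prime_eq_zero (Fact.out)).2 ?_
    rw [← map_natCast (algebraMap (ZMod p) k), CharP.cast_eq_zero, map_zero]
  let f : MvPolynomial k (ZMod p) →ₐ[ZMod p] k := MvPolynomial.aeval id
  have hf : Function.Surjective f := fun a => ⟨MvPolynomial.X a, by simp [f]⟩
  rw [Algebra.FormallySmooth.iff_split_surjection f hf]
  have hl : Function.Surjective f.kerSquareLift := by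
    intro a
    obtain ⟨b, rfl⟩ := hf a
    exact ⟨Ideal.Quotient.mk _ b, rfl⟩
  have : CharP (MvPolynomial k (ZMod p) ⧸ RingHom.ker f.toRingHom ^ 2) p := by
    have : Nontrivial (MvPolynomial k (ZMod p) ⧸ RingHom.ker f.toRingHom ^ 2) :=
      (f.kerSquareLift : _ →+* k).domain_nontrivial
    refine (CharP.charP_iff_prime_eq_zero (Fact.out)).2 ?_
    rw [← map_natCast (algebraMap (ZMod p) _), CharP.cast_eq_zero, map_zero]
  let π : (MvPolynomial k (ZMod p) ⧸ RingHom.ker f.toRingHom ^ 2) →+* k := f.kerSquareLift.toRingHom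
  obtain ⟨g, hg⟩ := sqz (p := p) π hl (by
    intro a b ha hb
    obtain ⟨a, rfl⟩ := Ideal.Quotient.mk_surjective (I := RingHom.ker f.toRingHom ^ 2) a
    obtain ⟨b, rfl⟩ := Ideal.Quotient.mk_surjective (I := RingHom.ker f.toRingHom ^ 2) b
    refine (map_mul (Ideal.Quotient.mk (RingHom.ker f.toRingHom ^ 2)) a b).symm.trans ((Ideal.Quotient.eq_zero_iff_mem (I := RingHom.ker f.toRingHom ^ 2)).2 ?_)
    rw [pow_two]
    have ha' : a ∈ RingHom.ker f.toRingHom := ha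
    have hb' : b ∈ RingHom.ker f.toRingHom := hb
    exact Ideal.mul_mem_mul ha' hb')
  refine ⟨{ g with commutes' := fun r => ?_ }, ?_⟩
  · have : (g.comp (algebraMap (ZMod p) k)) = algebraMap (ZMod p) _ := Subsingleton.elim _ _
    exact RingHom.congr_fun this r
  · ext l
    exact hg l

theorem coefField (R : Type) [CommRing R] [IsLocalRing R] [IsAdicComplete (maximalIdeal R) R]
    (p : ℕ) [Fact p.Prime] [CharP R p] :
    ∃ κ : ResidueField R →+* R, ∀ c, residue R (κ c) = c := by
  let : Algebra (ZMod p) R := ZMod.algebra R p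
  have := fsm p (ResidueField R)
  obtain ⟨g, hg⟩ := Algebra.FormallySmooth.exists_mkₐ_comp_eq_of_isAdicComplete
    (R := ZMod p) (A := ResidueField R) (S := R) (I := maximalIdeal R)
    (AlgHom.id (ZMod p) (ResidueField R))
  exact ⟨g.toRingHom, fun c => AlgHom.congr_fun hg c⟩

end HH

namespace HH

theorem phi_ex {R k : Type} [CommRing R] [IsLocalRing R] [IsAdicComplete (maximalIdeal R) R]
    [Field k] (κ : k →+* R) {d : ℕ} (x : Fin d → R) (hx : ∀ i, x i ∈ maximalIdeal R) :
    ∃ Φ : MvPowerSeries (Fin d) k →+* R, (∀ c, Φ (MvPowerSeries.C c) = κ c) ∧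
      ∀ i, Φ (MvPowerSeries.X i) = x i := by
  let : WithIdeal R := ⟨maximalIdeal R⟩
  let : UniformSpace k := ⊥
  have hc : CompleteSpace R ∧ T2Space R :=
    (IsAdic.isAdicComplete_iff (I := maximalIdeal R) (show IsAdic (maximalIdeal R) from rfl)).1 inferInstance
  have := hc.1
  have := hc.2
  have hκ : Continuous κ := continuous_of_discreteTopology
  have ha : MvPowerSeries.HasEval x :=
    ⟨fun i => WithIdeal.isTopologicallyNilpotent_of_mem (hx i), by simp [Filter.cofinite_eq_bot]⟩
  refine ⟨MvPowerSeries.eval₂Hom hκ ha, fun c => ?_, fun i => ?_⟩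
  · rw [MvPowerSeries.coe_eval₂Hom, MvPowerSeries.eval₂_C]
  · rw [MvPowerSeries.coe_eval₂Hom, MvPowerSeries.eval₂_X]


theorem pre_pi {P τ : Type} [CommRing P] [Fintype τ] (I : Ideal P) [IsPrecomplete I P] :
    IsPrecomplete I (τ → P) := by
  classical
  have key : ∀ (n : ℕ) (v : τ → P), v ∈ (I ^ n • ⊤ : Submodule P (τ → P)) ↔ ∀ t, v t ∈ I ^ n := by
    intro n v
    constructor
    · intro h t
      have := Submodule.mem_map_of_mem (f := LinearMap.proj (R := P) (φ := fun _ : τ => P) t) h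
      rw [Submodule.map_smul''] at this
      have h2 := smul_mono_right (I ^ n) (le_top (a := Submodule.map (LinearMap.proj (R := P) (φ := fun _ : τ => P) t) ⊤)) this
      simpa using h2
    · intro h
      rw [← Finset.univ_sum_single v]
      refine Submodule.sum_mem _ fun t _ => ?_
      have : Pi.single t (v t) = v t • (Pi.single t (1 : P) : τ → P) := by
        rw [← Pi.single_smul]; simp
      rw [this]
      exact Submodule.smul_mem_smul (h t) trivial
  refine ⟨fun f hf => ?_⟩
  have hP := (inferInstance : IsPrecomplete I P)
  have h1 : ∀ t, ∃ L, ∀ n, f n t ≡ L [SMOD (I ^ n • ⊤ : Submodule P P)] := fun t => by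
    refine IsPrecomplete.prec hP (f := fun n => f n t) ?_
    intro m n hmn
    have := hf hmn
    rw [SModEq.sub_mem, key] at this
    rw [SModEq.sub_mem]
    simpa using this t
  choose L hL using h1
  refine ⟨L, fun n => ?_⟩
  rw [SModEq.sub_mem, key]
  intro t
  have := hL t n
  rw [SModEq.sub_mem] at this
  simpa using this

theorem phi_fin {R : Type} [CommRing R] [IsLocalRing R] [IsNoetherianRing R]
    [IsAdicComplete (maximalIdeal R) R]
    (κ : ResidueField R →+* R) (hκ : ∀ c, residue R (κ c) = c) {d : ℕ} (x : Fin d → R)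
    (hx : (Ideal.span (Set.range x)).radical = maximalIdeal R)
    (Φ : MvPowerSeries (Fin d) (ResidueField R) →+* R)
    (hC : ∀ c, Φ (MvPowerSeries.C c) = κ c) (hX : ∀ i, Φ (MvPowerSeries.X i) = x i) :
    Φ.Finite := by
  classical
  let := Φ.toAlgebra
  change Module.Finite (MvPowerSeries (Fin d) (ResidueField R)) R
  let P := MvPowerSeries (Fin d) (ResidueField R)
  let I : Ideal P := Ideal.span (Set.range MvPowerSeries.X)
  have hI : I.map (algebraMap P R) = Ideal.span (Set.range x) := by
    rw [Ideal.map_span, ← Set.range_comp]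
    congr 1; congr 1; ext i; exact hX i
  have hne : Ideal.span (Set.range x) ≠ ⊤ := by
    intro h
    rw [h, Ideal.radical_top] at hx
    exact (maximalIdeal.isMaximal R).ne_top hx.symm
  have hH : IsHausdorff I R := by
    rw [← IsHausdorff.map_algebraMap_iff (S := R), hI]
    exact IsHausdorff.of_isLocalRing _ _ hne
  obtain ⟨n0, hn0⟩ := Ideal.exists_radical_pow_le_of_fg (Ideal.span (Set.range x))
    (IsNoetherian.noetherian _)
  rw [hx] at hn0
  have ind : ∀ n : ℕ, ∃ (τ : Type) (_ : Fintype τ) (b : τ → R), ∀ w, ∃ c : τ → ResidueField R,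
      w - ∑ t, κ (c t) * b t ∈ maximalIdeal R ^ n := by
    intro n
    induction n with
    | zero => exact ⟨Empty, inferInstance, fun _ => 0, fun w => ⟨fun _ => 0, by simp⟩⟩
    | succ n ih =>
      obtain ⟨τ, _, b, hb⟩ := ih
      obtain ⟨s, hs⟩ : (maximalIdeal R ^ n).FG := IsNoetherian.noetherian _
      refine ⟨τ ⊕ s, inferInstance, Sum.elim b (Subtype.val : s → R), fun w => ?_⟩
      obtain ⟨c, hc⟩ := hb w
      have hc' := hc
      rw [← hs, Submodule.mem_span_finset'] at hc'
      obtain ⟨r, hr⟩ := hc'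
      refine ⟨Sum.elim c (fun t => residue R (r t)), ?_⟩
      have : w - ∑ t : τ ⊕ s, κ (Sum.elim c (fun t => residue R (r t)) t) *
          Sum.elim b (Subtype.val : s → R) t =
          ∑ t : s, (r t - κ (residue R (r t))) * t := by
        simp only [Fintype.sum_sum_type, Sum.elim_inl, Sum.elim_inr, sub_mul, Finset.sum_sub_distrib]
        simp only [smul_eq_mul] at hr
        rw [hr]; ring
      rw [this, pow_succ']
      refine Ideal.sum_mem _ fun t _ => Ideal.mul_mem_mul ?_ ?_
      · rw [← residue_eq_zero_iff, map_sub, hκ, sub_self]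
      · rw [← hs]; exact Ideal.subset_span t.2
  obtain ⟨τ, _, b, hb⟩ := ind n0
  have : IsPrecomplete I P := (inferInstance : IsAdicComplete I P).toIsPrecomplete
  have := pre_pi (τ := τ) I
  let f : (τ → P) →ₗ[P] R := Fintype.linearCombination P b
  have hf : Function.Surjective f := by
    apply surjective_of_mkQ_comp_surjective (I := I)
    intro y
    obtain ⟨w, rfl⟩ := Submodule.mkQ_surjective _ y
    obtain ⟨c, hc⟩ := hb w
    refine ⟨fun t => MvPowerSeries.C (c t), ?_⟩
    change Submodule.Quotient.mk _ = Submodule.Quotient.mk _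
    symm
    rw [Submodule.Quotient.eq]
    have h1 : f (fun t => MvPowerSeries.C (c t)) = ∑ t, κ (c t) * b t := by
      simp only [f, Fintype.linearCombination_apply, Algebra.smul_def]
      exact Finset.sum_congr rfl fun t _ => by rw [← hC]; rfl
    rw [h1]
    have h2 := hn0 hc
    rw [← hI] at h2
    rw [Ideal.smul_top_eq_map]
    exact h2
  exact Module.Finite.of_surjective f hf

end HH

namespace HH

theorem coht_le {S : Type} [CommRing S] [IsLocalRing S] [IsNoetherianRing S] {d : ℕ} (x : Fin d → S)
    (hx : (Ideal.span (Set.range x)).radical = maximalIdeal S) (J : Finset (Fin d))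
    (Q : PrimeSpectrum S) (hQ : ∀ j ∈ J, x j ∈ Q.asIdeal) :
    Order.coheight Q ≤ (d - J.card : ℕ) := by
  classical
  let π := Ideal.Quotient.mk Q.asIdeal
  let s : Finset (S ⧸ Q.asIdeal) := Finset.image (fun j => π (x j)) Jᶜ
  have hloc : IsLocalRing (S ⧸ Q.asIdeal) := IsLocalRing.of_surjective' π Ideal.Quotient.mk_surjective
  have h1 : (Order.coheight Q : WithBot ℕ∞) = ringKrullDim (S ⧸ Q.asIdeal) := by
    rw [Order.coheight_eq_krullDim_Ici, ringKrullDim_quotient]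
    have : PrimeSpectrum.zeroLocus (Q.asIdeal : Set S) = Set.Ici Q := by
      ext q; rfl
    rw [this]
  rw [← IsLocalRing.maximalIdeal_height_eq_ringKrullDim] at h1
  have h1' := WithBot.coe_inj.1 h1
  rw [h1']
  have hc : s.card ≤ d - J.card := by
    refine Finset.card_image_le.trans ?_
    rw [Finset.card_compl, Fintype.card_fin]
  refine le_trans (Ideal.height_le_card_of_mem_minimalPrimes_span_finset (s := s) ?_) (by exact_mod_cast hc)
  have hmap : ∀ q : Ideal (S ⧸ Q.asIdeal), q.IsPrime → Ideal.span (s : Set (S ⧸ Q.asIdeal)) ≤ q →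
      maximalIdeal (S ⧸ Q.asIdeal) ≤ q := by
    intro q hq hs
    intro a ha
    obtain ⟨b, rfl⟩ := Ideal.Quotient.mk_surjective a
    have hb : b ∈ maximalIdeal S := by
      by_contra hb
      have hu : IsUnit b := by simpa using hb
      exact (mem_nonunits_iff.1 ((mem_maximalIdeal _).1 ha)) (hu.map _)
    rw [← hx] at hb
    have hle : (Ideal.span (Set.range x)) ≤ q.comap π := by
      rw [Ideal.span_le]
      rintro _ ⟨j, rfl⟩
      change π (x j) ∈ q
      by_cases hj : j ∈ J
      · rw [Ideal.Quotient.eq_zero_iff_mem.2 (hQ j hj)]; exact q.zero_mem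
      · exact hs (Ideal.subset_span (Finset.mem_coe.2 (Finset.mem_image_of_mem _ (by simpa using hj))))
    exact (Ideal.IsRadical.radical_le_iff (hq.comap π).isRadical).2 hle hb
  refine ⟨⟨(maximalIdeal.isMaximal _).isPrime, ?_⟩, fun q hq _ => hmap q hq.1 hq.2⟩
  rw [Ideal.span_le]
  intro a ha
  obtain ⟨j, -, rfl⟩ := Finset.mem_image.1 (Finset.mem_coe.1 ha)
  have hj : x j ∈ maximalIdeal S := by
    rw [← hx]; exact Ideal.le_radical (Ideal.subset_span ⟨j, rfl⟩)
  change π (x j) ∈ maximalIdeal (S ⧸ Q.asIdeal)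
  rw [mem_maximalIdeal, mem_nonunits_iff]
  intro hu
  have hl : IsLocalHom π := (IsLocalHom.of_surjective π Ideal.Quotient.mk_surjective)
  exact (mem_nonunits_iff.1 ((mem_maximalIdeal _).1 hj)) (isUnit_of_map_unit π _ hu)

end HH

namespace HH
open MvPowerSeries in
theorem mono_mem {ι k : Type} [DecidableEq ι] [CommRing k] (J : Finset ι) (α : ι → ℕ) (f : MvPowerSeries ι k) :
    (∃ c : ι → MvPowerSeries ι k, f = ∑ i ∈ J, c i * X i ^ α i) ↔
      ∀ γ : ι →₀ ℕ, (∀ i ∈ J, γ i < α i) → coeff γ f = 0 := by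
  constructor
  · rintro ⟨c, rfl⟩ γ hγ
    rw [map_sum]
    exact Finset.sum_eq_zero fun i hi => X_pow_dvd_iff.1 (Dvd.intro_left _ rfl) γ (hγ i hi)
  · induction J using Finset.induction_on generalizing f with
    | empty =>
      intro h
      exact ⟨0, by ext γ; simpa using h γ (by simp)⟩
    | insert j J hj ih =>
      intro h
      let f1 : MvPowerSeries ι k := fun γ => if α j ≤ γ j then coeff γ f else 0
      let f2 : MvPowerSeries ι k := fun γ => if α j ≤ γ j then 0 else coeff γ f
      have c1 : ∀ γ, coeff γ f1 = if α j ≤ γ j then coeff γ f else 0 := fun γ => rfl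
      have c2 : ∀ γ, coeff γ f2 = if α j ≤ γ j then 0 else coeff γ f := fun γ => rfl
      have h12 : f = f1 + f2 := by
        ext γ; rw [map_add, c1, c2]; split_ifs <;> simp
      obtain ⟨g, hg⟩ : X j ^ α j ∣ f1 := X_pow_dvd_iff.2 fun γ hγ => by
        rw [c1, if_neg (by omega)]
      obtain ⟨c, hc⟩ := ih f2 fun γ hγ => by
        rw [c2]
        split_ifs with h1
        · rfl
        · refine h γ fun i hi => ?_
          rcases Finset.mem_insert.1 hi with rfl | hi
          · omega
          · exact hγ i hi
      refine ⟨Function.update c j g, ?_⟩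
      rw [Finset.sum_insert hj, Function.update_self, h12, hg, hc, mul_comm]
      congr 1
      refine Finset.sum_congr rfl fun i hi => ?_
      rw [Function.update_of_ne (by rintro rfl; exact hj hi)]

open MvPowerSeries in
/-- power series not involving the variables in `H` -/
def SubH {ι : Type} (k : Type) [CommRing k] (H : Finset ι) : Subring (MvPowerSeries ι k) where
  carrier := {f | ∀ γ : ι →₀ ℕ, (∃ i ∈ H, γ i ≠ 0) → coeff γ f = 0}
  zero_mem' := by simp
  one_mem' := by
    classical
    rintro γ ⟨i, hi, h⟩
    rw [coeff_one, if_neg]; rintro rfl; exact h rfl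
  add_mem' := by
    intro a b ha hb γ h
    rw [map_add, ha γ h, hb γ h, add_zero]
  neg_mem' := by
    intro a ha γ h
    rw [map_neg, ha γ h, neg_zero]
  mul_mem' := by
    classical
    rintro a b ha hb γ ⟨i, hi, h⟩
    rw [coeff_mul]
    refine Finset.sum_eq_zero fun q hq => ?_
    rw [Finset.HasAntidiagonal.mem_antidiagonal] at hq
    by_cases h1 : q.1 i = 0
    · have : q.2 i ≠ 0 := by
        intro h2; apply h; rw [← hq]; simp [h1, h2]
      rw [hb _ ⟨i, hi, this⟩, mul_zero]
    · rw [ha _ ⟨i, hi, h1⟩, zero_mul]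

open MvPowerSeries Classical in
/-- set the variables in `H` to zero -/
noncomputable def retF {ι : Type} (k : Type) [CommRing k] (H : Finset ι) (f : MvPowerSeries ι k) :
    MvPowerSeries ι k := fun γ => if ∃ i ∈ H, γ i ≠ 0 then 0 else coeff γ f

open MvPowerSeries Classical in
theorem coeff_retF {ι : Type} {k : Type} [CommRing k] (H : Finset ι) (f : MvPowerSeries ι k)
    (γ : ι →₀ ℕ) : coeff γ (retF k H f) = if ∃ i ∈ H, γ i ≠ 0 then 0 else coeff γ f := rfl

open MvPowerSeries Classical in
/-- set the variables in `H` to zero -/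
noncomputable def ret {ι : Type} (k : Type) [CommRing k] (H : Finset ι) :
    MvPowerSeries ι k →+* MvPowerSeries ι k where
  toFun := retF k H
  map_zero' := by ext γ; rw [coeff_retF]; simp
  map_add' := by
    intro a b
    ext γ; rw [map_add, coeff_retF, coeff_retF, coeff_retF]
    split_ifs <;> simp
  map_one' := by
    ext γ
    rw [coeff_retF]
    split_ifs with h
    · obtain ⟨i, hi, h⟩ := h
      rw [coeff_one, if_neg]; rintro rfl; exact h rfl
    · rfl
  map_mul' := by
    intro a b
    ext γ
    rw [coeff_mul, coeff_retF]
    simp only [coeff_retF]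
    split_ifs with h
    · obtain ⟨i, hi, h⟩ := h
      symm
      refine Finset.sum_eq_zero fun q hq => ?_
      rw [Finset.HasAntidiagonal.mem_antidiagonal] at hq
      by_cases h1 : q.1 i = 0
      · have : q.2 i ≠ 0 := by
          intro h2; apply h; rw [← hq]; simp [h1, h2]
        rw [if_pos (⟨i, hi, this⟩ : ∃ i ∈ H, q.2 i ≠ 0), mul_zero]
      · rw [if_pos (⟨i, hi, h1⟩ : ∃ i ∈ H, q.1 i ≠ 0), zero_mul]
    · push Not at h
      rw [coeff_mul]
      refine Finset.sum_congr rfl fun q hq => ?_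
      rw [Finset.HasAntidiagonal.mem_antidiagonal] at hq
      have hz : ∀ i ∈ H, q.1 i = 0 ∧ q.2 i = 0 := by
        intro i hi
        have := h i hi
        rw [← hq] at this
        simpa using this
      rw [if_neg, if_neg]
      · rintro ⟨i, hi, h⟩; exact h (hz i hi).2
      · rintro ⟨i, hi, h⟩; exact h (hz i hi).1

open MvPowerSeries Classical in
theorem coeff_ret {ι : Type} {k : Type} [CommRing k] (H : Finset ι) (f : MvPowerSeries ι k)
    (γ : ι →₀ ℕ) : coeff γ (ret k H f) = if ∃ i ∈ H, γ i ≠ 0 then 0 else coeff γ f := rfl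

open MvPowerSeries in
theorem ker_ret {ι : Type} [DecidableEq ι] {k : Type} [CommRing k] (H : Finset ι) :
    RingHom.ker (ret k H) = Ideal.span (X '' (H : Set ι)) := by
  classical
  ext f
  have h1 := mono_mem H (fun _ => 1) f
  simp only [pow_one] at h1
  rw [mem_sp, h1, RingHom.mem_ker]
  constructor
  · intro h γ hγ
    have := coeff_ret H f γ
    rw [h, if_neg] at this
    · simpa using this.symm
    · rintro ⟨i, hi, h⟩; have := hγ i hi; omega
  · intro h
    ext γ
    rw [coeff_ret]
    split_ifs with h1
    · simp
    · push Not at h1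
      rw [h γ fun i hi => by rw [h1 i hi]; omega]; simp

open MvPowerSeries in
theorem ret_SubH {ι : Type} {k : Type} [CommRing k] (H : Finset ι) (f) (hf : f ∈ SubH k H) :
    ret k H f = f := by
  classical
  ext γ
  rw [coeff_ret]
  split_ifs with h
  · exact (hf γ h).symm
  · rfl

open MvPowerSeries in
theorem max_pow {ι : Type} [Finite ι] [DecidableEq ι] {k : Type} [Field k]  :
    (Ideal.span (Set.range (X : ι → MvPowerSeries ι k))).radical = maximalIdeal _ := by
  classical
  have := Fintype.ofFinite ι
  have h : Ideal.span (Set.range (X : ι → MvPowerSeries ι k)) = maximalIdeal _ := by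
    ext f
    rw [← Set.image_univ, ← Finset.coe_univ, mem_sp]
    have h1 := mono_mem (Finset.univ) (fun _ => 1) f
    simp only [pow_one] at h1
    rw [h1, mem_maximalIdeal, mem_nonunits_iff, isUnit_iff_constantCoeff, isUnit_iff_ne_zero, not_not]
    constructor
    · intro h; exact h 0 (by simp)
    · intro h γ hγ
      have : γ = 0 := by ext i; have := hγ i (by simp); simpa using this
      rw [this]; exact h
  rw [h]
  exact (maximalIdeal.isMaximal _).isPrime.radical

end HH

namespace HH

theorem d1 {R k : Type} [CommRing R] [Field k] {d : ℕ} (x : Fin d → R)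
    (Φ : MvPowerSeries (Fin d) k →+* R) (hX : ∀ i, Φ (MvPowerSeries.X i) = x i) (hf : Φ.Finite)
    (H : Finset (Fin d)) (Q : PrimeSpectrum R) (hQ : ∀ j ∈ H, x j ∈ Q.asIdeal)
    (a : MvPowerSeries (Fin d) k) (ha : a ∈ SubH k H) (ha0 : a ≠ 0) (haQ : Φ a ∈ Q.asIdeal) :
    Order.coheight Q + 1 ≤ (d - H.card : ℕ) := by
  let := Φ.toAlgebra
  have hfin : Module.Finite (MvPowerSeries (Fin d) k) R := hf
  have hs : StrictMono (PrimeSpectrum.comap Φ) := by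
    intro q1 q2 h
    obtain ⟨y, hy2, hy1⟩ := Set.exists_of_ssubset (show (q1.asIdeal : Set R) ⊂ q2.asIdeal from h)
    exact Ideal.comap_lt_comap_of_integral_mem_sdiff (R := MvPowerSeries (Fin d) k) (I := q1.asIdeal)
      (J := q2.asIdeal) (le_of_lt h) ⟨hy2, hy1⟩ (Algebra.IsIntegral.isIntegral y)
  have h1 := Order.coheight_le_coheight_apply_of_strictMono _ hs Q
  have : IsDomain (MvPowerSeries (Fin d) k) := NoZeroDivisors.to_isDomain _
  let q0 : PrimeSpectrum (MvPowerSeries (Fin d) k) := ⟨RingHom.ker (ret k H), RingHom.ker_isPrime _⟩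
  have hlt : q0 < PrimeSpectrum.comap Φ Q := by
    refine lt_of_le_of_ne ?_ ?_
    · change RingHom.ker (ret k H) ≤ Q.asIdeal.comap Φ
      rw [ker_ret, Ideal.span_le]
      rintro _ ⟨j, hj, rfl⟩
      change Φ (MvPowerSeries.X j) ∈ Q.asIdeal
      rw [hX]; exact hQ j hj
    · intro h
      have h2 : a ∈ (PrimeSpectrum.comap Φ Q).asIdeal := haQ
      rw [← h] at h2
      have h3 : ret k H a = 0 := h2
      rw [ret_SubH H a ha] at h3
      exact ha0 h3
  have h2 := Order.coheight_add_one_le hlt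
  have h3 := coht_le (MvPowerSeries.X) max_pow H q0 (by
    intro j hj
    change _ ∈ RingHom.ker (ret k H)
    rw [ker_ret]; exact Ideal.subset_span ⟨j, hj, rfl⟩)
  exact le_trans (by gcongr) (h2.trans h3)

theorem phi_inj {R k : Type} [CommRing R] [IsDomain R] [Field k] {d : ℕ} (hd : ringKrullDim R = d) (x : Fin d → R)
    (Φ : MvPowerSeries (Fin d) k →+* R) (hX : ∀ i, Φ (MvPowerSeries.X i) = x i) (hf : Φ.Finite) :
    Function.Injective Φ := by
  rw [injective_iff_map_eq_zero]
  intro a ha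
  by_contra ha0
  have h1 := d1 x Φ hX hf ∅ ⊥ (by simp) a (by rintro γ ⟨i, hi, -⟩; simp at hi) ha0 (by rw [ha]; exact Ideal.zero_mem _)
  have h2 : (Order.coheight (⊥ : PrimeSpectrum R) : WithBot ℕ∞) = d := by
    rw [Order.coheight_bot_eq_krullDim]; exact hd
  have h3 : Order.coheight (⊥ : PrimeSpectrum R) = d := by exact_mod_cast h2
  rw [h3, Finset.card_empty] at h1
  have : d + 1 ≤ d := by exact_mod_cast h1
  omega

theorem shift {R k : Type} [CommRing R] [IsLocalRing R] [IsNoetherianRing R] [Field k] {d : ℕ} (x : Fin d → R)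
    (hx : (Ideal.span (Set.range x)).radical = maximalIdeal R)
    (Φ : MvPowerSeries (Fin d) k →+* R) (hX : ∀ i, Φ (MvPowerSeries.X i) = x i) (hf : Φ.Finite)
    (H : Finset (Fin d)) (j0 : Fin d) (hj0 : j0 ∉ H)
    (a : MvPowerSeries (Fin d) k) (ha : a ∈ SubH k H) (ha0 : a ≠ 0) :
    ∃ N : Fin d → ℕ, (∀ j, 1 ≤ N j) ∧ (Ideal.span (Set.range (fun j => if j ∈ H then x j else
      if j = j0 then Φ a * x j0 else x j + x j0 ^ N j))).radical = maximalIdeal R := by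
  classical
  have hcard : ∀ J : Finset (Fin d), J.card ≤ d := fun J => by
    simpa using Finset.card_le_univ J
  have cl : ∀ (J : Finset (Fin d)) (Q : PrimeSpectrum R), (∀ j ∈ J, x j ∈ Q.asIdeal) →
      Order.coheight Q + J.card ≤ d := by
    intro J Q hQ
    have h1 := coht_le x hx J Q hQ
    obtain ⟨c, hc⟩ := ENat.ne_top_iff_exists.1 (ne_top_of_le_ne_top (ENat.natCast_ne_top _) h1)
    rw [← hc] at h1 ⊢
    have h2 : c ≤ d - J.card := by exact_mod_cast h1
    have := hcard J
    have h3 : c + J.card ≤ d := by omega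
    exact_mod_cast h3
  have ind : ∀ K : Finset (Fin d), Disjoint K (insert j0 H) → ∃ N : Fin d → ℕ, (∀ j, 1 ≤ N j) ∧
      ∀ Q : PrimeSpectrum R, (∀ j ∈ H, x j ∈ Q.asIdeal) → Φ a * x j0 ∈ Q.asIdeal →
        (∀ j ∈ K, x j + x j0 ^ N j ∈ Q.asIdeal) → Order.coheight Q + (H.card + 1 + K.card : ℕ) ≤ d := by
    intro K
    induction K using Finset.induction_on with
    | empty =>
      intro _
      refine ⟨fun _ => 1, fun _ => le_rfl, fun Q hH hQ _ => ?_⟩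
      rcases Q.isPrime.mem_or_mem hQ with h | h
      · have h1 := d1 x Φ hX hf H Q hH a ha ha0 h
        obtain ⟨c, hc⟩ := ENat.ne_top_iff_exists.1 (ne_top_of_le_ne_top (ENat.natCast_ne_top _)
          (le_self_add.trans h1))
        rw [← hc] at h1 ⊢
        have h2 : c + 1 ≤ d - H.card := by exact_mod_cast h1
        have h3 : c + (H.card + 1 + 0) ≤ d := by omega
        exact_mod_cast h3
      · have h1 := cl (insert j0 H) Q (by
          intro j hj
          rcases Finset.mem_insert.1 hj with rfl | hj
          · exact h
          · exact hH j hj)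
        rw [Finset.card_insert_of_notMem hj0] at h1
        exact h1
    | insert j K hj ih =>
      intro hdis
      rw [Finset.disjoint_insert_left] at hdis
      obtain ⟨N, hN1, hN⟩ := ih hdis.2
      have hjH : j ∉ insert j0 H := hdis.1
      let I : Ideal R := Ideal.span (x '' H ∪ {Φ a * x j0} ∪ (fun j => x j + x j0 ^ N j) '' K)
      have hIQ : ∀ Q : Ideal R, I ≤ Q ↔ (∀ j ∈ H, x j ∈ Q) ∧ Φ a * x j0 ∈ Q ∧
          ∀ j ∈ K, x j + x j0 ^ N j ∈ Q := by
        intro Q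
        simp only [I, Ideal.span_le, Set.union_subset_iff, Set.image_subset_iff,
          Set.singleton_subset_iff, and_assoc]
        rfl
      let M : Set (Ideal R) := {Q ∈ I.minimalPrimes | x j0 ∉ Q ∨ x j ∉ Q}
      have hMf : M.Finite := (Ideal.finite_minimalPrimes_of_isNoetherianRing R I).subset (Set.sep_subset _ _)
      have hbad : (⋃ Q ∈ M, {n | 1 ≤ n ∧ x j + x j0 ^ n ∈ Q}).Finite := by
        refine hMf.biUnion fun Q hQ => Set.Subsingleton.finite ?_
        have hQp : Q.IsPrime := hQ.1.1.1
        have key : ∀ n m, 1 ≤ n → n < m → x j + x j0 ^ n ∈ Q → x j + x j0 ^ m ∈ Q → False := by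
          intro n m hn hnm h1 h2
          have h3 := Q.sub_mem h1 h2
          have h4 : x j0 ^ n * (1 - x j0 ^ (m - n)) ∈ Q := by
            have : x j + x j0 ^ n - (x j + x j0 ^ m) = x j0 ^ n * (1 - x j0 ^ (m - n)) := by
              rw [mul_sub, ← pow_add, show n + (m - n) = m by omega]; ring
            rwa [this] at h3
          have h5 : x j0 ∈ Q := by
            rcases hQp.mem_or_mem h4 with h | h
            · exact hQp.mem_of_pow_mem n h
            · exfalso
              have hm : x j0 ∈ maximalIdeal R := by
                rw [← hx]; exact Ideal.le_radical (Ideal.subset_span ⟨j0, rfl⟩)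
              have := (le_maximalIdeal hQp.ne_top) h
              have h6 := Ideal.add_mem _ this (Ideal.pow_mem_of_mem _ hm (m - n) (by omega))
              rw [sub_add_cancel] at h6
              exact (Ideal.ne_top_iff_one _).1 (maximalIdeal.isMaximal R).ne_top h6
          rcases hQ.2 with h | h
          · exact h h5
          · apply h
            have := Q.sub_mem h1 (Q.pow_mem_of_mem h5 n hn)
            rwa [add_sub_cancel_right] at this
        intro n hn m hm
        rcases lt_trichotomy n m with h | h | h
        · exact (key n m hn.1 h hn.2 hm.2).elim
        · exact h
        · exact (key m n hm.1 h hm.2 hn.2).elim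
      obtain ⟨n, hn⟩ := (hbad.union (Set.finite_singleton 0)).exists_notMem
      have hn0 : 1 ≤ n := by
        by_contra h
        exact hn (Or.inr (by simp; omega))
      refine ⟨Function.update N j n, fun i => ?_, fun Q hQH hQa hQK => ?_⟩
      · by_cases hi : i = j
        · rw [hi, Function.update_self]; exact hn0
        · rw [Function.update_of_ne hi]; exact hN1 i
      have hQj : x j + x j0 ^ n ∈ Q.asIdeal := by
        have := hQK j (Finset.mem_insert_self _ _)
        rwa [Function.update_self] at this
      have hQK' : ∀ i ∈ K, x i + x j0 ^ N i ∈ Q.asIdeal := by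
        intro i hi
        have := hQK i (Finset.mem_insert_of_mem hi)
        rwa [Function.update_of_ne (by rintro rfl; exact hj hi)] at this
      have h1 := hN Q hQH hQa hQK'
      obtain ⟨c, hc⟩ := ENat.ne_top_iff_exists.1 (ne_top_of_le_ne_top (ENat.natCast_ne_top _)
          (le_self_add.trans h1))
      rw [← hc] at h1 ⊢
      have h2 : c + (H.card + 1 + K.card) ≤ d := by exact_mod_cast h1
      rw [Finset.card_insert_of_notMem hj]
      suffices c + (H.card + 1 + K.card) ≠ d by
        have h3 : c + (H.card + 1 + (K.card + 1)) ≤ d := by omega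
        exact_mod_cast h3
      intro heq
      have hIle : I ≤ Q.asIdeal := (hIQ _).2 ⟨hQH, hQa, hQK'⟩
      have := Q.isPrime
      obtain ⟨Q', hQ', hQ'le⟩ := Ideal.exists_minimalPrimes_le hIle
      let q' : PrimeSpectrum R := ⟨Q', hQ'.1.1⟩
      have hqq : q' = Q := by
        by_contra hne
        have hlt : q' < Q := lt_of_le_of_ne hQ'le hne
        have h3 := Order.coheight_add_one_le hlt
        obtain ⟨b1, b2, b3⟩ := (hIQ Q').1 hQ'.1.2
        have h4 := hN q' b1 b2 b3
        rw [← hc] at h3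
        have h5 : ((c + 1 + (H.card + 1 + K.card) : ℕ) : ℕ∞) ≤ d := by
          push_cast
          push_cast at h4
          exact le_trans (by gcongr) h4
        have h6 : c + 1 + (H.card + 1 + K.card) ≤ d := by exact_mod_cast h5
        omega
      have hQM : Q.asIdeal ∈ M := by
        refine ⟨by rw [← hqq]; exact hQ', ?_⟩
        by_contra hcon
        push Not at hcon
        have h3 := cl (insert j (insert j0 (H ∪ K))) Q (by
          intro i hi
          simp only [Finset.mem_insert, Finset.mem_union] at hi
          rcases hi with rfl | rfl | hi | hi
          · exact hcon.2
          · exact hcon.1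
          · exact hQH i hi
          · have := Q.asIdeal.sub_mem (hQK' i hi) (Q.asIdeal.pow_mem_of_mem hcon.1 _ (hN1 i))
            rwa [add_sub_cancel_right] at this)
        rw [← hc, Finset.card_insert_of_notMem, Finset.card_insert_of_notMem, Finset.card_union_of_disjoint] at h3
        · have h6 : c + (H.card + K.card + 1 + 1) ≤ d := by exact_mod_cast h3
          omega
        · exact (Finset.disjoint_insert_right.1 hdis.2).2.symm
        · intro h
          rcases Finset.mem_union.1 h with h | h
          · exact hj0 h
          · exact (Finset.disjoint_insert_right.1 hdis.2).1 h
        · intro h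
          simp only [Finset.mem_insert, Finset.mem_union] at h hjH
          tauto
      exact hn (Or.inl (Set.mem_biUnion hQM ⟨hn0, hQj⟩))
  obtain ⟨N, hN1, hN⟩ := ind (insert j0 H)ᶜ disjoint_compl_left
  refine ⟨N, hN1, ?_⟩
  have hxm : ∀ j, x j ∈ maximalIdeal R := fun j => by
    rw [← hx]; exact Ideal.le_radical (Ideal.subset_span ⟨j, rfl⟩)
  apply le_antisymm
  · rw [(maximalIdeal.isMaximal R).isPrime.isRadical.radical_le_iff, Ideal.span_le]
    rintro _ ⟨j, rfl⟩
    change (if _ then _ else _) ∈ maximalIdeal R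
    split_ifs
    · exact hxm j
    · exact Ideal.mul_mem_left _ _ (hxm _)
    · exact Ideal.add_mem _ (hxm _) (Ideal.pow_mem_of_mem _ (hxm _) _ (hN1 j))
  · rw [Ideal.radical_eq_sInf]
    refine le_sInf ?_
    rintro Q ⟨hQ, hQp⟩
    have hmem : ∀ j, (if j ∈ H then x j else
      if j = j0 then Φ a * x j0 else x j + x j0 ^ N j) ∈ Q := fun j => hQ (Ideal.subset_span ⟨j, rfl⟩)
    have h1 := hN ⟨Q, hQp⟩ (fun j hj => by have := hmem j; rwa [if_pos hj] at this)
      (by have := hmem j0; rwa [if_neg hj0, if_pos rfl] at this)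
      (fun j hj => by
        have := hmem j
        simp only [Finset.mem_compl, Finset.mem_insert, not_or] at hj
        rwa [if_neg hj.2, if_neg hj.1] at this)
    have hcc : H.card + 1 + ((insert j0 H)ᶜ).card = d := by
      rw [Finset.card_compl, Finset.card_insert_of_notMem hj0, Fintype.card_fin]
      have := hcard (insert j0 H)
      rw [Finset.card_insert_of_notMem hj0] at this
      omega
    rw [hcc] at h1
    have h0 : Order.coheight (⟨Q, hQp⟩ : PrimeSpectrum R) = 0 := by
      obtain ⟨c, hc⟩ := ENat.ne_top_iff_exists.1 (ne_top_of_le_ne_top (ENat.natCast_ne_top _)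
          (le_self_add.trans h1))
      rw [← hc] at h1 ⊢
      have h2 : c + d ≤ d := by exact_mod_cast h1
      have : c = 0 := by omega
      rw [this]; rfl
    rw [Order.coheight_eq_zero] at h0
    exact h0 (b := ⟨maximalIdeal R, (maximalIdeal.isMaximal R).isPrime⟩) (le_maximalIdeal hQp.ne_top)

end HH

namespace HH

/-- what we use about the absolute integral closure -/
structure Env (R Ω : Type) [CommRing R] [CommRing Ω] [Algebra R Ω] : Prop where
  inj : Function.Injective (algebraMap R Ω)
  int : ∀ w : Ω, IsIntegral R w
  root : ∀ f : Polynomial Ω, f.Monic → f.natDegree ≠ 0 → ∃ y, f.eval y = 0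
  ic : IsIntegrallyClosed Ω

def mkS {R Ω : Type} [CommRing R] [CommRing Ω] [Algebra R Ω] (p : ℕ) [Fact p.Prime] [CharP Ω p]
    (R' : Subalgebra R Ω) (e : ℕ) : Subring Ω := R'.toSubring.comap (iterateFrobenius Ω p e)

theorem mem_mkS {R Ω : Type} [CommRing R] [CommRing Ω] [Algebra R Ω] {p : ℕ} [Fact p.Prime] [CharP Ω p]
    {R' : Subalgebra R Ω} {e : ℕ} {w : Ω} : w ∈ mkS p R' e ↔ w ^ p ^ e ∈ R' := Iff.rfl

def GG (R Ω : Type) [CommRing R] [CommRing Ω] [Algebra R Ω] (p : ℕ) [Fact p.Prime] [CharP Ω p] :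
    Set (Subring Ω) :=
  {S | ∃ R' : Subalgebra R Ω, Module.Finite R R' ∧ ∃ e, S = mkS p R' e}

section
variable {R Ω : Type} [CommRing R] [CommRing Ω] [IsDomain Ω] [Algebra R Ω] {p : ℕ} [hp : Fact p.Prime] [CharP Ω p]

theorem Env.proot (hE : Env R Ω) (p : ℕ) [hp : Fact p.Prime] (e : ℕ) (a : Ω) : ∃ y, y ^ p ^ e = a := by
  have h1 : p ^ e ≠ 0 := pow_ne_zero _ hp.out.ne_zero
  obtain ⟨y, hy⟩ := hE.root (Polynomial.X ^ p ^ e - Polynomial.C a) (Polynomial.monic_X_pow_sub_C a h1)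
    (by rw [Polynomial.natDegree_X_pow_sub_C]; exact h1)
  exact ⟨y, by simpa [sub_eq_zero] using hy⟩

theorem qinj (p : ℕ) [hp : Fact p.Prime] [CharP Ω p] (e : ℕ) {a b : Ω} (h : a ^ p ^ e = b ^ p ^ e) : a = b :=
  iterateFrobenius_inj Ω p e h

theorem Env.base [IsNoetherianRing R] (hE : Env R Ω) : Base p (GG R Ω p) where
  dir := by
    rintro _ ⟨R1, h1, e1, rfl⟩ _ ⟨R2, h2, e2, rfl⟩
    refine ⟨mkS p (R1 ⊔ R2) (e1 + e2), ⟨_, Subalgebra.finite_sup R1 R2, _, rfl⟩, ?_, ?_⟩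
    · intro w hw
      rw [mem_mkS] at hw ⊢
      rw [pow_add, pow_mul]
      exact pow_mem ((le_sup_left : R1 ≤ R1 ⊔ R2) hw) _
    · intro w hw
      rw [mem_mkS] at hw ⊢
      rw [add_comm, pow_add, pow_mul]
      exact pow_mem ((le_sup_right : R2 ≤ R1 ⊔ R2) hw) _
  ex := by
    intro w
    refine ⟨mkS p (Algebra.adjoin R {w}) 0, ⟨_, Algebra.finite_adjoin_simple_of_isIntegral (hE.int w), _, rfl⟩, ?_⟩
    rw [mem_mkS, pow_zero, pow_one]
    exact Algebra.self_mem_adjoin_singleton R w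
  noeth := by
    rintro _ ⟨R', h, e, rfl⟩
    have : IsNoetherian R R' := isNoetherian_of_isNoetherianRing_of_finite R R'
    have hN : IsNoetherianRing R' := isNoetherian_of_tower R this
    let f : mkS p R' e →+* R' :=
      ((iterateFrobenius Ω p e).comp (mkS p R' e).subtype).codRestrict R'.toSubring (fun w => w.2)
    have hf : Function.Bijective f := by
      constructor
      · intro a b hab
        have : (a : Ω) ^ p ^ e = (b : Ω) ^ p ^ e := congrArg (Subtype.val) hab
        exact Subtype.ext (qinj p e this)
      · rintro ⟨a, ha⟩
        obtain ⟨y, hy⟩ := hE.proot p e a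
        exact ⟨⟨y, by rw [mem_mkS, hy]; exact ha⟩, Subtype.ext hy⟩
    exact isNoetherianRing_of_ringEquiv R' (RingEquiv.ofBijective f hf).symm
  frob := by
    rintro _ ⟨R', h, e, rfl⟩
    refine ⟨mkS p R' (e + 1), ⟨_, h, _, rfl⟩, fun w hw => ?_⟩
    rw [mem_mkS] at hw ⊢
    rwa [pow_succ', pow_mul]
  root := by
    intro N s g hN
    let q : Polynomial Ω := ∑ i ∈ Finset.range N, Polynomial.C (s i) * Polynomial.X ^ p ^ i + Polynomial.C g
    have hq : q.degree < (p ^ N : ℕ) := by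
      refine lt_of_le_of_lt (Polynomial.degree_add_le _ _) (max_lt ?_ ?_)
      · refine lt_of_le_of_lt (Polynomial.degree_sum_le _ _) ?_
        rw [Finset.sup_lt_iff (WithBot.bot_lt_coe _)]
        intro i hi
        refine lt_of_le_of_lt (Polynomial.degree_C_mul_X_pow_le _ _) ?_
        exact_mod_cast Nat.pow_lt_pow_right hp.out.one_lt (Finset.mem_range.1 hi)
      · refine lt_of_le_of_lt Polynomial.degree_C_le ?_
        exact_mod_cast pow_pos hp.out.pos N
    have hm : (Polynomial.X ^ p ^ N - q).Monic := by
      exact Polynomial.monic_X_pow_sub hq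
    obtain ⟨y, hy⟩ := hE.root _ hm (by
      have h1 : (Polynomial.X ^ p ^ N - q).degree = ((p ^ N : ℕ) : WithBot ℕ) := by
        rw [Polynomial.degree_sub_eq_left_of_degree_lt, Polynomial.degree_X_pow]
        rw [Polynomial.degree_X_pow]; exact hq
      rw [Polynomial.natDegree_eq_of_degree_eq_some h1]
      exact pow_ne_zero _ hp.out.ne_zero)
    refine ⟨y, ?_⟩
    simpa [q, sub_eq_zero, Polynomial.eval_finsetSum] using hy
  intc := by
    intro b t N s hb h
    have := hE.ic
    let K := FractionRing Ω
    have hb' : algebraMap Ω K b ≠ 0 := by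
      simpa using hb
    let y : K := algebraMap Ω K t / algebraMap Ω K b
    have hy : IsIntegral Ω y := by
      let q : Polynomial Ω := ∑ i ∈ Finset.range N, Polynomial.C (s i) * Polynomial.X ^ p ^ i
      have hq : q.degree < (p ^ N : ℕ) := by
        refine lt_of_le_of_lt (Polynomial.degree_sum_le _ _) ?_
        rw [Finset.sup_lt_iff (WithBot.bot_lt_coe _)]
        intro i hi
        refine lt_of_le_of_lt (Polynomial.degree_C_mul_X_pow_le _ _) ?_
        exact_mod_cast Nat.pow_lt_pow_right hp.out.one_lt (Finset.mem_range.1 hi)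
      refine ⟨Polynomial.X ^ p ^ N - q, Polynomial.monic_X_pow_sub hq, ?_⟩
      have h2 := congrArg (algebraMap Ω K) h
      simp only [map_pow, map_sum, map_mul] at h2
      simp only [q, Polynomial.eval₂_sub, Polynomial.eval₂_X_pow, Polynomial.eval₂_finsetSum,
        Polynomial.eval₂_mul, Polynomial.eval₂_C, y, div_pow]
      rw [sub_eq_zero, h2, Finset.sum_div]
      refine Finset.sum_congr rfl fun i hi => ?_
      have : p ^ i ≤ p ^ N := Nat.pow_le_pow_right hp.out.pos (Finset.mem_range.1 hi).le
      rw [pow_sub₀ _ hb' this, div_eq_iff (pow_ne_zero _ hb')]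
      ring
    obtain ⟨z, hz⟩ := IsIntegrallyClosed.isIntegral_iff.1 hy
    refine ⟨z, ?_⟩
    apply IsFractionRing.injective Ω K
    rw [map_mul, hz]
    exact (mul_div_cancel₀ _ hb').symm
end
end HH

namespace HH

theorem cc0 {ι k M : Type} [DecidableEq ι] [Field k] [AddCommGroup M] [Module (MvPowerSeries ι k) M]
    [Module.Finite (MvPowerSeries ι k) M] :
    ∃ c : MvPowerSeries ι k, c ≠ 0 ∧ ∀ (J : Finset ι) (j : ι) (α : ι → ℕ) (β : ℕ) (w : M) (r : ι → M), j ∉ J →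
      (MvPowerSeries.X j : MvPowerSeries ι k) ^ β • w = ∑ i ∈ J, (MvPowerSeries.X i : MvPowerSeries ι k) ^ α i • r i →
      ∃ r' : ι → M, c • w = ∑ i ∈ J, (MvPowerSeries.X i : MvPowerSeries ι k) ^ α i • r' i := by
  classical
  let P := MvPowerSeries ι k
  obtain ⟨s, hs⟩ := (Module.Finite.fg_top : (⊤ : Submodule P M).FG)
  obtain ⟨b, hb, hmax⟩ := exists_maximal_linearIndepOn P (fun t : s => (t : M))
  have h1 : ∀ t : s, ∃ a : P, a ≠ 0 ∧ a • (t : M) ∈ Submodule.span P ((fun t : s => (t : M)) '' b) := by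
    intro t
    by_cases ht : t ∈ b
    · exact ⟨1, one_ne_zero, by rw [one_smul]; exact Submodule.subset_span ⟨t, ht, rfl⟩⟩
    · exact hmax t ht
  choose a ha0 ha using h1
  let L := Submodule.span P ((fun t : s => (t : M)) '' b)
  let c : P := ∏ t, a t
  have hc0 : c ≠ 0 := Finset.prod_ne_zero_iff.2 fun t _ => ha0 t
  have hcL : ∀ w : M, c • w ∈ L := by
    intro w
    have hw : w ∈ Submodule.span P (s : Set M) := by rw [hs]; trivial
    induction hw using Submodule.span_induction with
    | mem w hw =>
      have : c = (∏ t ∈ Finset.univ.erase (⟨w, hw⟩ : s), a t) * a ⟨w, hw⟩ :=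
        (Finset.prod_erase_mul _ _ (Finset.mem_univ _)).symm
      rw [this, mul_smul]
      exact L.smul_mem _ (ha ⟨w, hw⟩)
    | zero => rw [smul_zero]; exact L.zero_mem
    | add x y _ _ hx hy => rw [smul_add]; exact L.add_mem hx hy
    | smul r x _ hx => rw [smul_comm]; exact L.smul_mem _ hx
  let v : b → M := fun t => (t : s)
  have hv : LinearIndependent P v := hb
  have hLv : L = Submodule.span P (Set.range v) := by
    change Submodule.span P _ = _
    apply congrArg (Submodule.span P)
    ext w
    constructor
    · rintro ⟨t, ht, rfl⟩
      exact ⟨⟨t, ht⟩, rfl⟩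
    · rintro ⟨t, rfl⟩
      exact ⟨t.1, t.2, rfl⟩
  have hcr : ∀ w : M, ∃ g : b →₀ P, c • w = g.sum fun t q => q • v t := by
    intro w
    have := hcL w
    rw [hLv, Finsupp.mem_span_range_iff_exists_finsupp] at this
    obtain ⟨g, hg⟩ := this
    exact ⟨g, hg.symm⟩
  choose g hg using hcr
  refine ⟨c, hc0, fun J j α β w r hj h => ?_⟩
  have h2 : (MvPowerSeries.X j : P) ^ β • g w = ∑ i ∈ J, (MvPowerSeries.X i : P) ^ α i • g (r i) := by
    apply hv
    rw [map_smul, map_sum]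
    simp only [map_smul, Finsupp.linearCombination_apply]
    rw [← hg w, smul_comm, h, Finset.smul_sum]
    refine Finset.sum_congr rfl fun i _ => ?_
    rw [← hg, smul_comm]
  have h3 : ∀ t, ∃ cf : ι → P, g w t = ∑ i ∈ J, cf i * MvPowerSeries.X i ^ α i := by
    intro t
    rw [mono_mem]
    intro γ hγ
    have h4 : ∃ cf : ι → P, (MvPowerSeries.X j : P) ^ β * g w t = ∑ i ∈ J, cf i * MvPowerSeries.X i ^ α i := by
      refine ⟨fun i => g (r i) t, ?_⟩
      have := DFunLike.congr_fun h2 t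
      simp only [Finsupp.smul_apply, Finsupp.finsetSum_apply, smul_eq_mul] at this
      rw [this]
      exact Finset.sum_congr rfl fun i _ => mul_comm _ _
    rw [mono_mem] at h4
    have h5 := h4 (γ + Finsupp.single j β) (fun i hi => by
      have : i ≠ j := by rintro rfl; exact hj hi
      simpa [Finsupp.single_apply, this.symm] using hγ i hi)
    rw [MvPowerSeries.X_pow_eq, add_comm, MvPowerSeries.coeff_add_monomial_mul, one_mul] at h5
    exact h5
  choose cf hcf using h3
  refine ⟨fun i => (g w).sum fun t _ => cf t i • v t, ?_⟩
  rw [hg w]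
  simp only [Finsupp.sum, Finset.smul_sum]
  rw [Finset.sum_comm]
  refine Finset.sum_congr rfl fun t _ => ?_
  rw [hcf t, Finset.sum_smul]
  refine Finset.sum_congr rfl fun i _ => ?_
  rw [smul_smul, mul_comm]

open MvPowerSeries in
theorem box {ι k : Type} [Finite ι] [DecidableEq ι] [Field k] (H : Finset ι) (q : ℕ) (hq : 0 < q) :
    ∃ B : Finset (ι →₀ ℕ), ∀ a : MvPowerSeries ι k, ∃ (c : (ι →₀ ℕ) → MvPowerSeries ι k)
      (g : ι → MvPowerSeries ι k), (∀ μ, c μ ∈ SubH k H) ∧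
      a = ∑ μ ∈ B, c μ * monomial μ 1 + ∑ i ∈ H, g i * X i ^ q := by
  classical
  let δ : ι →₀ ℕ := Finsupp.equivFunOnFinite.symm (fun i => if i ∈ H then q - 1 else 0)
  have hδ : ∀ i, δ i = if i ∈ H then q - 1 else 0 := fun i => rfl
  refine ⟨Finset.Iic δ, fun a => ?_⟩
  let c : (ι →₀ ℕ) → MvPowerSeries ι k := fun μ γ => if ∃ i ∈ H, γ i ≠ 0 then 0 else coeff (γ + μ) a
  have hc : ∀ μ γ, coeff γ (c μ) = if ∃ i ∈ H, γ i ≠ 0 then 0 else coeff (γ + μ) a := fun _ _ => rfl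
  obtain ⟨g, hg⟩ := (mono_mem H (fun _ => q) (a - ∑ μ ∈ Finset.Iic δ, c μ * monomial μ 1)).2 (by
    intro γ hγ
    let μ0 : ι →₀ ℕ := γ.filter (· ∈ H)
    have hμ0 : ∀ i, μ0 i = if i ∈ H then γ i else 0 := fun i => by simp [μ0, Finsupp.filter_apply]
    rw [map_sub, map_sum, Finset.sum_eq_single μ0]
    · rw [coeff_mul_monomial, if_pos, hc, if_neg, tsub_add_cancel_of_le]
      · simp
      · intro i; rw [hμ0]; split_ifs <;> simp
      · rintro ⟨i, hi, h⟩
        apply h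
        rw [Finsupp.tsub_apply, hμ0, if_pos hi, Nat.sub_self]
      · intro i; rw [hμ0]; split_ifs <;> simp
    · intro μ hμ hne
      rw [coeff_mul_monomial]
      split_ifs with hle
      · rw [hc, if_pos, zero_mul]
        by_contra hcon
        push Not at hcon
        apply hne
        ext i
        rw [hμ0]
        split_ifs with hi
        · have := hcon i hi
          rw [Finsupp.tsub_apply] at this
          have := hle i
          omega
        · have := Finset.mem_Iic.1 hμ i
          rw [hδ, if_neg hi] at this
          omega
      · rfl
    · intro h
      exfalso
      apply h
      rw [Finset.mem_Iic]
      intro i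
      rw [hμ0, hδ]
      split_ifs with hi
      · have := hγ i hi; omega
      · rfl)
  exact ⟨c, g, fun μ γ h => by rw [hc, if_pos h], by rw [← hg]; ring⟩
end HH

namespace HH
section
variable {R : Type} [CommRing R] [IsDomain R] [IsNoetherianRing R] [IsLocalRing R]
    [IsAdicComplete (maximalIdeal R) R] {p : ℕ} [Fact p.Prime] [CharP R p] {d : ℕ}

theorem par_phi (p : ℕ) [Fact p.Prime] [CharP R p] (hd : ringKrullDim R = d) (x : Fin d → R)
    (hx : (Ideal.span (Set.range x)).radical = maximalIdeal R) :
    ∃ Φ : MvPowerSeries (Fin d) (ResidueField R) →+* R, (∀ i, Φ (MvPowerSeries.X i) = x i) ∧ Φ.Finite ∧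
      Function.Injective Φ := by
  obtain ⟨κ, hκ⟩ := coefField R p
  obtain ⟨Φ, hC, hX⟩ := phi_ex κ x (fun i => hx ▸ Ideal.le_radical (Ideal.subset_span ⟨i, rfl⟩))
  have hf := phi_fin κ hκ x hx Φ hC hX
  exact ⟨Φ, hX, hf, phi_inj hd x Φ hX hf⟩

theorem par_ne0 (hd : ringKrullDim R = d) (x : Fin d → R)
    (hx : (Ideal.span (Set.range x)).radical = maximalIdeal R) (i : Fin d) : x i ≠ 0 := by
  intro h
  have h1 := coht_le x hx {i} ⊥ (by
    intro j hj
    rw [Finset.mem_singleton.1 hj, h]; exact Ideal.zero_mem _)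
  have h2 : (Order.coheight (⊥ : PrimeSpectrum R) : WithBot ℕ∞) = d := by
    rw [Order.coheight_bot_eq_krullDim]; exact hd
  have h3 : Order.coheight (⊥ : PrimeSpectrum R) = d := by exact_mod_cast h2
  rw [h3, Finset.card_singleton] at h1
  have h4 : d ≤ d - 1 := by exact_mod_cast h1
  have := i.2
  omega

variable {Ω : Type} [CommRing Ω] [IsDomain Ω] [Algebra R Ω] [CharP Ω p]

theorem ax_cc (hE : Env R Ω) (hd : ringKrullDim R = d) (x : Fin d → R)
    (hx : (Ideal.span (Set.range x)).radical = maximalIdeal R) :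
    ∀ S ∈ GG R Ω p, ∃ c : Ω, c ≠ 0 ∧ ∃ S' ∈ GG R Ω p, ∀ (J : Finset (Fin d)) (j : Fin d) (α : Fin d → ℕ) (β : ℕ) (w : Ω)
      (r : Fin d → Ω), j ∉ J → w ∈ S → (∀ i, r i ∈ S) →
      algebraMap R Ω (x j) ^ β * w = ∑ i ∈ J, r i * algebraMap R Ω (x i) ^ α i →
      ∃ r' : Fin d → Ω, (∀ i, r' i ∈ S') ∧ c * w = ∑ i ∈ J, r' i * algebraMap R Ω (x i) ^ α i := by
  rintro _ ⟨R', hR', e, rfl⟩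
  obtain ⟨Φ, hX, hf, hi⟩ := par_phi p hd x hx
  let P := MvPowerSeries (Fin d) (ResidueField R)
  let : Algebra P R := Φ.toAlgebra
  let : Algebra P Ω := ((algebraMap R Ω).comp Φ).toAlgebra
  have : IsScalarTower P R Ω := IsScalarTower.of_algebraMap_eq fun _ => rfl
  have hPf : Module.Finite P R := hf
  have : Module.Finite P R' := Module.Finite.trans R R'
  obtain ⟨c, hc0, hc⟩ := cc0 (ι := Fin d) (k := ResidueField R) (M := R')
  obtain ⟨c', hc'⟩ := hE.proot p e (algebraMap P Ω c)
  have hXs : ∀ i n (m : R'), (((MvPowerSeries.X i : P) ^ n • m : R') : Ω) = algebraMap R Ω (x i) ^ n * m := by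
    intro i n m
    rw [Subalgebra.coe_smul, Algebra.smul_def, map_pow]
    change (algebraMap R Ω (Φ _)) ^ n * _ = _
    rw [hX]
  refine ⟨c', ?_, _, ⟨R', hR', e, rfl⟩, ?_⟩
  · rintro rfl
    rw [zero_pow (pow_ne_zero _ (Fact.out (p := p.Prime)).ne_zero)] at hc'
    apply hc0
    apply hi
    apply hE.inj
    rw [map_zero, map_zero, hc']
    rfl
  intro J j α β w r hj hw hr h
  have hcs : ∀ (q : ℕ) (r : Fin d → Ω), (∑ i ∈ J, r i * algebraMap R Ω (x i) ^ α i) ^ p ^ e =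
      ∑ i ∈ J, algebraMap R Ω (x i) ^ (α i * p ^ e) * r i ^ p ^ e := by
    intro q r
    rw [sum_pow_char_pow]
    refine Finset.sum_congr rfl fun i _ => ?_
    rw [mul_pow, ← pow_mul, mul_comm]
  obtain ⟨r', hr'⟩ := hc J j (fun i => α i * p ^ e) (β * p ^ e) ⟨w ^ p ^ e, hw⟩ (fun i => ⟨r i ^ p ^ e, hr i⟩) hj (by
    apply Subtype.ext
    rw [AddSubmonoidClass.coe_finsetSum, hXs]
    simp only [hXs]
    have := congrArg (· ^ p ^ e) h
    simp only [hcs 0] at this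
    rw [← this, mul_pow, ← pow_mul])
  choose s hs using fun i => hE.proot p e (r' i : Ω)
  refine ⟨s, fun i => by rw [mem_mkS, hs]; exact (r' i).2, ?_⟩
  apply qinj p e
  rw [hcs 0, mul_pow, hc']
  have := congrArg Subtype.val hr'
  rw [AddSubmonoidClass.coe_finsetSum, Subalgebra.coe_smul, Algebra.smul_def] at this
  simp only [hXs] at this
  rw [this]
  simp only [hs]
end
end HH

namespace HH
section
variable {R : Type} [CommRing R] [IsDomain R] [IsNoetherianRing R] [IsLocalRing R]
    [IsAdicComplete (maximalIdeal R) R] {p : ℕ} [hp : Fact p.Prime] [CharP R p] {d : ℕ}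
    {Ω : Type} [CommRing Ω] [IsDomain Ω] [Algebra R Ω] [CharP Ω p]

def Par (R Ω : Type) [CommRing R] [IsLocalRing R] [CommRing Ω] [Algebra R Ω] (d : ℕ) : Set (Fin d → Ω) :=
  {X | ∃ x : Fin d → R, (Ideal.span (Set.range x)).radical = maximalIdeal R ∧ X = fun i => algebraMap R Ω (x i)}

theorem ax_sub (hE : Env R Ω) (hd : ringKrullDim R = d) (x : Fin d → R)
    (hx : (Ideal.span (Set.range x)).radical = maximalIdeal R) (H : Finset (Fin d)) :
    ∃ B : Subring Ω, (∃ S ∈ GG R Ω p, B ≤ S) ∧ (∀ j, j ∉ H → algebraMap R Ω (x j) ∈ B) ∧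
      (∀ S ∈ GG R Ω p, ∃ (e : ℕ) (T : Finset Ω), ∀ w ∈ S, ∃ b : Ω → Ω, (∀ t, b t ^ p ^ e ∈ B) ∧
        w - ∑ t ∈ T, b t * t ∈ Ideal.span ((fun i => algebraMap R Ω (x i)) '' (H : Set (Fin d)))) ∧
      (∀ j0, j0 ∉ H → ∀ a ∈ B, a ≠ 0 → ∃ N : Fin d → ℕ, (∀ j, 1 ≤ N j) ∧
        (fun j => if j ∈ H then algebraMap R Ω (x j) else if j = j0 then a * algebraMap R Ω (x j0) else
          algebraMap R Ω (x j) + algebraMap R Ω (x j0) ^ N j) ∈ Par R Ω d) ∧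
      (H = ∅ → ∀ c : Ω, c ≠ 0 → ∃ a ∈ B, a ≠ 0 ∧ c ∣ a) := by
  classical
  obtain ⟨Φ, hX, hf, hi⟩ := par_phi p hd x hx
  let P := MvPowerSeries (Fin d) (ResidueField R)
  let : Algebra P R := Φ.toAlgebra
  let : Algebra P Ω := ((algebraMap R Ω).comp Φ).toAlgebra
  have : IsScalarTower P R Ω := IsScalarTower.of_algebraMap_eq fun _ => rfl
  have hPf : Module.Finite P R := hf
  have hPX : ∀ i, algebraMap P Ω (MvPowerSeries.X i : P) = algebraMap R Ω (x i) := fun i => by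
    rw [← hX]; rfl
  have hPi : Function.Injective (algebraMap P Ω) := hE.inj.comp hi
  refine ⟨(SubH (ResidueField R) H).map (algebraMap P Ω), ⟨_, ⟨⊥, inferInstance, 0, rfl⟩, ?_⟩, ?_, ?_, ?_, ?_⟩
  · rintro _ ⟨a, -, rfl⟩
    rw [mem_mkS, pow_zero, pow_one]
    exact ⟨Φ a, rfl⟩
  · intro j hj
    refine ⟨MvPowerSeries.X j, ?_, hPX j⟩
    rintro γ ⟨i, hi, h⟩
    rw [MvPowerSeries.coeff_X, if_neg]
    rintro rfl
    have : j ≠ i := by rintro rfl; exact hj hi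
    simp [this] at h
  · rintro _ ⟨R', hR', e, rfl⟩
    have : Module.Finite P R' := Module.Finite.trans R R'
    obtain ⟨T0, hT0⟩ := (Module.Finite.fg_top : (⊤ : Submodule P R').FG)
    obtain ⟨M, hM⟩ := box (k := ResidueField R) H (p ^ e) (pow_pos hp.out.pos e)
    choose cc gg hcc hag using hM
    choose rt hrt using fun a => hE.proot p e a
    let η : R' × (Fin d →₀ ℕ) → Ω := fun z => rt (algebraMap P Ω (MvPowerSeries.monomial z.2 1) * z.1)
    refine ⟨e, (T0 ×ˢ M).image η, fun w hw => ?_⟩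
    have h1 : (⟨w ^ p ^ e, hw⟩ : R') ∈ Submodule.span P (T0 : Set R') := by rw [hT0]; trivial
    rw [Submodule.mem_span_finset'] at h1
    obtain ⟨a0, ha0⟩ := h1
    let a : R' → P := fun t => if h : t ∈ T0 then a0 ⟨t, h⟩ else 0
    have ha : w ^ p ^ e = ∑ t ∈ T0, algebraMap P Ω (a t) * t := by
      have := congrArg Subtype.val ha0
      rw [AddSubmonoidClass.coe_finsetSum] at this
      rw [← Finset.sum_attach T0 (fun t => algebraMap P Ω (a t) * t)]
      refine Eq.trans this.symm ?_
      refine Finset.sum_congr rfl fun t _ => ?_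
      rw [Subalgebra.coe_smul, Algebra.smul_def]
      simp [a]
    let β : R' × (Fin d →₀ ℕ) → Ω := fun z => rt (algebraMap P Ω (cc (a z.1) z.2))
    refine ⟨fun s => ∑ z ∈ (T0 ×ˢ M) with η z = s, β z, fun s => ?_, ?_⟩
    · rw [sum_pow_char_pow]
      refine Subring.sum_mem _ fun z _ => ⟨_, hcc (a z.1) z.2, (hrt _).symm⟩
    · have h2 : ∑ s ∈ (T0 ×ˢ M).image η, (∑ z ∈ (T0 ×ˢ M) with η z = s, β z) * s = ∑ z ∈ T0 ×ˢ M, β z * η z := by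
        rw [← Finset.sum_fiberwise_of_maps_to (g := η) (t := (T0 ×ˢ M).image η)
          (fun z hz => Finset.mem_image_of_mem _ hz)]
        refine Finset.sum_congr rfl fun s _ => ?_
        rw [Finset.sum_mul]
        refine Finset.sum_congr rfl fun z hz => ?_
        rw [(Finset.mem_filter.1 hz).2]
      have h3 : w = ∑ z ∈ T0 ×ˢ M, β z * η z +
          ∑ i ∈ H, rt (∑ t ∈ T0, algebraMap P Ω (gg (a t) i) * t) * algebraMap R Ω (x i) := by
        apply qinj p e
        rw [add_pow_char_pow, sum_pow_char_pow, sum_pow_char_pow, ha, Finset.sum_product]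
        simp only [mul_pow, β, η, hrt, Finset.sum_mul]
        rw [Finset.sum_comm (s := H), ← Finset.sum_add_distrib]
        refine Finset.sum_congr rfl fun t _ => ?_
        conv_lhs => rw [hag (a t)]
        simp only [map_add, map_sum, map_mul, map_pow, hPX, add_mul, Finset.sum_mul]
        congr 1
        · exact Finset.sum_congr rfl fun _ _ => by ring
        · exact Finset.sum_congr rfl fun _ _ => by ring
      rw [h2]
      rw [sub_eq_iff_eq_add'.2 h3]
      exact Ideal.sum_mem _ fun i hi => Ideal.mul_mem_left _ _ (Ideal.subset_span ⟨i, hi, rfl⟩)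
  · rintro j0 hj0 _ ⟨a, ha, rfl⟩ ha0
    obtain ⟨N, hN, h⟩ := shift x hx Φ hX hf H j0 hj0 a ha (by rintro rfl; exact ha0 (map_zero _))
    refine ⟨N, hN, _, h, ?_⟩
    funext j
    split_ifs
    · rfl
    · rw [map_mul]; rfl
    · rw [map_add, map_pow]
  · rintro rfl c hc
    have hint : IsIntegral P c := isIntegral_trans (R := P) (A := R) c (hE.int c)
    have : IsDomain P := NoZeroDivisors.to_isDomain _
    obtain ⟨r, hr, h⟩ := hint.isAlgebraic.exists_nonzero_dvd (mem_nonZeroDivisors_of_ne_zero hc)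
    exact ⟨_, ⟨r, by rintro γ ⟨i, hi, -⟩; simp at hi, rfl⟩, fun h0 => hr (hPi (by rw [map_zero]; exact h0)), h⟩

theorem ax (hE : Env R Ω) (hd : ringKrullDim R = d) : Ax p (GG R Ω p) (Par R Ω d) where
  toBase := hE.base
  ne0 := by
    rintro _ ⟨x, hx, rfl⟩ i h
    exact par_ne0 hd x hx i (hE.inj (by rw [map_zero]; exact h))
  cc := by
    rintro _ ⟨x, hx, rfl⟩
    exact ax_cc hE hd x hx
  sub := by
    rintro _ ⟨x, hx, rfl⟩ H
    exact ax_sub hE hd x hx H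
end
end HH

namespace HH
section
variable {R : Type} [CommRing R] [IsDomain R] [IsNoetherianRing R] [IsLocalRing R]
    [IsAdicComplete (maximalIdeal R) R] {p : ℕ} [hp : Fact p.Prime] [CharP R p] {d : ℕ}
    {Ω : Type} [CommRing Ω] [IsDomain Ω] [Algebra R Ω] [CharP Ω p]

theorem env_plus (R F : Type) [CommRing R] [IsDomain R] [Field F] [Algebra R F] [IsAlgClosed F]
    [Algebra.IsAlgebraic R F] (hi : Function.Injective (algebraMap R F)) : Env R (integralClosure R F) where
  inj := fun a b h => hi (congrArg Subtype.val h)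
  int := fun w => integralClosure.isIntegral w
  root := by
    intro f hm hd
    have hm' := hm.map (algebraMap (integralClosure R F) F)
    obtain ⟨y, hy⟩ := IsAlgClosed.exists_root (f.map (algebraMap (integralClosure R F) F)) (by
      rw [Polynomial.degree_eq_natDegree hm'.ne_zero, hm.natDegree_map]
      exact_mod_cast hd)
    have h1 : IsIntegral (integralClosure R F) y := ⟨f, hm, by rw [← Polynomial.eval_map]; exact hy⟩
    refine ⟨⟨y, isIntegral_trans y h1⟩, ?_⟩
    apply Subtype.ext
    rw [Polynomial.IsRoot.def, Polynomial.eval_map] at hy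
    change algebraMap (integralClosure R F) F _ = 0
    rw [← Polynomial.eval₂_at_apply]
    exact hy
  ic := by
    have : IsFractionRing (integralClosure R F) F := integralClosure.isFractionRing_of_algebraic (fun x hx => by
      exact (injective_iff_map_eq_zero _).1 hi x hx)
    rw [isIntegrallyClosed_iff F]
    intro x hx
    exact ⟨⟨x, isIntegral_trans x hx⟩, rfl⟩

theorem regO (p : ℕ) [Fact p.Prime] [CharP R p] [CharP Ω p] (hE : Env R Ω) (hd : ringKrullDim R = d) (x : Fin d → R)
    (hx : (Ideal.span (Set.range x)).radical = maximalIdeal R) (α : Fin d → ℕ) (β : ℕ) (J : Finset (Fin d)) (j : Fin d)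
    (hj : j ∉ J) (w : Ω)
    (h : algebraMap R Ω (x j) ^ β * w ∈ Ideal.span ((fun i => algebraMap R Ω (x i) ^ α i) '' (J : Set (Fin d)))) :
    w ∈ Ideal.span ((fun i => algebraMap R Ω (x i) ^ α i) '' (J : Set (Fin d))) := by
  have hA := ax (p := p) hE hd
  have hB := hA.toBase
  obtain ⟨r, hr⟩ := mem_sp.1 h
  obtain ⟨S, hS, hwS⟩ := hB.ex w
  have hbr : Bdd (GG R Ω p) (fun q : Unit × Fin d => r q.2) := by
    have : ∀ s : Finset (Fin d), ∃ S ∈ GG R Ω p, ∀ i ∈ s, r i ∈ S := by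
      intro s
      induction s using Finset.induction_on with
      | empty => exact ⟨S, hS, by simp⟩
      | insert i s _ ih =>
        obtain ⟨S1, h1, h2⟩ := ih
        obtain ⟨S2, h3, h4⟩ := hB.ex (r i)
        obtain ⟨S3, h5, h6, h7⟩ := hB.dir _ h1 _ h3
        refine ⟨S3, h5, fun k hk => ?_⟩
        rcases Finset.mem_insert.1 hk with rfl | hk
        · exact h7 h4
        · exact h6 (h2 k hk)
    obtain ⟨S, hS, h⟩ := this Finset.univ
    exact ⟨S, hS, fun q => h q.2 (Finset.mem_univ _)⟩
  obtain ⟨r', -, hr'⟩ := reg_all hA (J.card + 1) _ ⟨x, hx, rfl⟩ Unit (fun _ => α) (fun _ => β) J j (fun _ => w)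
    (Nat.lt_succ_self _) hj ⟨S, hS, fun _ => hwS⟩ ⟨fun _ => r, hbr, fun _ => hr⟩
  exact mem_sp.2 ⟨r' (), hr' ()⟩

theorem one_notMem (hE : Env R Ω) (x : Fin d → R)
    (hx : (Ideal.span (Set.range x)).radical = maximalIdeal R) :
    (1 : Ω) ∉ Ideal.span (Set.range fun i => algebraMap R Ω (x i)) := by
  have : Algebra.IsIntegral R Ω := ⟨hE.int⟩
  obtain ⟨Q, -, hQ, hQm⟩ := Ideal.exists_ideal_over_prime_of_isIntegral (maximalIdeal R) (⊥ : Ideal Ω) (by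
    intro a ha
    have : algebraMap R Ω a = 0 := ha
    rw [(injective_iff_map_eq_zero _).1 hE.inj a this]; exact Ideal.zero_mem _)
  intro h
  apply hQ.ne_top
  rw [Ideal.eq_top_iff_one]
  refine (Ideal.span_le.2 ?_ : _ ≤ Q) h
  rintro _ ⟨i, rfl⟩
  have : x i ∈ Q.comap (algebraMap R Ω) := by
    rw [hQm, ← hx]; exact Ideal.le_radical (Ideal.subset_span ⟨i, rfl⟩)
  exact this

/-- contraction of monomial ideals -/
theorem contr (p : ℕ) [Fact p.Prime] [CharP R p] [CharP Ω p] (hE : Env R Ω) (hd : ringKrullDim R = d) (x : Fin d → R)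
    (hx : (Ideal.span (Set.range x)).radical = maximalIdeal R)
    (φ : MvPowerSeries (Fin d) (ResidueField R) →+* Ω) (hφ : ∀ i, φ (MvPowerSeries.X i) = algebraMap R Ω (x i))
    (α : Fin d → ℕ) (hα : ∀ i, 0 < α i) (a : MvPowerSeries (Fin d) (ResidueField R))
    (h : φ a ∈ Ideal.span (Set.range fun i => algebraMap R Ω (x i) ^ α i)) (γ : Fin d →₀ ℕ) (hγ : ∀ i, γ i < α i) :
    MvPowerSeries.coeff γ a = 0 := by
  classical
  induction γ using WellFoundedLT.induction with
  | ind γ ih =>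
  by_contra hne
  let I := Ideal.span (Set.range fun i => algebraMap R Ω (x i) ^ α i)
  let τ : Fin d →₀ ℕ := Finsupp.equivFunOnFinite.symm (fun i => α i - 1)
  have hτ : ∀ i, τ i = α i - 1 := fun i => rfl
  have hγτ : γ ≤ τ := fun i => by have := hγ i; rw [hτ]; omega
  obtain ⟨g, hg⟩ := (mono_mem Finset.univ α (MvPowerSeries.monomial (τ - γ) 1 * a -
    MvPowerSeries.C (MvPowerSeries.coeff γ a) * MvPowerSeries.monomial τ 1)).2 (by
      intro δ hδ
      have hδτ : δ ≤ τ := fun i => by have := hδ i (Finset.mem_univ _); rw [hτ]; omega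
      rw [map_sub, MvPowerSeries.coeff_C_mul, MvPowerSeries.coeff_monomial_mul, MvPowerSeries.coeff_monomial]
      by_cases h1 : δ = τ
      · subst h1
        rw [if_pos tsub_le_self, if_pos rfl, tsub_tsub_cancel_of_le hγτ]; simp
      · rw [if_neg h1, mul_zero, sub_zero]
        split_ifs with h2
        · rw [one_mul]
          have hle : ∀ i, (δ - (τ - γ)) i ≤ γ i ∧ (δ i < τ i → (δ - (τ - γ)) i < γ i) := by
            intro i
            have := h2 i
            have := hγτ i
            have := hδτ i
            simp only [Finsupp.tsub_apply] at *
            omega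
          apply ih
          · refine lt_of_le_of_ne (fun i => (hle i).1) (fun heq => h1 ?_)
            ext i
            have h3 := hle i
            rw [heq] at h3
            have := hδτ i
            by_contra h4
            exact lt_irrefl _ (h3.2 (lt_of_le_of_ne this h4))
          · exact fun i => lt_of_le_of_lt (hle i).1 (hγ i)
        · rfl)
  have hmon : ∀ τ : Fin d →₀ ℕ, φ (MvPowerSeries.monomial τ 1) = ∏ i, algebraMap R Ω (x i) ^ τ i := by
    intro τ
    have : (MvPowerSeries.monomial τ 1 : MvPowerSeries (Fin d) (ResidueField R)) = ∏ i, MvPowerSeries.X i ^ τ i := by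
      have h1 := MvPowerSeries.monomial_one_eq (R := ResidueField R) τ
      rw [h1, Finsupp.prod_fintype]
      simp
    rw [this, map_prod]
    simp only [map_pow, hφ]
  have h1 : ∏ i, algebraMap R Ω (x i) ^ (α i - 1) ∈ I := by
    have h2 : φ (MvPowerSeries.C (MvPowerSeries.coeff γ a) * MvPowerSeries.monomial τ 1) ∈ I := by
      rw [sub_eq_iff_eq_add] at hg
      have h3 := congrArg φ hg
      rw [map_mul, map_add, ← sub_eq_iff_eq_add'] at h3
      rw [← h3]
      refine I.sub_mem (I.mul_mem_left _ h) ?_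
      rw [map_sum]
      refine I.sum_mem fun i _ => ?_
      rw [map_mul, map_pow, hφ]
      exact I.mul_mem_left _ (Ideal.subset_span ⟨i, rfl⟩)
    have h4 := I.mul_mem_left (φ (MvPowerSeries.C (MvPowerSeries.coeff γ a)⁻¹)) h2
    rw [← map_mul, ← mul_assoc, ← map_mul, inv_mul_cancel₀ hne, map_one, one_mul, hmon] at h4
    exact h4
  have key : ∀ K : Finset (Fin d), ∏ i ∈ K, algebraMap R Ω (x i) ^ (α i - 1) ∈
      Ideal.span ((fun i => algebraMap R Ω (x i) ^ (if i ∈ K then α i else 1)) '' (Finset.univ : Finset (Fin d))) → False := by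
    intro K
    induction K using Finset.induction_on with
    | empty =>
      intro h
      apply one_notMem hE x hx
      simpa using h
    | insert k K hk ih =>
      intro h
      apply ih
      rw [Finset.prod_insert hk] at h
      obtain ⟨r, hr⟩ := mem_sp.1 h
      have hk1 := hα k
      have h5 := regO p hE hd x hx (fun i => if i ∈ K then α i else 1) (α k - 1) (Finset.univ.erase k) k (by simp)
        (∏ i ∈ K, algebraMap R Ω (x i) ^ (α i - 1) - r k * algebraMap R Ω (x k)) (mem_sp.2 ⟨r, by
          rw [← Finset.add_sum_erase _ _ (Finset.mem_univ k)] at hr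
          rw [mul_sub, hr]
          simp only [Finset.mem_insert_self, if_true]
          have : algebraMap R Ω (x k) ^ α k = algebraMap R Ω (x k) ^ (α k - 1) * algebraMap R Ω (x k) := by
            rw [← pow_succ]; congr 1; omega
          rw [this]
          have : ∀ i ∈ Finset.univ.erase k, r i * algebraMap R Ω (x i) ^ (if i ∈ insert k K then α i else 1) =
            r i * algebraMap R Ω (x i) ^ (if i ∈ K then α i else 1) := by
            intro i hi
            simp [Finset.ne_of_mem_erase hi]
          rw [Finset.sum_congr rfl this]
          ring⟩)
      have h6 : algebraMap R Ω (x k) ∈ Ideal.span ((fun i => algebraMap R Ω (x i) ^ (if i ∈ K then α i else 1)) '' (Finset.univ : Finset (Fin d))) :=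
        Ideal.subset_span ⟨k, by simp, by simp [hk]⟩
      have h7 := Ideal.add_mem _ (Ideal.span_mono (Set.image_mono (by simp)) h5) (Ideal.mul_mem_left _ (r k) h6)
      rwa [sub_add_cancel] at h7
  apply key Finset.univ
  simpa using h1
end
end HH

namespace HH

theorem conj_bound {P K F Ω : Type} [CommRing P] [IsDomain P] [Field K] [Algebra P K] [IsFractionRing P K]
    [Field F] [Algebra P F] [Algebra K F] [IsScalarTower P K F] [IsAlgClosed F] [Algebra.IsAlgebraic K F]
    [CommRing Ω] [IsDomain Ω] [Algebra P Ω] [Algebra Ω F] [IsScalarTower P Ω F] [IsIntegralClosure Ω P F]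
    (v : Ω) (hs : IsSeparable K (algebraMap Ω F v)) :
    ∃ (D : P) (r : ℕ) (a : ℕ → Fin r → P), D ≠ 0 ∧
      (∀ q, algebraMap P Ω D * v ^ q = ∑ j, algebraMap P Ω (a q j) * v ^ (j : ℕ)) ∧
      ∀ (I0 : Ideal P) (q : ℕ), v ^ q ∈ I0.map (algebraMap P Ω) → ∀ j, algebraMap P Ω (a q j) ∈ I0.map (algebraMap P Ω) := by
  classical
  have hinj : Function.Injective (algebraMap Ω F) := IsIntegralClosure.algebraMap_injective Ω P F
  have hPi : Function.Injective (algebraMap P F) := by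
    rw [IsScalarTower.algebraMap_eq P K F]
    exact (algebraMap K F).injective.comp (IsFractionRing.injective P K)
  have hPO : Function.Injective (algebraMap P Ω) := by
    rw [IsScalarTower.algebraMap_eq P Ω F] at hPi
    exact Function.Injective.of_comp hPi
  have hint : ∀ w : Ω, IsIntegral P w := fun w => (IsIntegralClosure.isIntegral P F w)
  have hsm : ∀ (b : P) (w : Ω), algebraMap Ω F (b • w) = b • algebraMap Ω F w := fun b w => by
    rw [Algebra.smul_def, map_mul, ← IsScalarTower.algebraMap_apply, ← Algebra.smul_def]
  let v' := algebraMap Ω F v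
  let g := minpoly K v'
  let r := g.natDegree
  have hgm : g.Monic := minpoly.monic hs.isIntegral
  -- a uniform denominator
  let L : Submodule P Ω := Submodule.span P (Set.range fun j : Fin r => v ^ (j : ℕ))
  have h1 : ∀ w ∈ Algebra.adjoin P {v}, ∃ c : P, c ≠ 0 ∧ c • w ∈ L := by
    intro w hw
    rw [Algebra.adjoin_singleton_eq_range_aeval] at hw
    obtain ⟨f, rfl⟩ := hw
    let f' := (f.map (algebraMap P K)) %ₘ g
    have hf' : f'.degree < r := by
      have := Polynomial.degree_modByMonic_lt (f.map (algebraMap P K)) hgm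
      rwa [Polynomial.degree_eq_natDegree hgm.ne_zero] at this
    obtain ⟨b, hb⟩ := IsLocalization.exist_integer_multiples (nonZeroDivisors P) (Finset.range r) (fun i => f'.coeff i)
    choose! k hk using hb
    refine ⟨b, nonZeroDivisors.coe_ne_zero b, ?_⟩
    have h2 : (b : P) • (Polynomial.aeval v f) = ∑ j : Fin r, k j • v ^ (j : ℕ) := by
      apply hinj
      have h3 : algebraMap Ω F (Polynomial.aeval v f) = Polynomial.aeval v' f' := by
        rw [← Polynomial.aeval_algebraMap_apply, ← Polynomial.aeval_map_algebraMap K]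
        exact (Polynomial.aeval_modByMonic_eq_self_of_root (minpoly.aeval K v')).symm
      rw [hsm, h3, Polynomial.aeval_eq_sum_range' (n := r) (by
        by_cases h0 : f' = 0
        · rw [h0, Polynomial.natDegree_zero]
          exact minpoly.natDegree_pos hs.isIntegral
        · exact (Polynomial.natDegree_lt_iff_degree_lt h0).2 hf'), map_sum, Finset.smul_sum,
        Finset.sum_range]
      refine Finset.sum_congr rfl fun j _ => ?_
      rw [hsm, map_pow, ← smul_assoc, ← hk j (Finset.mem_range.2 j.2), algebraMap_smul]
    change (b : P) • (Polynomial.aeval v f) ∈ L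
    rw [h2]
    exact L.sum_mem fun j _ => L.smul_mem _ (Submodule.subset_span ⟨j, rfl⟩)
  obtain ⟨s, hs1⟩ := (hint v).fg_adjoin_singleton
  have h2 : ∃ c : P, c ≠ 0 ∧ ∀ w ∈ Algebra.adjoin P {v}, c • w ∈ L := by
    have hss : ∀ t : s, (t : Ω) ∈ Algebra.adjoin P {v} := fun t => by
      rw [← Subalgebra.mem_toSubmodule, ← hs1]; exact Submodule.subset_span t.2
    choose c hc0 hc using fun t : s => h1 t (hss t)
    refine ⟨∏ t, c t, Finset.prod_ne_zero_iff.2 fun t _ => hc0 t, fun w hw => ?_⟩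
    rw [← Subalgebra.mem_toSubmodule, ← hs1] at hw
    induction hw using Submodule.span_induction with
    | mem w hw =>
      rw [← Finset.prod_erase_mul _ _ (Finset.mem_univ (⟨w, hw⟩ : s)), mul_smul]
      exact L.smul_mem _ (hc ⟨w, hw⟩)
    | zero => rw [smul_zero]; exact L.zero_mem
    | add x y _ _ hx hy => rw [smul_add]; exact L.add_mem hx hy
    | smul r x _ hx => rw [smul_comm]; exact L.smul_mem _ hx
  obtain ⟨c, hc0, hc⟩ := h2
  have h3 : ∀ q : ℕ, ∃ a : Fin r → P, ∑ j, a j • v ^ (j : ℕ) = c • v ^ q := by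
    intro q
    exact (Submodule.mem_span_range_iff_exists_fun P).1 (hc _ (pow_mem (Algebra.self_mem_adjoin_singleton P v) q))
  choose a ha using h3
  -- conjugates
  have hn : Normal K F := normal_iff.2 fun x => ⟨Algebra.IsIntegral.isIntegral x, IsAlgClosed.splits _⟩
  have hcard : Fintype.card (g.rootSet F) = r :=
    Polynomial.card_rootSet_eq_natDegree hs (IsAlgClosed.splits _)
  let eq := (Fintype.equivFinOfCardEq hcard).symm
  have h4 : ∀ i : Fin r, ∃ σ : Gal(F/K), σ v' = eq i := by
    intro i
    refine isConjRoot_iff_exists_algEquiv.1 ?_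
    have := (Polynomial.mem_rootSet.1 (eq i).2).2
    exact ((isConjRoot_iff_aeval_eq_zero hs.isIntegral).2 this).symm
  choose σ hσ using h4
  let τ : Fin r → (Ω →ₐ[P] Ω) := fun i => galRestrict' P Ω Ω (σ i : F →ₐ[K] F)
  have hτ : ∀ i, algebraMap Ω F (τ i v) = eq i := fun i => by
    rw [algebraMap_galRestrict'_apply]; exact hσ i
  let V := Matrix.vandermonde (fun i => τ i v)
  have hV : V.det ≠ 0 := by
    rw [Matrix.det_vandermonde_ne_zero_iff]
    intro i j hij
    apply eq.injective
    apply Subtype.ext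
    rw [← hτ, ← hτ]; exact congrArg _ hij
  obtain ⟨D, hD0, hD⟩ := (hint V.det).isAlgebraic.exists_nonzero_dvd (mem_nonZeroDivisors_of_ne_zero hV)
  refine ⟨D * c, r, fun q j => D * a q j, mul_ne_zero hD0 hc0, fun q => ?_, fun I0 q hq j => ?_⟩
  · have := ha q
    simp only [Algebra.smul_def] at this
    rw [map_mul, mul_assoc, ← this, Finset.mul_sum]
    exact Finset.sum_congr rfl fun j _ => by rw [map_mul, mul_assoc]
  · have h5 : ∀ i, (V.mulVec fun j => algebraMap P Ω (a q j)) i ∈ I0.map (algebraMap P Ω) := by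
      intro i
      have h6 : (V.mulVec fun j => algebraMap P Ω (a q j)) i = τ i (c • v ^ q) := by
        rw [← ha, map_sum]
        simp only [Matrix.mulVec, dotProduct, V, Matrix.vandermonde_apply, map_smul, map_pow]
        exact Finset.sum_congr rfl fun j _ => by rw [Algebra.smul_def, mul_comm]
      rw [h6, map_smul, Algebra.smul_def]
      refine Ideal.mul_mem_left _ _ ?_
      have h7 := Ideal.mem_map_of_mem (τ i : Ω →+* Ω) hq
      rw [Ideal.map_map] at h7
      rwa [show (τ i : Ω →+* Ω).comp (algebraMap P Ω) = algebraMap P Ω from (τ i).comp_algebraMap] at h7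
    have h8 : V.det * algebraMap P Ω (a q j) = (V.adjugate.mulVec (V.mulVec fun j => algebraMap P Ω (a q j))) j := by
      rw [Matrix.mulVec_mulVec, Matrix.adjugate_mul, Matrix.smul_mulVec, Matrix.one_mulVec]
      rfl
    rw [map_mul]
    refine Ideal.mem_of_dvd _ (mul_dvd_mul_right hD _) ?_
    rw [h8, Matrix.mulVec, dotProduct]
    exact Ideal.sum_mem _ fun i _ => Ideal.mul_mem_left _ _ (h5 i)
end HH

namespace HH

theorem thmB {R : Type} [CommRing R] [IsDomain R] [IsNoetherianRing R] [IsLocalRing R]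
    [IsAdicComplete (maximalIdeal R) R] (p : ℕ) [hp : Fact p.Prime] [CharP R p] {d : ℕ} (hd : ringKrullDim R = d)
    (x : Fin d → R) (hx : (Ideal.span (Set.range x)).radical = maximalIdeal R)
    {F : Type} [Field F] [Algebra R F] [IsAlgClosed F] [Algebra.IsAlgebraic R F] (hi : Function.Injective (algebraMap R F))
    (J : Finset (Fin d)) (u : integralClosure R F)
    (h : ∀ N, u ∈ Ideal.span ((fun i => algebraMap R (integralClosure R F) (x i)) '' (J : Set (Fin d))) ⊔
      Ideal.span (Set.range fun i => algebraMap R (integralClosure R F) (x i)) ^ N) :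
    u ∈ Ideal.span ((fun i => algebraMap R (integralClosure R F) (x i)) '' (J : Set (Fin d))) := by
  classical
  let Ω := integralClosure R F
  have hE : Env R Ω := env_plus R F hi
  have : CharP Ω p := charP_of_injective_algebraMap hE.inj p
  have : CharP F p := charP_of_injective_algebraMap hi p
  have hA := ax (p := p) hE hd
  obtain ⟨Φ, hX, hf, hΦ⟩ := par_phi p hd x hx
  let P := MvPowerSeries (Fin d) (ResidueField R)
  have : IsDomain P := NoZeroDivisors.to_isDomain _
  let : Algebra P R := Φ.toAlgebra
  let : Algebra P Ω := ((algebraMap R Ω).comp Φ).toAlgebra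
  let : Algebra P F := ((algebraMap R F).comp Φ).toAlgebra
  have : IsScalarTower P R Ω := IsScalarTower.of_algebraMap_eq fun _ => rfl
  have : IsScalarTower P R F := IsScalarTower.of_algebraMap_eq fun _ => rfl
  have : IsScalarTower P Ω F := IsScalarTower.of_algebraMap_eq fun _ => rfl
  have hPf : Module.Finite P R := hf
  have hPi : Function.Injective (algebraMap P F) := hi.comp hΦ
  have hPX : ∀ i, algebraMap P Ω (MvPowerSeries.X i : P) = algebraMap R Ω (x i) := fun i => by
    rw [← hX]; rfl
  let K := FractionRing P
  have : FaithfulSMul P F := (faithfulSMul_iff_algebraMap_injective P F).2 hPi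
  let : Algebra K F := FractionRing.liftAlgebra P F
  have : IsScalarTower P K F := FractionRing.isScalarTower_liftAlgebra P F
  have : FaithfulSMul P R := (faithfulSMul_iff_algebraMap_injective P R).2 hΦ
  have hPF : Algebra.IsAlgebraic P F := Algebra.IsAlgebraic.trans P R F
  have : Algebra.IsAlgebraic K F := Algebra.IsAlgebraic.extendScalars (R := P) (IsFractionRing.injective P K)
  have : IsIntegralClosure Ω P F := 
    { algebraMap_injective := Subtype.val_injective
      isIntegral_iff := by
        intro w
        constructor
        · intro hw
          exact ⟨⟨w, hw.tower_top⟩, rfl⟩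
        · rintro ⟨y, rfl⟩
          exact isIntegral_trans (R := P) (A := R) _ y.2 }
  -- make it separable
  have : ExpChar K p := by
    have : CharP K p := (RingHom.charP_iff (algebraMap K F) (algebraMap K F).injective p).2 inferInstance
    exact ExpChar.prime hp.out
  have : ExpChar (separableClosure K F) p := expChar_of_injective_algebraMap (algebraMap K _).injective p
  obtain ⟨e0, w0, hw0⟩ := IsPurelyInseparable.pow_mem (separableClosure K F) p (algebraMap Ω F u)
  have hs : IsSeparable K (algebraMap Ω F (u ^ p ^ e0)) := by
    rw [map_pow, ← hw0]
    exact mem_separableClosure_iff.1 w0.2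
  obtain ⟨D, r, a, hD, ha, haI⟩ := conj_bound (P := P) (K := K) (F := F) (u ^ p ^ e0) hs
  let X : Fin d → Ω := fun i => algebraMap R Ω (x i)
  -- powers of u lie in monomial ideals
  have h1 : ∀ f M : ℕ, 0 < M → u ^ p ^ f ∈ Ideal.span (Set.range fun i => X i ^ (if i ∈ J then p ^ f else M)) := by
    intro f M hM
    have h2 : u ∈ Ideal.span ((fun i => X i ^ (if i ∈ J then 1 else M)) '' (Finset.univ : Finset (Fin d))) := by
      obtain ⟨N, hN⟩ := Ideal.exists_pow_le_of_le_radical_of_fg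
        (I := Ideal.span (Set.range X)) (J := Ideal.span ((fun i => X i ^ M) '' (Finset.univ : Finset (Fin d)))) (by
          rw [Ideal.span_le]
          rintro _ ⟨i, rfl⟩
          exact ⟨M, Ideal.subset_span ⟨i, by simp, rfl⟩⟩) (Submodule.fg_span (Set.finite_range X))
      refine SetLike.le_def.1 (sup_le ?_ ?_) (h N)
      · rw [Ideal.span_le]
        rintro _ ⟨i, hi, rfl⟩
        exact Ideal.subset_span ⟨i, by simp, by
          change X i ^ _ = X i
          rw [if_pos (Finset.mem_coe.1 hi), pow_one]⟩
      · refine le_trans (?_ : _ ≤ Ideal.span ((fun i => X i ^ M) '' (Finset.univ : Finset (Fin d)))) ?_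
        · exact hN
        · rw [Ideal.span_le]
          rintro _ ⟨i, hi, rfl⟩
          have : X i ^ (if i ∈ J then 1 else M) ∣ X i ^ M := pow_dvd_pow _ (by split_ifs <;> omega)
          exact Ideal.mem_of_dvd _ this (Ideal.subset_span ⟨i, hi, rfl⟩)
    obtain ⟨c, hc⟩ := mem_sp.1 h2
    rw [hc, sum_pow_char_pow]
    refine Ideal.sum_mem _ fun i _ => ?_
    rw [mul_pow, ← pow_mul]
    refine Ideal.mul_mem_left _ _ ?_
    have : X i ^ (if i ∈ J then p ^ f else M) ∣ X i ^ ((if i ∈ J then 1 else M) * p ^ f) := pow_dvd_pow _ (by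
      split_ifs
      · simp
      · exact Nat.le_mul_of_pos_right _ (pow_pos hp.out.pos _))
    exact Ideal.mem_of_dvd _ this (Ideal.subset_span ⟨i, rfl⟩)
  have h3 : ∀ ν j, ∃ c : Fin d → P, a (p ^ ν) j = ∑ i ∈ J, c i * MvPowerSeries.X i ^ p ^ (ν + e0) := by
    intro ν j
    rw [mono_mem J (fun _ => p ^ (ν + e0))]
    intro γ hγ
    let M := ∑ i, γ i + 1
    have hM : ∀ i, γ i < M := fun i => Nat.lt_succ_of_le (Finset.single_le_sum (fun _ _ => Nat.zero_le _) (Finset.mem_univ i))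
    let α : Fin d → ℕ := fun i => if i ∈ J then p ^ (ν + e0) else M
    refine contr p hE hd x hx (algebraMap P Ω) hPX α (fun i => ?_) _ ?_ γ (fun i => ?_)
    · simp only [α]; split_ifs
      · exact pow_pos hp.out.pos _
      · exact Nat.succ_pos _
    · have h4 := haI (Ideal.span (Set.range fun i => (MvPowerSeries.X i : P) ^ α i)) (p ^ ν) 
      rw [Ideal.map_span, ← Set.range_comp] at h4
      have h5 : (algebraMap P Ω ∘ fun i => (MvPowerSeries.X i : P) ^ α i) = fun i => X i ^ α i := by
        funext i; simp [X, hPX]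
      rw [h5] at h4
      refine h4 ?_ j
      rw [← pow_mul, ← pow_add, add_comm]
      exact h1 _ _ (Nat.succ_pos _)
    · simp only [α]; split_ifs with hi
      · exact hγ i hi
      · exact hM i
  choose b hb using h3
  have hR' : Module.Finite R (Algebra.adjoin R {u ^ p ^ e0}) := Algebra.finite_adjoin_simple_of_isIntegral (hE.int _)
  have hS : mkS p (Algebra.adjoin R {u ^ p ^ e0}) 0 ∈ GG R Ω p := ⟨_, hR', 0, rfl⟩
  have hmS : ∀ w, w ∈ Algebra.adjoin R {u ^ p ^ e0} → w ∈ mkS p (Algebra.adjoin R {u ^ p ^ e0}) 0 := fun w hw => by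
    rw [mem_mkS, pow_zero, pow_one]; exact hw
  have hself := Algebra.self_mem_adjoin_singleton R (u ^ p ^ e0)
  obtain ⟨r', -, hr'⟩ := uu_all hA J.card X ⟨x, hx, rfl⟩ ℕ Nat.succ (fun ν => ν + e0) J (fun ν => (u ^ p ^ e0) ^ p ^ ν)
    (algebraMap P Ω D) rfl (fun ν => by beta_reduce; omega) (fun ν => by beta_reduce; rw [← pow_mul (u ^ p ^ e0), ← pow_succ])
    ⟨_, hS, fun ν => hmS _ (pow_mem hself _)⟩
    (fun h0 => hD (hPi (by rw [map_zero, IsScalarTower.algebraMap_apply P Ω F, h0, map_zero])))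
    ⟨fun ν i => ∑ j, algebraMap P Ω (b ν j i) * (u ^ p ^ e0) ^ (j : ℕ), ⟨_, hS, fun q => hmS _ (Subalgebra.sum_mem _ fun j _ =>
      Subalgebra.mul_mem _ (Subalgebra.algebraMap_mem _ (Φ _)) (pow_mem hself _))⟩, fun ν => by
      dsimp only
      rw [ha]
      simp only [Finset.sum_mul]
      rw [Finset.sum_comm]
      refine Finset.sum_congr rfl fun j _ => ?_
      rw [hb ν j, map_sum, Finset.sum_mul]
      refine Finset.sum_congr rfl fun i _ => ?_
      rw [map_mul, map_pow, hPX]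
      ring⟩
  have h6 := hr' 0
  simp only [pow_zero, pow_one, zero_add] at h6
  choose s hs' using fun i => hE.proot p e0 (r' 0 i)
  refine mem_sp.2 ⟨s, ?_⟩
  apply qinj p e0
  rw [h6, sum_pow_char_pow]
  exact Finset.sum_congr rfl fun i _ => by rw [mul_pow, hs']
end HH

namespace HH

def Nz {B : Type} [CommRing B] (I : Ideal B) (a : B) : Prop := ∀ g, a * g ∈ I → g ∈ I

def EE {B : Type} [CommRing B] (K : Ideal B) (x : ℕ → B) (α : ℕ → ℕ) (J : Finset ℕ) : Ideal B :=
  K ⊔ Ideal.span ((fun i => x i ^ α i) '' (J : Set ℕ))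

structure Good {B : Type} [CommRing B] (K : Ideal B) (x : ℕ → B) (n d : ℕ) : Prop where
  reg : ∀ (α : ℕ → ℕ) (J : Finset ℕ) (j : ℕ), J ⊆ Finset.Ico n d → j ∈ Finset.Ico n d → j ∉ J → Nz (EE K x α J) (x j)
  sep : ∀ (J : Finset ℕ), J ⊆ Finset.Ico (n + 1) d → ∀ g,
    (∀ N, g ∈ EE K x (fun i => if i ∈ J then 1 else N) (Finset.Ico n d)) → g ∈ EE K x 1 J

section
variable {B : Type} [CommRing B]

theorem mem_sup1 {I : Ideal B} {a g : B} : g ∈ I ⊔ Ideal.span {a} ↔ ∃ h, g - a * h ∈ I := by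
  rw [Submodule.mem_sup]
  constructor
  · rintro ⟨y, hy, z, hz, rfl⟩
    obtain ⟨h, rfl⟩ := Ideal.mem_span_singleton.1 hz
    exact ⟨h, by rwa [add_sub_cancel_right]⟩
  · rintro ⟨h, hh⟩
    exact ⟨_, hh, a * h, Ideal.mul_mem_right _ _ (Ideal.mem_span_singleton_self a), by ring⟩

theorem EE_insert (K : Ideal B) (x : ℕ → B) (α) (J) (j) : EE K x α (insert j J) = EE K x α J ⊔ Ideal.span {x j ^ α j} := by
  rw [EE, Finset.coe_insert, Set.image_insert_eq, Ideal.span_insert, EE, sup_assoc, sup_comm (Ideal.span {_})]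

theorem EE_K (K : Ideal B) (x : ℕ → B) (α) (J) (z : B) : EE (K ⊔ Ideal.span {z}) x α J = EE K x α J ⊔ Ideal.span {z} := by
  rw [EE, EE, sup_assoc, sup_assoc, sup_comm (Ideal.span {z})]

theorem EE_congr (K : Ideal B) (x : ℕ → B) {α β : ℕ → ℕ} {J : Finset ℕ} (h : ∀ i ∈ J, α i = β i) : EE K x α J = EE K x β J := by
  rw [EE, EE]
  congr 2
  exact Set.image_congr fun i hi => by rw [h i hi]

theorem EE_mono (K : Ideal B) (x : ℕ → B) {α β : ℕ → ℕ} {J L : Finset ℕ} (h : ∀ i ∈ J, i ∈ L ∧ β i ≤ α i) :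
    EE K x α J ≤ EE K x β L := by
  refine sup_le_sup_left (Ideal.span_le.2 ?_) _
  rintro _ ⟨i, hi, rfl⟩
  exact Ideal.mem_of_dvd _ (pow_dvd_pow _ (h i hi).2) (Ideal.subset_span ⟨i, (h i hi).1, rfl⟩)

theorem EE_map {A : Type} [CommRing A] (f : B →+* A) (K : Ideal B) (x : ℕ → B) (α J) :
    (EE K x α J).map f = EE (K.map f) (fun i => f (x i)) α J := by
  rw [EE, EE, Ideal.map_sup, Ideal.map_span, ← Set.image_comp]
  congr 2
  exact Set.image_congr fun i _ => by simp

theorem EE_pow {K : Ideal B} {x : ℕ → B} {α : ℕ → ℕ} {J : Finset ℕ} {j : ℕ} (hj : j ∈ J) : x j ^ α j ∈ EE K x α J :=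
  Ideal.mem_sup_right (Ideal.subset_span ⟨j, hj, rfl⟩)

theorem Nz.pow {I : Ideal B} {a : B} (h : Nz I a) (n : ℕ) : Nz I (a ^ n) := by
  induction n with
  | zero => intro g hg; simpa using hg
  | succ n ih => intro g hg; rw [pow_succ', mul_assoc] at hg; exact ih _ (h _ hg)

/-- swap -/
theorem Nz.swap {I : Ideal B} {a b : B} (ha : Nz I a) (hb : Nz (I ⊔ Ideal.span {a}) b) : Nz (I ⊔ Ideal.span {b}) a := by
  intro g hg
  obtain ⟨h, hh⟩ := mem_sup1.1 hg
  obtain ⟨h', hh'⟩ := mem_sup1.1 (hb h (mem_sup1.2 ⟨g, by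
    have := I.neg_mem hh
    rwa [neg_sub] at this⟩))
  refine mem_sup1.2 ⟨h', ha _ ?_⟩
  have := I.add_mem hh (I.mul_mem_left b hh')
  convert this using 1
  ring

theorem Nz.polyC {I : Ideal B} {a : B} (ha : Nz I a) : Nz (I.map Polynomial.C) (Polynomial.C a) := by
  intro g hg
  rw [Ideal.mem_map_C_iff] at hg ⊢
  intro n
  have := hg n
  rw [Polynomial.coeff_C_mul] at this
  exact ha _ this

theorem Nz.polyt {I : Ideal B} {a : B} (ha : Nz I a) (b : B) :
    Nz (I.map Polynomial.C) (Polynomial.C a - Polynomial.X * Polynomial.C b) := by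
  intro g hg
  rw [Ideal.mem_map_C_iff] at hg ⊢
  intro n
  induction n with
  | zero =>
    have := hg 0
    rw [sub_mul, mul_assoc, Polynomial.coeff_sub, Polynomial.coeff_C_mul, Polynomial.coeff_X_mul_zero, sub_zero] at this
    exact ha _ this
  | succ n ih =>
    have := hg (n + 1)
    rw [sub_mul, mul_assoc, Polynomial.coeff_sub, Polynomial.coeff_C_mul, Polynomial.coeff_X_mul, Polynomial.coeff_C_mul] at this
    refine ha _ ?_
    have h2 := I.add_mem this (I.mul_mem_left b ih)
    rwa [sub_add_cancel] at h2

theorem colon1 {I : Ideal B} {a : B} (ha : Nz I a) (n : ℕ) {g : B} (h : a * g ∈ I ⊔ Ideal.span {a ^ (n + 1)}) :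
    g ∈ I ⊔ Ideal.span {a ^ n} := by
  obtain ⟨k, hk⟩ := mem_sup1.1 h
  refine mem_sup1.2 ⟨k, ha _ ?_⟩
  convert hk using 1
  ring

variable {K : Ideal B} {x : ℕ → B} {n d : ℕ}

theorem Good.nz_z (hG : Good K x n d) (α : ℕ → ℕ) (J : Finset ℕ) (hJ : J ⊆ Finset.Ico (n + 1) d) (hn : n < d) :
    Nz (EE K x α J) (x n) :=
  hG.reg α J n (hJ.trans (Finset.Ico_subset_Ico_left (Nat.le_succ n))) (Finset.mem_Ico.2 ⟨le_rfl, hn⟩)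
    (fun h => by have := Finset.mem_Ico.1 (hJ h); omega)

open Polynomial in
theorem Good.step (hG : Good K x n d) (hn : n + 1 < d) :
    Good (K.map (C : B →+* B[X]) ⊔ Ideal.span {C (x n) - X * C (x (n + 1))}) (fun i => C (x i)) (n + 1) d := by
  classical
  have hreg : ∀ (α : ℕ → ℕ) (J : Finset ℕ) (j : ℕ), J ⊆ Finset.Ico (n + 1) d → j ∈ Finset.Ico (n + 1) d → j ∉ J →
      Nz (EE (K.map (C : B →+* B[X]) ⊔ Ideal.span {C (x n) - X * C (x (n + 1))}) (fun i => C (x i)) α J) (C (x j)) := by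
    intro α J j hJ hj hjJ
    rw [EE_K, ← EE_map]
    apply Nz.swap
    · exact (hG.reg α J j (hJ.trans (Finset.Ico_subset_Ico_left (Nat.le_succ n)))
        (Finset.Ico_subset_Ico_left (Nat.le_succ n) hj) hjJ).polyC
    · have h1 := hG.nz_z (Function.update α j 1) (insert j J) (Finset.insert_subset hj hJ) (by omega)
      rw [EE_insert, Function.update_self, pow_one, EE_congr K x (β := α) (fun i hi => by
        rw [Function.update_of_ne]; rintro rfl; exact hjJ hi)] at h1
      have h2 := h1.polyt (x (n + 1))
      rwa [Ideal.map_sup, Ideal.map_span, Set.image_singleton] at h2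
  refine ⟨hreg, fun J hJ g hg => ?_⟩
  have hJ1 : J ⊆ Finset.Ico (n + 1) d := hJ.trans (Finset.Ico_subset_Ico_left (Nat.le_succ _))
  have hnJ : n ∉ J := fun h => by have := Finset.mem_Ico.1 (hJ h); omega
  have hn1J : n + 1 ∉ J := fun h => by have := Finset.mem_Ico.1 (hJ h); omega
  let D := g.natDegree
  let G : B := ∑ j ∈ Finset.range (D + 1), g.coeff j * (x n ^ j * x (n + 1) ^ (D - j))
  let z : B[X] := C (x n) - X * C (x (n + 1))
  have hGg : z ∣ C (x (n + 1)) ^ D * g - C G := by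
    have h1 : C (x (n + 1)) ^ D * g - C G = ∑ j ∈ Finset.range (D + 1), C (g.coeff j) * C (x (n + 1)) ^ (D - j) *
        ((X * C (x (n + 1))) ^ j - C (x n) ^ j) := by
      conv_lhs => rw [g.as_sum_range_C_mul_X_pow]
      rw [Finset.mul_sum, map_sum, ← Finset.sum_sub_distrib]
      refine Finset.sum_congr rfl fun j hj => ?_
      have : C (x (n + 1)) ^ D = C (x (n + 1)) ^ (D - j) * C (x (n + 1)) ^ j := by
        rw [← pow_add]; congr 1; have := Finset.mem_range.1 hj; omega
      rw [this]
      simp only [map_mul, map_pow]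
      ring
    rw [h1]
    refine Finset.dvd_sum fun j _ => Dvd.dvd.mul_left ?_ _
    refine dvd_trans ?_ (sub_dvd_pow_sub_pow _ _ _)
    exact (dvd_neg.2 (dvd_refl z)).trans (by simp [z])
  obtain ⟨q, hq⟩ := hGg
  have hGsep : G ∈ EE K x 1 J := by
    apply hG.sep J hJ1
    intro s
    -- ideals of `B`
    let W : ℕ → ℕ → Ideal B := fun a b => EE K x (fun i => if i ∈ J then 1 else if i = n then a else if i = n + 1 then b else 2 * s)
      (Finset.Ico n d)
    let V : Ideal B := EE K x (fun i => if i ∈ J then 1 else 2 * s) (Finset.Ico (n + 1) d)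
    have hV : C G ∈ V.map (C : B →+* B[X]) ⊔ Ideal.span {z} := by
      have h1 := Ideal.mul_mem_left _ (C (x (n + 1)) ^ D) (hg (2 * s))
      rw [EE_K, ← EE_map] at h1
      have h2 : C G = C (x (n + 1)) ^ D * g - z * q := by rw [← hq]; ring
      rw [h2]
      exact Ideal.sub_mem _ h1 (Ideal.mul_mem_right _ _ (Ideal.mem_sup_right (Ideal.mem_span_singleton_self z)))
    obtain ⟨h, hh⟩ := mem_sup1.1 hV
    rw [Ideal.mem_map_C_iff] at hh
    have h0 : G - x n * h.coeff 0 ∈ V := by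
      have := hh 0
      simpa [z, sub_mul, mul_assoc, Polynomial.coeff_X_mul_zero] using this
    have h1 : ∀ k, x (n + 1) * h.coeff k - x n * h.coeff (k + 1) ∈ V := by
      intro k
      have := hh (k + 1)
      simp only [z, sub_mul, mul_assoc, Polynomial.coeff_sub, Polynomial.coeff_C_mul, Polynomial.coeff_X_mul,
        Polynomial.coeff_C_succ, zero_sub, neg_sub] at this
      exact this
    have hVW : ∀ a b, b ≤ 2 * s → V ≤ W a b := by
      intro a b hb
      refine EE_mono K x fun i hi => ⟨Finset.Ico_subset_Ico_left (Nat.le_succ _) hi, ?_⟩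
      have := Finset.mem_Ico.1 hi
      split_ifs <;> omega
    have hxW : ∀ a b c, c ∈ W a b → x n * c ∈ W (a + 1) b := by
      intro a b c hc
      have hI : Finset.Ico n d = insert n (Finset.Ico (n + 1) d) := (Finset.insert_Ico_add_one_left_eq_Ico (by omega)).symm
      have hW : ∀ a, W a b = EE K x (fun i => if i ∈ J then 1 else if i = n + 1 then b else 2 * s)
          (Finset.Ico (n + 1) d) ⊔ Ideal.span {x n ^ a} := by
        intro a
        change EE _ _ _ _ = _
        rw [hI, EE_insert, if_neg hnJ, if_pos rfl]
        congr 1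
        refine EE_congr K x fun i hi => ?_
        have := Finset.mem_Ico.1 hi
        split_ifs <;> first | rfl | omega
      rw [hW, mem_sup1] at hc
      obtain ⟨y, hy⟩ := hc
      rw [hW, mem_sup1]
      refine ⟨y, ?_⟩
      convert Ideal.mul_mem_left _ (x n) hy using 1
      ring
    have hcol : ∀ a b c, x (n + 1) * c ∈ W a (b + 1) → c ∈ W a b := by
      intro a b c hc
      have hI : Finset.Ico n d = insert (n + 1) ((Finset.Ico n d).erase (n + 1)) :=
        (Finset.insert_erase (Finset.mem_Ico.2 ⟨by omega, hn⟩)).symm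
      have hW : ∀ b, W a b = EE K x (fun i => if i ∈ J then 1 else if i = n then a else 2 * s)
          ((Finset.Ico n d).erase (n + 1)) ⊔ Ideal.span {x (n + 1) ^ b} := by
        intro b
        change EE _ _ _ _ = _
        conv_lhs => rw [hI]
        rw [EE_insert, if_neg hn1J, if_neg (by omega), if_pos rfl]
        congr 1
        refine EE_congr K x fun i hi => ?_
        have := Finset.ne_of_mem_erase hi
        split_ifs <;> first | rfl | omega
      rw [hW] at hc ⊢
      exact colon1 (hG.reg _ _ _ (Finset.erase_subset _ _) (Finset.mem_Ico.2 ⟨by omega, hn⟩) (by simp)) b hc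
    have key : ∀ m, m ≤ 2 * s → ∀ k, h.coeff k ∈ W m (2 * s - m) := by
      intro m
      induction m with
      | zero =>
        intro _ k
        have : (1 : B) ∈ W 0 (2 * s - 0) := by
          have := EE_pow (K := K) (x := x) (α := fun i => if i ∈ J then 1 else if i = n then 0 else if i = n + 1 then 2 * s - 0 else 2 * s)
            (J := Finset.Ico n d) (j := n) (Finset.mem_Ico.2 ⟨le_rfl, by omega⟩)
          beta_reduce at this
          rwa [if_neg hnJ, if_pos rfl, pow_zero] at this
        rw [(Ideal.eq_top_iff_one _).2 this]
        trivial
      | succ m ih =>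
        intro hm k
        apply hcol
        have e1 : 2 * s - (m + 1) + 1 = 2 * s - m := by omega
        rw [e1]
        have := Ideal.add_mem _ (hVW (m + 1) (2 * s - m) (by omega) (h1 k)) (hxW _ _ _ (ih (by omega) (k + 1)))
        rwa [sub_add_cancel] at this
    have hfin : G ∈ W (s + 1) (2 * s - s) := by
      have := Ideal.add_mem _ (hVW (s + 1) (2 * s - s) (by omega) h0) (hxW _ _ _ (key s (by omega) 0))
      rwa [sub_add_cancel] at this
    refine EE_mono K x (fun i hi => ⟨hi, ?_⟩) hfin
    split_ifs <;> omega
  have hfin : C (x (n + 1)) ^ D * g ∈ EE (K.map (C : B →+* B[X]) ⊔ Ideal.span {z}) (fun i => C (x i)) 1 J := by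
    rw [EE_K, ← EE_map]
    refine mem_sup1.2 ⟨q, ?_⟩
    rw [← hq, sub_sub_cancel]
    exact Ideal.mem_map_of_mem _ hGsep
  exact (hreg 1 J (n + 1) hJ1 (Finset.mem_Ico.2 ⟨le_rfl, hn⟩) hn1J).pow D g hfin
end
end HH

namespace HH
section
variable {B : Type} [CommRing B] {Λ : Type}
open MvPolynomial

theorem Nz.mvC {I : Ideal B} {a : B} (ha : Nz I a) : Nz (I.map (C (σ := Λ))) (C a) := by
  intro g hg
  rw [MvPolynomial.mem_map_C_iff] at hg ⊢
  intro m
  have := hg m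
  rw [MvPolynomial.coeff_C_mul] at this
  exact ha _ this

theorem Nz.mvt {I : Ideal B} {a : B} (ha : Nz I a) (b : B) (l : Λ) :
    Nz (I.map (C (σ := Λ))) (C a - X l * C b) := by
  classical
  intro g hg
  rw [MvPolynomial.mem_map_C_iff] at hg ⊢
  have key : ∀ n : ℕ, ∀ m : Λ →₀ ℕ, m l = n → coeff m g ∈ I := by
    intro n
    induction n with
    | zero =>
      intro m hm
      have := hg m
      rw [sub_mul, mul_assoc, coeff_sub, coeff_C_mul, coeff_X_mul', if_neg (by simp [hm]), sub_zero] at this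
      exact ha _ this
    | succ n ih =>
      intro m hm
      have := hg m
      rw [sub_mul, mul_assoc, coeff_sub, coeff_C_mul, coeff_X_mul', if_pos (by simp [hm]), coeff_C_mul] at this
      refine ha _ ?_
      have h2 := I.add_mem this (I.mul_mem_left b (ih (m - Finsupp.single l 1) (by simp [hm])))
      rwa [sub_add_cancel] at h2
  exact fun m => key _ m rfl

theorem Good.mv {K : Ideal B} {x : ℕ → B} {n d : ℕ} (hG : Good K x n d) :
    Good (K.map (C (σ := Λ))) (fun i => C (x i)) n d := by
  constructor
  · intro α J j hJ hj hjJ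
    rw [← EE_map]
    exact (hG.reg α J j hJ hj hjJ).mvC
  · intro J hJ g hg
    rw [← EE_map, MvPolynomial.mem_map_C_iff]
    intro m
    refine hG.sep J hJ _ fun N => ?_
    have := hg N
    rw [← EE_map, MvPolynomial.mem_map_C_iff] at this
    exact this m

theorem mem_map_bij {A : Type} [CommRing A] {f : B →+* A} (hf : Function.Bijective f) {I : Ideal B} {a : B} :
    f a ∈ I.map f ↔ a ∈ I := by
  rw [← Ideal.mem_comap, Ideal.comap_map_of_bijective f hf]

theorem Nz.bij {A : Type} [CommRing A] {f : B →+* A} (hf : Function.Bijective f) {I : Ideal B} {a : B} (h : Nz I a) :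
    Nz (I.map f) (f a) := by
  intro g hg
  obtain ⟨g, rfl⟩ := hf.2 g
  rw [← map_mul, mem_map_bij hf] at hg
  exact (mem_map_bij hf).2 (h _ hg)

theorem Good.bij {A : Type} [CommRing A] {f : B →+* A} (hf : Function.Bijective f) {K : Ideal B} {x : ℕ → B} {n d : ℕ}
    (hG : Good K x n d) : Good (K.map f) (fun i => f (x i)) n d := by
  constructor
  · intro α J j hJ hj hjJ
    rw [← EE_map]
    exact (hG.reg α J j hJ hj hjJ).bij hf
  · intro J hJ g hg
    obtain ⟨g, rfl⟩ := hf.2 g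
    rw [← EE_map, mem_map_bij hf]
    refine hG.sep J hJ _ fun N => ?_
    have := hg N
    rwa [← EE_map, mem_map_bij hf] at this

noncomputable def ZZ (K : Ideal B) (x : ℕ → B) {k : ℕ} (lam : Fin k → Λ) (n : ℕ) : Ideal (MvPolynomial Λ B) :=
  K.map C ⊔ Ideal.span (Set.range fun i : Fin k => C (x (n + i)) - X (lam i) * C (x (n + i + 1)))

noncomputable def ff (B : Type) [CommRing B] (a : Λ) : MvPolynomial {b : Λ // b ≠ a} (Polynomial B) →+* MvPolynomial Λ B :=
  eval₂Hom (Polynomial.eval₂RingHom C (X a)) (fun b => X b)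

theorem ff_bij (a : Λ) : Function.Bijective (ff B a) := by
  classical
  let e : MvPolynomial {b : Λ // b ≠ a} (Polynomial B) ≃+* MvPolynomial Λ B :=
    ((optionEquivRight B {b : Λ // b ≠ a}).symm.trans (renameEquiv B (Equiv.optionSubtypeNe a))).toRingEquiv
  have : ff B a = (e : MvPolynomial {b : Λ // b ≠ a} (Polynomial B) →+* MvPolynomial Λ B) := by
    apply MvPolynomial.ringHom_ext'
    · apply Polynomial.ringHom_ext
      · intro b
        simp [ff, e, optionEquivRight]
      · simp [ff, e, optionEquivRight]
    · intro b
      simp [ff, e, optionEquivRight]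
  rw [this]
  exact e.bijective

theorem ff_CC (a : Λ) (b : B) : ff B a (C (Polynomial.C b)) = C b := by simp [ff]
theorem ff_CX (a : Λ) : ff B a (C Polynomial.X) = X a := by simp [ff]
theorem ff_X (a : Λ) (b) : ff B a (X b) = X (b : Λ) := by simp [ff]

theorem ZZ_succ (K : Ideal B) (x : ℕ → B) {k : ℕ} (lam : Fin (k + 1) → Λ) (hl : Function.Injective lam) (n : ℕ) :
    (ZZ (K.map (Polynomial.C : B →+* Polynomial B) ⊔ Ideal.span {Polynomial.C (x n) - Polynomial.X * Polynomial.C (x (n + 1))})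
      (fun i => Polynomial.C (x i)) (fun i : Fin k => (⟨lam i.succ, fun h => Fin.succ_ne_zero i (hl h)⟩ : {b : Λ // b ≠ lam 0})) (n + 1)).map (ff B (lam 0))
    = ZZ K x lam n := by
  have h1 : (Set.range fun i : Fin (k + 1) => (C (x (n + i)) - X (lam i) * C (x (n + i + 1)) : MvPolynomial Λ B)) =
      insert (C (x n) - X (lam 0) * C (x (n + 1))) (Set.range fun i : Fin k => (C (x (n + 1 + i)) - X (lam i.succ) * C (x (n + 1 + i + 1)) : MvPolynomial Λ B)) := by
    ext t
    simp only [Set.mem_range, Set.mem_insert_iff, Fin.exists_fin_succ]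
    simp only [Fin.val_zero, add_zero, Fin.val_succ, add_assoc, add_comm 1, eq_comm]
  rw [ZZ, ZZ, h1, Ideal.span_insert, Ideal.map_sup, Ideal.map_sup, Ideal.map_sup, Ideal.map_map, Ideal.map_map, Ideal.map_span, Ideal.map_span,
    Ideal.map_span, Set.image_singleton, Set.image_singleton, ← Set.range_comp, sup_assoc]
  congr 1
  · congr 1
    ext b : 1
    simp [ff_CC]
  · congr 1
    · simp only [map_sub, map_mul, ff_CC, ff_CX]
    · congr 2
      ext i : 1
      simp [ff_CC, ff_X]

theorem claim (d k : ℕ) : ∀ {B : Type} [CommRing B] {Λ : Type} (K : Ideal B) (x : ℕ → B) (n : ℕ) (_ : Good K x n d) (_ : n + k < d)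
    (lam : Fin k → Λ) (_ : Function.Injective lam),
    Good (ZZ K x lam n) (fun i => C (x i)) (n + k) d ∧
    ∀ (l : Λ) (_ : l ∉ Set.range lam) (α : ℕ → ℕ) (J : Finset ℕ) (_ : J ⊆ Finset.Ico (n + k + 1) d),
      Nz (EE (ZZ K x lam n) (fun i => C (x i)) α J) (C (x (n + k)) - X l * C (x (n + k + 1))) := by
  induction k with
  | zero =>
    intro B _ Λ K x n hG hn lam _
    have h0 : ZZ K x lam n = K.map C := by
      rw [ZZ, Set.range_eq_empty, Ideal.span_empty, sup_bot_eq]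
    rw [h0]
    refine ⟨hG.mv, fun l _ α J hJ => ?_⟩
    rw [← EE_map]
    exact (hG.nz_z α J hJ hn).mvt _ _
  | succ k ih =>
    intro B _ Λ K x n hG hn lam hl
    have h1 := ih _ _ _ (hG.step (by omega)) (by omega) (fun i : Fin k => (⟨lam i.succ, fun h => Fin.succ_ne_zero i (hl h)⟩ : {b : Λ // b ≠ lam 0}))
      (fun i j h => Fin.succ_injective _ (hl (Subtype.ext_iff.1 h)))
    have e : n + 1 + k = n + (k + 1) := by omega
    rw [e] at h1
    obtain ⟨h1, h2⟩ := h1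
    constructor
    · have h3 := h1.bij (ff_bij (lam 0))
      rw [ZZ_succ _ _ lam hl] at h3
      simpa only [ff_CC] using h3
    · intro l hlr α J hJ
      have h3 := (h2 ⟨l, fun h => hlr ⟨0, h.symm⟩⟩ (by
        rintro ⟨i, hi⟩
        exact hlr ⟨i.succ, Subtype.ext_iff.1 hi⟩) α J hJ).bij (ff_bij (lam 0))
      rw [EE_map, ZZ_succ _ _ lam hl] at h3
      simpa only [map_sub, map_mul, ff_CC, ff_X] using h3
end
end HH

namespace HH
section
variable {B : Type} [CommRing B] {Λ : Type}
open MvPolynomial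

theorem Nz.pw {I : Ideal B} {a s : B} (ha : Nz I a) (hs : Nz (I ⊔ Ideal.span {a}) s) (n : ℕ) : Nz (I ⊔ Ideal.span {a ^ n}) s := by
  induction n with
  | zero => intro g _; rw [pow_zero, Ideal.span_singleton_one, sup_top_eq]; trivial
  | succ n ih =>
    intro g hg
    have hle : I ⊔ Ideal.span {a ^ (n + 1)} ≤ I ⊔ Ideal.span {a} :=
      sup_le_sup_left ((Ideal.span_singleton_le_span_singleton).2 (dvd_pow_self _ (by omega))) _
    obtain ⟨h, hh⟩ := mem_sup1.1 (hs g (hle hg))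
    have h1 : a * (s * h) ∈ I ⊔ Ideal.span {a ^ (n + 1)} := by
      have := Ideal.sub_mem _ hg (Ideal.mem_sup_left (Ideal.mul_mem_left _ s hh))
      convert this using 1
      ring
    obtain ⟨c, hc⟩ := mem_sup1.1 (ih _ (colon1 ha n h1))
    refine mem_sup1.2 ⟨c, ?_⟩
    have := I.add_mem hh (I.mul_mem_left a hc)
    convert this using 1
    ring

theorem sN {K : Ideal B} {x : ℕ → B} {n d : ℕ} (hG : Good K x n d) {s : B} (hs : Nz (EE K x 1 (Finset.Ico n d)) s) (α : ℕ → ℕ) :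
    Nz (EE K x α (Finset.Ico n d)) s := by
  classical
  have key : ∀ S : Finset ℕ, S ⊆ Finset.Ico n d → ∀ α : ℕ → ℕ, (∀ i ∈ Finset.Ico n d, i ∉ S → α i = 1) →
      Nz (EE K x α (Finset.Ico n d)) s := by
    intro S
    induction S using Finset.induction_on with
    | empty =>
      intro _ α hα
      rwa [EE_congr K x (β := 1) fun i hi => hα i hi (by simp)]
    | insert j S hj ih =>
      intro hS α hα
      have hjI := hS (Finset.mem_insert_self j S)
      have h1 := ih ((Finset.subset_insert _ _).trans hS) (Function.update α j 1) (by
        intro i hi hiS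
        by_cases hij : i = j
        · rw [hij, Function.update_self]
        · rw [Function.update_of_ne hij]; exact hα i hi (by simp [hij, hiS]))
      have hI := (Finset.insert_erase hjI).symm
      rw [hI, EE_insert, Function.update_self, pow_one, EE_congr K x (β := α) (fun i hi => by
        rw [Function.update_of_ne (Finset.ne_of_mem_erase hi)])] at h1
      rw [hI, EE_insert]
      exact (hG.reg α _ j (Finset.erase_subset _ _) hjI (by simp)).pw h1 _
  exact key _ subset_rfl α fun i hi h => absurd hi h

theorem mccoy0 [Nontrivial B] (s g : MvPolynomial Λ B) (hs : s ≠ 0) (hu : ∀ m ∈ s.support, IsUnit (coeff m s)) (h : s * g = 0) : g = 0 := by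
  classical
  obtain ⟨r, _⟩ := exists_wellFoundedGT Λ
  let M : MonomialOrder Λ := MonomialOrder.lex
  have h1 : IsUnit (M.leadingCoeff s) := hu _ (M.degree_mem_support hs)
  have h2 := M.leadingCoeff_mul_of_isRegular_left (g := g) h1.isRegular
  rw [h, M.leadingCoeff_zero] at h2
  exact M.leadingCoeff_eq_zero_iff.1 ((h1.mul_right_eq_zero).1 h2.symm)

theorem mccoy [IsLocalRing B] (I : Ideal B) (hI : I.radical = maximalIdeal B) (s : MvPolynomial Λ B)
    (hs : s ∉ (maximalIdeal B).map (C (σ := Λ))) : Nz (I.map C) s := by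
  classical
  let s0 : MvPolynomial Λ B := ∑ m ∈ s.support with coeff m s ∉ maximalIdeal B, monomial m (coeff m s)
  have hc : ∀ m, coeff m s0 = if coeff m s ∉ maximalIdeal B then coeff m s else 0 := by
    intro m
    simp only [s0, coeff_sum, coeff_monomial, Finset.sum_ite_eq', Finset.mem_filter, mem_support_iff]
    by_cases h : coeff m s = 0 <;> simp [h]
  have hs1 : s - s0 ∈ (I.map (C (σ := Λ))).radical := by
    apply Ideal.map_radical_le
    rw [hI, MvPolynomial.mem_map_C_iff]
    intro m
    rw [coeff_sub, hc]
    split_ifs with h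
    · rwa [sub_zero]
    · rw [sub_self]; exact zero_mem _
  have hIt : I ≠ ⊤ := by
    rintro rfl
    rw [Ideal.radical_top] at hI
    exact (maximalIdeal.isMaximal B).ne_top hI.symm
  have hIm : I ≤ maximalIdeal B := hI ▸ Ideal.le_radical
  have hs0 : Nz (I.map (C (σ := Λ))) s0 := by
    intro g hg
    have hn : Nontrivial (B ⧸ I) := Ideal.Quotient.nontrivial_iff.2 hIt
    have e : ∀ q : MvPolynomial Λ B, q ∈ I.map (C (σ := Λ)) ↔ MvPolynomial.map (Ideal.Quotient.mk I) q = 0 := by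
      intro q
      rw [MvPolynomial.mem_map_C_iff, MvPolynomial.ext_iff]
      simp only [coeff_map, coeff_zero, Ideal.Quotient.eq_zero_iff_mem]
    rw [e] at hg ⊢
    rw [map_mul] at hg
    refine mccoy0 _ _ ?_ ?_ hg
    · intro h0
      rw [← e, MvPolynomial.mem_map_C_iff] at h0
      apply hs
      rw [MvPolynomial.mem_map_C_iff]
      intro m
      by_contra hm
      have := h0 m
      rw [hc, if_pos hm] at this
      exact hm (hIm this)
    · intro m hm
      rw [mem_support_iff, coeff_map, hc] at hm
      rw [coeff_map, hc]
      split_ifs at hm ⊢ with h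
      · simp at hm
      · exact (notMem_maximalIdeal.1 h).map _
  intro g hg
  obtain ⟨k, hk⟩ := hs1
  refine hs0.pow k g ?_
  have h1 : s ∣ (s - s0) ^ k - (-s0) ^ k := by
    refine dvd_trans ?_ (sub_dvd_pow_sub_pow _ _ _)
    simp
  obtain ⟨q, hq⟩ := h1
  have h2 : s0 ^ k * g = (-1) ^ k * ((s - s0) ^ k * g - q * (s * g)) := by
    have : (s - s0) ^ k * g - q * (s * g) = (-s0) ^ k * g := by
      have : (-s0) ^ k = (s - s0) ^ k - s * q := by rw [← hq]; ring
      rw [this]; ring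
    rw [this, ← mul_assoc, ← mul_pow]
    simp
  rw [h2]
  exact Ideal.mul_mem_left _ _ (Ideal.sub_mem _ (Ideal.mul_mem_right _ _ hk) (Ideal.mul_mem_left _ _ hg))

theorem EE_all (x : ℕ → B) {n d : ℕ} (hn : n < d) (lam : Fin n → Λ) :
    EE (ZZ ⊥ x lam 0) (fun i => C (x i)) 1 (Finset.Ico n d) = (Ideal.span (x '' (Set.Iio d))).map C := by
  have hm : ∀ i, i < d → C (x i) ∈ (Ideal.span (x '' (Set.Iio d))).map (C (σ := Λ)) :=
    fun i hi => Ideal.mem_map_of_mem _ (Ideal.subset_span ⟨i, hi, rfl⟩)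
  apply le_antisymm
  · refine sup_le (sup_le ?_ (Ideal.span_le.2 ?_)) (Ideal.span_le.2 ?_)
    · rw [Ideal.map_bot]; exact bot_le
    · rintro _ ⟨i, rfl⟩
      have := i.2
      exact Ideal.sub_mem _ (hm _ (by omega)) (Ideal.mul_mem_left _ _ (hm _ (by omega)))
    · rintro _ ⟨i, hi, rfl⟩
      have := Finset.mem_Ico.1 hi
      simpa using hm i (by omega)
  · rw [Ideal.map_span, Ideal.span_le]
    rintro _ ⟨_, ⟨i, hi, rfl⟩, rfl⟩
    have key : ∀ k i, n ≤ i + k → i < d → C (x i) ∈ EE (ZZ ⊥ x lam 0) (fun i => C (x i)) 1 (Finset.Ico n d) := by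
      intro k
      induction k with
      | zero =>
        intro i h1 h2
        refine Ideal.mem_sup_right (Ideal.subset_span ⟨i, Finset.mem_coe.2 (Finset.mem_Ico.2 ⟨h1, h2⟩), by simp⟩)
      | succ k ih =>
        intro i h1 h2
        by_cases h : n ≤ i
        · exact ih i (by omega) h2
        · have h3 : C (x (0 + i)) - X (lam ⟨i, by omega⟩) * C (x (0 + i + 1)) ∈ EE (ZZ ⊥ x lam 0) (fun i => C (x i)) 1 (Finset.Ico n d) :=
            Ideal.mem_sup_left (Ideal.mem_sup_right (Ideal.subset_span ⟨⟨i, by omega⟩, rfl⟩))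
          have := Ideal.add_mem _ h3 (Ideal.mul_mem_left _ (X (lam ⟨i, by omega⟩)) (ih (0 + i + 1) (by omega) (by omega)))
          rwa [sub_add_cancel, zero_add] at this
    exact key n i (by omega) hi

theorem nzs [IsLocalRing B] (x : ℕ → B) {n d : ℕ} (hn : n < d) (lam : Fin n → Λ)
    (hG : Good (ZZ ⊥ x lam 0) (fun i => C (x i)) n d) (hr : (Ideal.span (x '' (Set.Iio d))).radical = maximalIdeal B)
    (s : MvPolynomial Λ B) (hs : s ∉ (maximalIdeal B).map (C (σ := Λ))) (α : ℕ → ℕ) :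
    Nz (EE (ZZ ⊥ x lam 0) (fun i => C (x i)) α (Finset.Ico n d)) s := by
  refine sN hG ?_ α
  rw [EE_all x hn]
  exact mccoy _ hr s hs

theorem Nz.loc {T : Type} [CommRing T] [Algebra B T] (M : Submonoid B) [IsLocalization M T] {I : Ideal B} {a : B} (h : Nz I a) :
    Nz (I.map (algebraMap B T)) (algebraMap B T a) := by
  intro g hg
  obtain ⟨g0, s, rfl⟩ := IsLocalization.exists_mk'_eq M g
  rw [← IsLocalization.mk'_one (M := M) T a, ← IsLocalization.mk'_mul, one_mul, IsLocalization.mk'_mem_map_algebraMap_iff] at hg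
  obtain ⟨t, ht, h1⟩ := hg
  rw [IsLocalization.mk'_mem_map_algebraMap_iff]
  exact ⟨t, ht, h _ (by rwa [mul_left_comm] at h1)⟩
end
end HH

namespace HH
open MvPolynomial

noncomputable def xx {R : Type} [CommRing R] (Ω : Type) [CommRing Ω] [Algebra R Ω] {d : ℕ} (x : Fin d → R) (i : ℕ) : Ω :=
  if h : i < d then algebraMap R Ω (x ⟨i, h⟩) else 0

theorem xx_fin {R : Type} [CommRing R] (Ω : Type) [CommRing Ω] [Algebra R Ω] {d : ℕ} (x : Fin d → R) (i : Fin d) :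
    xx Ω x i = algebraMap R Ω (x i) := by rw [xx, dif_pos i.2]

theorem EE_fin {R : Type} [CommRing R] (Ω : Type) [CommRing Ω] [Algebra R Ω] {d : ℕ} (x : Fin d → R) (α : ℕ → ℕ) (J : Finset ℕ)
    (hJ : J ⊆ Finset.Ico 0 d) : EE ⊥ (xx Ω x) α J =
      Ideal.span ((fun i : Fin d => algebraMap R Ω (x i) ^ α i) '' ((Finset.univ.filter fun i : Fin d => (i : ℕ) ∈ J : Finset (Fin d)) : Set (Fin d))) := by
  rw [EE, bot_sup_eq]
  congr 1
  ext t
  constructor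
  · rintro ⟨i, hi, rfl⟩
    have := (Finset.mem_Ico.1 (hJ hi)).2
    exact ⟨⟨i, this⟩, by simpa using hi, by simp [xx, this]⟩
  · rintro ⟨i, hi, rfl⟩
    exact ⟨i, by simpa using hi, by simp only [xx_fin]⟩

section
variable {R : Type} [CommRing R] [IsDomain R] [IsNoetherianRing R] [IsLocalRing R]
    [IsAdicComplete (maximalIdeal R) R] {d : ℕ} {F : Type} [Field F] [Algebra R F] [IsAlgClosed F] [Algebra.IsAlgebraic R F]

theorem good0 (p : ℕ) [Fact p.Prime] [CharP R p] (hd : ringKrullDim R = d) (x : Fin d → R)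
    (hx : (Ideal.span (Set.range x)).radical = maximalIdeal R) (hi : Function.Injective (algebraMap R F)) : Good ⊥ (xx (integralClosure R F) x) 0 d := by
  classical
  have hE := env_plus R F hi
  have : CharP (integralClosure R F) p := charP_of_injective_algebraMap hE.inj p
  constructor
  · intro α J j hJ hj hjJ g hg
    rw [EE_fin _ _ _ _ hJ] at hg ⊢
    have hjd := (Finset.mem_Ico.1 hj).2
    refine regO p hE hd x hx (fun i => α i) 1 _ ⟨j, hjd⟩ (by simpa using hjJ) g ?_
    rw [pow_one, ← xx_fin]
    exact hg
  · intro J hJ g hg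
    have hJ0 : J ⊆ Finset.Ico 0 d := hJ.trans (Finset.Ico_subset_Ico_left (Nat.zero_le _))
    rw [EE_fin _ _ _ _ hJ0]
    simp only [Pi.one_apply, pow_one]
    refine thmB p hd x hx hi _ g fun N => ?_
    refine SetLike.le_def.1 (sup_le bot_le (Ideal.span_le.2 ?_)) (hg N)
    rintro _ ⟨i, hiI, rfl⟩
    have hid : i < d := (Finset.mem_Ico.1 hiI).2
    have e : xx (integralClosure R F) x i = algebraMap R (integralClosure R F) (x ⟨i, hid⟩) := dif_pos hid
    beta_reduce
    rw [e]
    split_ifs with h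
    · rw [pow_one]
      exact Ideal.mem_sup_left (Ideal.subset_span ⟨⟨i, hid⟩, by simpa using h, rfl⟩)
    · exact Ideal.mem_sup_right (Ideal.pow_mem_pow (Ideal.subset_span (Set.mem_range_self (⟨i, hid⟩ : Fin d))) N)

theorem rad0 (x : Fin d → R) (hx : (Ideal.span (Set.range x)).radical = maximalIdeal R)
    (hi : Function.Injective (algebraMap R F)) [IsLocalRing (integralClosure R F)] :
    (Ideal.span (xx (integralClosure R F) x '' Set.Iio d)).radical = maximalIdeal (integralClosure R F) := by
  have hE := env_plus R F hi
  have hs : xx (integralClosure R F) x '' Set.Iio d = Set.range fun i => algebraMap R (integralClosure R F) (x i) := by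
    ext t
    constructor
    · rintro ⟨i, hi, rfl⟩
      exact ⟨⟨i, hi⟩, (xx_fin _ x ⟨i, hi⟩).symm⟩
    · rintro ⟨i, rfl⟩
      exact ⟨i, i.2, xx_fin _ _ _⟩
  rw [hs]
  have : Algebra.IsIntegral R (integralClosure R F) := ⟨hE.int⟩
  apply le_antisymm
  · rw [(maximalIdeal.isMaximal (integralClosure R F)).isPrime.radical_le_iff]
    exact le_maximalIdeal fun h => one_notMem hE x hx ((Ideal.eq_top_iff_one _).1 h)
  · rw [Ideal.radical_eq_sInf]
    refine le_sInf ?_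
    rintro Q ⟨hQ, hQp⟩
    have h1 : maximalIdeal R ≤ Q.comap (algebraMap R (integralClosure R F)) := by
      rw [← hx, (Ideal.IsPrime.comap (hK := hQp) _).radical_le_iff, Ideal.span_le]
      rintro _ ⟨i, rfl⟩
      exact hQ (Ideal.subset_span ⟨i, rfl⟩)
    have h2 : Q.comap (algebraMap R (integralClosure R F)) = maximalIdeal R :=
      ((maximalIdeal.isMaximal R).eq_of_le (Ideal.IsPrime.comap (hK := hQp) _).ne_top h1).symm
    have h3 := Ideal.isMaximal_of_isIntegral_of_isMaximal_comap (R := R) Q (h2 ▸ maximalIdeal.isMaximal R)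
    rw [eq_maximalIdeal h3]
end

section
variable {T : Type} [CommRing T]

theorem wr_snoc (l : List T) (a : T) (h : RingTheory.Sequence.IsWeaklyRegular T l) (ha : Nz (Ideal.ofList l) a) :
    RingTheory.Sequence.IsWeaklyRegular T (l ++ [a]) := by
  rw [RingTheory.Sequence.isWeaklyRegular_append_iff, RingTheory.Sequence.isWeaklyRegular_singleton_iff,
    isSMulRegular_quotient_iff_mem_of_smul_mem]
  refine ⟨h, fun g hg => ?_⟩
  rw [Ideal.smul_top_eq_map, Algebra.algebraMap_self, Ideal.map_id] at hg ⊢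
  exact ha g hg

theorem ofList_ofFn {k : ℕ} (g : Fin k → T) : Ideal.ofList (List.ofFn g) = Ideal.span (Set.range g) := by
  rw [Ideal.ofList]
  congr 1
  ext t
  simp [List.mem_ofFn]

theorem wr_ofFn (l0 : List T) (h0 : RingTheory.Sequence.IsWeaklyRegular T l0) (k : ℕ) (g : Fin k → T)
    (h : ∀ i : Fin k, Nz (Ideal.ofList l0 ⊔ Ideal.span (g '' {j | j < i})) (g i)) :
    RingTheory.Sequence.IsWeaklyRegular T (l0 ++ List.ofFn g) := by
  induction k with
  | zero => simpa using h0
  | succ k ih =>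
    rw [List.ofFn_succ', List.concat_eq_append, ← List.append_assoc]
    refine wr_snoc _ _ (ih _ fun i => ?_) ?_
    · have := h i.castSucc
      have e : g '' {j | j < i.castSucc} = (fun i : Fin k => g i.castSucc) '' {j | j < i} := by
        ext t
        constructor
        · rintro ⟨j, hj, rfl⟩
          have hjk : (j : ℕ) < k := lt_trans (Fin.lt_def.1 hj) i.2
          exact ⟨⟨j, hjk⟩, Fin.lt_def.2 (Fin.lt_def.1 hj), rfl⟩
        · rintro ⟨j, hj, rfl⟩
          exact ⟨j.castSucc, Fin.castSucc_lt_castSucc_iff.2 hj, rfl⟩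
      rwa [e] at this
    · have := h (Fin.last k)
      rw [Ideal.ofList_append, ofList_ofFn]
      convert this using 4
      ext t
      constructor
      · rintro ⟨j, rfl⟩
        exact ⟨j.castSucc, Fin.castSucc_lt_last j, rfl⟩
      · rintro ⟨j, hj, rfl⟩
        exact ⟨⟨j, Fin.lt_def.1 hj⟩, rfl⟩
end

section
variable {B : Type} [CommRing B] {Λ : Type} {T : Type} [CommRing T] [Algebra (MvPolynomial Λ B) T]

theorem ideal_eq (X' : ℕ → B) {k : ℕ} (lam : Fin k → Λ) (S : Finset ℕ) :
    (EE (ZZ ⊥ X' lam 0) (fun i => C (X' i)) 1 S).map (algebraMap (MvPolynomial Λ B) T) =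
    Ideal.span ((fun i => algebraMap (MvPolynomial Λ B) T (C (X' i))) '' (S : Set ℕ)) ⊔
    Ideal.span (Set.range fun i : Fin k => algebraMap (MvPolynomial Λ B) T (C (X' i)) -
      algebraMap (MvPolynomial Λ B) T (X (lam i)) * algebraMap (MvPolynomial Λ B) T (C (X' (i + 1)))) := by
  rw [EE_map, EE, ZZ, Ideal.map_bot, bot_sup_eq, Ideal.map_span, ← Set.range_comp, sup_comm]
  congr 2
  · exact Set.image_congr fun i _ => by simp
  · congr 1
    ext i : 1
    simp

variable [IsLocalRing B] (M : Submonoid (MvPolynomial Λ B)) [IsLocalization M T]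

theorem part2 (hM : ∀ s ∈ M, s ∉ (maximalIdeal B).map (C (σ := Λ))) (X' : ℕ → B) {n d : ℕ} (hn : n < d) (lam : Fin n → Λ)
    (hG : Good (ZZ ⊥ X' lam 0) (fun i => C (X' i)) n d) (hr : (Ideal.span (X' '' (Set.Iio d))).radical = maximalIdeal B)
    (J : Finset ℕ) (hJ : J ⊆ Finset.Ico (n + 1) d) (W : Ideal T) (hW : W.FG)
    (hWX : W ≤ Ideal.span ((fun i => algebraMap (MvPolynomial Λ B) T (C (X' i))) '' (Finset.Ico n d : Set ℕ))) (g : T)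
    (hg : ∀ N, 0 < N → g ∈ (EE (ZZ ⊥ X' lam 0) (fun i => C (X' i)) 1 J).map (algebraMap (MvPolynomial Λ B) T) ⊔ W ^ N) :
    g ∈ (EE (ZZ ⊥ X' lam 0) (fun i => C (X' i)) 1 J).map (algebraMap (MvPolynomial Λ B) T) := by
  obtain ⟨g0, s, rfl⟩ := IsLocalization.exists_mk'_eq M g
  rw [IsLocalization.mk'_mem_map_algebraMap_iff]
  refine ⟨1, M.one_mem, ?_⟩
  rw [one_mul]
  refine hG.sep J hJ g0 fun N' => ?_
  set A := EE (ZZ ⊥ X' lam 0) (fun i => C (X' i)) (fun i => if i ∈ J then 1 else N') (Finset.Ico n d) with hA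
  have hWA : W ≤ (A.map (algebraMap (MvPolynomial Λ B) T)).radical := by
    refine hWX.trans (Ideal.span_le.2 ?_)
    rintro _ ⟨i, hi, rfl⟩
    refine ⟨if i ∈ J then 1 else N', ?_⟩
    rw [← map_pow]
    exact Ideal.mem_map_of_mem _ (EE_pow (x := fun i => C (X' i)) (α := fun i => if i ∈ J then 1 else N') hi)
  obtain ⟨m, hm⟩ := Ideal.exists_pow_le_of_le_radical_of_fg hWA hW
  have h1 := SetLike.le_def.1 (sup_le (Ideal.map_mono (EE_mono _ _ fun i hi => ⟨Finset.Ico_subset_Ico_left (Nat.le_succ _) (hJ hi), by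
    simp [hi]⟩)) ((Ideal.pow_le_pow_right (Nat.le_succ m)).trans hm)) (hg (m + 1) (Nat.succ_pos m))
  rw [IsLocalization.mk'_mem_map_algebraMap_iff] at h1
  obtain ⟨t, ht, h2⟩ := h1
  exact nzs X' hn lam hG hr t (hM t ht) _ _ h2
end
end HH

namespace HH
theorem gen {Ω Λ T : Type} [CommRing Ω] [IsLocalRing Ω] [CommRing T] [Algebra (MvPolynomial Λ Ω) T]
    (𝔭 : Ideal (MvPolynomial Λ Ω)) [𝔭.IsPrime] (h𝔭 : 𝔭 = Ideal.map (MvPolynomial.C (σ := Λ)) (maximalIdeal Ω))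
    [IsLocalization.AtPrime T 𝔭] (X' : ℕ → Ω) {d : ℕ} (hG0 : Good ⊥ X' 0 d)
    (hr : (Ideal.span (X' '' Set.Iio d)).radical = maximalIdeal Ω) (n : ℕ) (hn : n + 1 ≤ d)
    (lam : Fin n → Λ) (hlam : Function.Injective lam) {h l : ℕ}
    (jy : Fin h → Fin d) (hjinj : Function.Injective jy) (hjy : ∀ i, n + 1 ≤ (jy i : ℕ))
    (jw : Fin l → Fin d) (hjw : ∀ i, n + 1 ≤ (jw i : ℕ))
    (F : ℕ → T) (hF : ∀ i, F i = algebraMap (MvPolynomial Λ Ω) T (MvPolynomial.C (X' i)))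
    (z : Fin n → T) (hzs : ∀ i, z i = F i - algebraMap (MvPolynomial Λ Ω) T (MvPolynomial.X (lam i)) * F (i + 1))
    (ys zs ws : List T) (hys : ys = List.ofFn fun i => F (jy i)) (hzz : zs = List.ofFn z) (hws : ws = List.ofFn fun i => F (jw i)) :
    RingTheory.Sequence.IsRegular T (ys ++ zs ++ [F n]) ∧
      (⨅ (N : ℕ) (_ : 0 < N), (Ideal.span {a | a ∈ ys ++ zs} ⊔ (Ideal.span (insert (F n) {a | a ∈ ws})) ^ N)) =
        Ideal.span {a | a ∈ ys ++ zs} := by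
  classical
  obtain rfl : F = fun i => algebraMap (MvPolynomial Λ Ω) T (MvPolynomial.C (X' i)) := funext hF
  beta_reduce at hzs
  subst hys hzz hws
  let lm : ∀ k : ℕ, k ≤ n → Fin k → Λ := fun k hk i => lam ⟨i, by have := i.2; omega⟩
  have hlm : ∀ k hk, Function.Injective (lm k hk) := by
    intro k hk i j hij
    exact Fin.ext (Fin.mk.inj_iff.1 (hlam hij))
  have hcl := fun k (hk : k ≤ n) => claim d k ⊥ X' 0 hG0 (by omega) (lm k hk) (hlm k hk)
  simp only [zero_add] at hcl
  let Jy : Finset ℕ := Finset.univ.image fun i => (jy i : ℕ)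
  have hJy : Jy ⊆ Finset.Ico (n + 1) d := by
    intro t ht
    obtain ⟨i, -, rfl⟩ := Finset.mem_image.1 ht
    exact Finset.mem_Ico.2 ⟨hjy i, (jy i).2⟩
  have hysp : Ideal.ofList (List.ofFn fun i => (algebraMap (MvPolynomial Λ Ω) T) (MvPolynomial.C (X' (jy i)))) = Ideal.span ((fun i => (algebraMap (MvPolynomial Λ Ω) T) (MvPolynomial.C (X' i))) '' (Jy : Set ℕ)) := by
    rw [ofList_ofFn, Finset.coe_image, Finset.coe_univ, Set.image_univ, ← Set.range_comp]
    rfl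
  have hI : Ideal.ofList ((List.ofFn fun i => (algebraMap (MvPolynomial Λ Ω) T) (MvPolynomial.C (X' (jy i)))) ++ List.ofFn z) = (EE (ZZ ⊥ X' (lm n le_rfl) 0) (fun i => MvPolynomial.C (X' i)) 1 Jy).map (algebraMap (MvPolynomial Λ Ω) T) := by
    rw [ideal_eq, Ideal.ofList_append, hysp]
    congr 1
    rw [ofList_ofFn]
    congr 2
    ext i : 1
    exact hzs i
  constructor
  · refine ⟨?_, ?_⟩
    · refine wr_snoc _ _ (wr_ofFn _ ?_ _ _ ?_) ?_
      · have := wr_ofFn ([] : List (T)) (RingTheory.Sequence.IsWeaklyRegular.nil _ _) h (fun i => (algebraMap (MvPolynomial Λ Ω) T) (MvPolynomial.C (X' (jy i)))) (fun i => ?_)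
        · simpa only [List.nil_append] using this
        · have h1 := ((hcl 0 (Nat.zero_le _)).1.reg 1 ((Finset.univ.filter fun j => j < i).image fun i => (jy i : ℕ)) (jy i)
            (by
              intro t ht
              obtain ⟨i, -, rfl⟩ := Finset.mem_image.1 ht
              exact Finset.mem_Ico.2 ⟨Nat.zero_le _, (jy i).2⟩)
            (Finset.mem_Ico.2 ⟨Nat.zero_le _, (jy i).2⟩)
            (by
              intro ht
              obtain ⟨j, hj, hji⟩ := Finset.mem_image.1 ht
              have := (Finset.mem_filter.1 hj).2
              rw [hjinj (Fin.ext hji)] at this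
              exact lt_irrefl _ this)).loc (T := T) 𝔭.primeCompl
          rw [ideal_eq, Set.range_eq_empty, Ideal.span_empty, sup_bot_eq] at h1
          rw [Ideal.ofList_nil, bot_sup_eq]
          convert h1 using 2
          rw [Finset.coe_image, ← Set.image_comp]
          ext t
          simp
      · intro i
        have h1 := ((hcl i i.2.le).2 (lam i) (by
          rintro ⟨j, hj⟩
          have h2 := Fin.ext_iff.1 (hlam hj)
          simp only at h2
          have := j.2
          omega) 1 Jy (hJy.trans (Finset.Ico_subset_Ico_left (by have := i.2; omega)))).loc (T := T) 𝔭.primeCompl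
        rw [hzs, hysp]
        rw [ideal_eq, map_sub, map_mul] at h1
        convert h1 using 3
        ext t
        constructor
        · rintro ⟨j, hj, rfl⟩
          exact ⟨⟨j, Fin.lt_def.1 hj⟩, (hzs j).symm⟩
        · rintro ⟨j, rfl⟩
          exact ⟨⟨j, by have := j.2; have := i.2; omega⟩, Fin.lt_def.2 j.2, hzs _⟩
      · rw [hI]
        exact ((hcl n le_rfl).1.nz_z 1 Jy hJy (by omega)).loc (T := T) 𝔭.primeCompl
    · intro htop
      rw [Ideal.smul_top_eq_map, Algebra.algebraMap_self, Ideal.map_id] at htop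
      have hle : Ideal.ofList ((List.ofFn fun i => (algebraMap (MvPolynomial Λ Ω) T) (MvPolynomial.C (X' (jy i)))) ++ List.ofFn z ++ [(algebraMap (MvPolynomial Λ Ω) T) (MvPolynomial.C (X' n))]) ≤ 𝔭.map (algebraMap (MvPolynomial Λ Ω) T) := by
        have hXm : ∀ i, i < d → (algebraMap (MvPolynomial Λ Ω) T) (MvPolynomial.C (X' i)) ∈ 𝔭.map (algebraMap (MvPolynomial Λ Ω) T) := fun i hid =>
          Ideal.mem_map_of_mem _ (h𝔭 ▸ Ideal.mem_map_of_mem _ (hr ▸ Ideal.le_radical (Ideal.subset_span ⟨i, hid, rfl⟩)))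
        rw [Ideal.ofList_append, Ideal.ofList_singleton, hI, ideal_eq]
        refine sup_le (sup_le (Ideal.span_le.2 ?_) (Ideal.span_le.2 ?_)) (Ideal.span_le.2 ?_)
        · rintro _ ⟨i, hiJ, rfl⟩
          exact hXm i (Finset.mem_Ico.1 (hJy hiJ)).2
        · rintro _ ⟨i, rfl⟩
          have := i.2
          exact Ideal.sub_mem _ (hXm _ (by omega)) (Ideal.mul_mem_left _ _ (hXm _ (by omega)))
        · rintro _ rfl
          exact hXm n (by omega)
      replace hle := htop.le.trans hle
      rw [top_le_iff, Ideal.eq_top_iff_one, ← map_one (algebraMap (MvPolynomial Λ Ω) T),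
        IsLocalization.algebraMap_mem_map_algebraMap_iff 𝔭.primeCompl] at hle
      obtain ⟨t, ht, h1⟩ := hle
      rw [mul_one] at h1
      exact ht h1
  · have hS : Ideal.span {a | a ∈ (List.ofFn fun i => (algebraMap (MvPolynomial Λ Ω) T) (MvPolynomial.C (X' (jy i)))) ++ List.ofFn z} = (EE (ZZ ⊥ X' (lm n le_rfl) 0) (fun i => MvPolynomial.C (X' i)) 1 Jy).map (algebraMap (MvPolynomial Λ Ω) T) := hI
    rw [hS]
    apply le_antisymm
    · intro g hg
      refine part2 𝔭.primeCompl (fun s hs => h𝔭 ▸ hs) X' (by omega) (lm n le_rfl) (hcl n le_rfl).1 hr Jy hJy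
        (Ideal.span (insert ((algebraMap (MvPolynomial Λ Ω) T) (MvPolynomial.C (X' n))) {a | a ∈ List.ofFn fun i => (algebraMap (MvPolynomial Λ Ω) T) (MvPolynomial.C (X' (jw i)))})) ?_ ?_ g ?_
      · exact Submodule.fg_span (((List.ofFn fun i => (algebraMap (MvPolynomial Λ Ω) T) (MvPolynomial.C (X' (jw i)))).finite_toSet).insert _)
      · refine Ideal.span_mono (Set.insert_subset ?_ ?_)
        · exact ⟨n, Finset.mem_coe.2 (Finset.mem_Ico.2 ⟨le_rfl, by omega⟩), rfl⟩
        · intro a ha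
          obtain ⟨i, rfl⟩ := List.mem_ofFn.1 ha
          exact ⟨jw i, Finset.mem_coe.2 (Finset.mem_Ico.2 ⟨(Nat.le_succ n).trans (hjw i), (jw i).2⟩), rfl⟩
      · intro N hN
        exact (Submodule.mem_iInf _).1 ((Submodule.mem_iInf _).1 hg N) hN
    · exact le_iInf fun N => le_iInf fun _ => le_sup_left
end HH

/-- With `T = R⁺(t_λ)`, `z_i = x_i - t_{λ_i} x_{i+1}` and subsets
`{y₁, …, y_h}, {w₁, …, w_l} ⊆ X_n = {x_{n+2}, …, x_d}` (1-indexed):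
(1) `y₁, …, y_h, z₁, …, zₙ, x_{n+1}` is a regular sequence on `T`, and
(2) `⋂_{N ≥ 1} ((y, z)T + ((x_{n+1}, w)T)^N) = (y, z)T`. -/
theorem stmt14 (R : Type) [CommRing R] [IsDomain R] [IsNoetherianRing R] [IsLocalRing R]
    [IsAdicComplete (maximalIdeal R) R]
    (p : ℕ) [Fact p.Prime] [CharP R p]
    [IsLocalRing (RPlus R)] (Λ : Type)
    [(Ideal.map (MvPolynomial.C (σ := Λ)) (maximalIdeal (RPlus R))).IsPrime]
    (d : ℕ) (x : Fin d → R) (hx : IsSOP R x)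
    (lam : Fin (d - 1) → Λ) (hlam : Function.Injective lam)
    (n : ℕ) (hn : n + 1 ≤ d)
    (h l : ℕ) (hh : h ≤ d - n - 1) (hl : l ≤ d - n - 1)
    (y : Fin h → R) (hyinj : Function.Injective y)
    (hy : ∀ i, ∃ j : Fin d, n + 1 ≤ (j : ℕ) ∧ y i = x j)
    (w : Fin l → R) (hwinj : Function.Injective w)
    (hw : ∀ i, ∃ j : Fin d, n + 1 ≤ (j : ℕ) ∧ w i = x j) :
    let f := toT R Λ
    let z : Fin (d - 1) → TRing R Λ := fun i =>
      f (x ⟨(i : ℕ), lt_of_lt_of_le i.isLt (Nat.sub_le d 1)⟩) -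
        algebraMap (MvPolynomial Λ (RPlus R)) (TRing R Λ) (MvPolynomial.X (lam i)) *
          f (x ⟨(i : ℕ) + 1, Nat.add_lt_of_lt_sub i.isLt⟩)
    let ys : List (TRing R Λ) := List.ofFn fun i => f (y i)
    let zs : List (TRing R Λ) :=
      List.ofFn fun i : Fin n => z ⟨(i : ℕ), by have := i.isLt; omega⟩
    RingTheory.Sequence.IsRegular (TRing R Λ) (ys ++ zs ++ [f (x ⟨n, by omega⟩)]) ∧
      (⨅ (N : ℕ) (_ : 0 < N),
          (Ideal.span {a | a ∈ ys ++ zs} ⊔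
            (Ideal.span (insert (f (x ⟨n, by omega⟩))
              {a | a ∈ List.ofFn fun i => f (w i)})) ^ N)) =
        Ideal.span {a | a ∈ ys ++ zs} := by
  classical
  intro f z ys zs
  have hi : Function.Injective (algebraMap R (AlgebraicClosure (FractionRing R))) := by
    rw [IsScalarTower.algebraMap_eq R (FractionRing R) (AlgebraicClosure (FractionRing R))]
    exact (algebraMap (FractionRing R) (AlgebraicClosure (FractionRing R))).injective.comp (IsFractionRing.injective R _)
  have hal : Algebra.IsAlgebraic R (AlgebraicClosure (FractionRing R)) :=
    (IsFractionRing.comap_isAlgebraic_iff (A := R) (K := FractionRing R) (C := AlgebraicClosure (FractionRing R))).2 inferInstance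
  let X' : ℕ → RPlus R := HH.xx (RPlus R) x
  have hG0 : HH.Good ⊥ X' 0 d := HH.good0 p hx.1 x hx.2 hi
  have hr : (Ideal.span (X' '' Set.Iio d)).radical = maximalIdeal (RPlus R) := HH.rad0 x hx.2 hi
  let ι := algebraMap (MvPolynomial Λ (RPlus R)) (TRing R Λ)
  let 𝔭 := Ideal.map (MvPolynomial.C (σ := Λ)) (maximalIdeal (RPlus R))
  have hf : ∀ i : Fin d, f (x i) = ι (MvPolynomial.C (X' i)) := by
    intro i
    simp only [X', HH.xx_fin]
    rfl
  choose jy hjy hyx using hy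
  choose jw hjw hwx using hw
  have hX : ∀ i (hid : i < d), f (x ⟨i, hid⟩) = ι (MvPolynomial.C (X' i)) := fun i hid => hf ⟨i, hid⟩
  have hm := HH.gen (T := TRing R Λ) 𝔭 rfl X' hG0 hr n hn (fun i => lam ⟨i, by have := i.2; omega⟩)
    (fun i j hij => Fin.ext (Fin.mk.inj_iff.1 (hlam hij))) jy (fun a b hab => hyinj (by rw [hyx, hyx, hab])) hjy jw hjw
    (fun i => ι (MvPolynomial.C (X' i))) (fun _ => rfl)
    (fun i : Fin n => z ⟨(i : ℕ), by have := i.isLt; omega⟩) (fun i => by simp only [z, hX])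
    ys zs (List.ofFn fun i => f (w i)) (by simp only [ys, hyx, hf]) rfl (by simp only [hwx, hf])
  simp only [hX]
  exact hm
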